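/- Let q be a power of 2, let 𝐅̄_q be an algebraic closure of 𝐅_q, and let (V,T) be a form module over 𝐅̄_q with symbol (λ_i, χ_i, m_i)_{1≤i≤k}. With χ_{k+1} := 0, set n₁ = #{1 ≤ i ≤ k−1 : χ_i + χ_{i+1} ≤ λ_i and χ_i ≠ λ_i/2} and n₂ = #{1 ≤ i ≤ k : χ_i + χ_{i+1} ≤ λ_i and χ_i ≠ λ_i/2}. (i) If V is defective (V^⊥ ≠ 0), then the number of isomorphism classes of form modules (V₀,T₀) over 𝐅_q whose scalar extension to 𝐅̄_q is isomorphic to (V,T) equals 2^{n₁}. (ii) If V is non-defective (V^⊥ = 0), then this number equals 2^{n₂}. -/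

import Mathlib

open Module Finset

/-- The radical `V^⊥ = {v | ⟨v,w⟩ = 0 for all w}` of the polar form of `Q`. -/
def QuadraticForm.polarRadical {F V : Type*} [Field F] [AddCommGroup V] [Module F V]
    (Q : QuadraticForm F V) : Submodule F V :=
  LinearMap.ker (QuadraticMap.polarBilin Q)

/-- A quadratic space `(V, Q)` (in characteristic 2) is non-degenerate if `V ≠ 0`,
`dim V^⊥ ≤ 1` and `Q(v) ≠ 0` for every nonzero `v ∈ V^⊥`. -/
def QuadraticForm.IsNondegenerateFormSpace {F V : Type*} [Field F] [AddCommGroup V] [Module F V]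
    (Q : QuadraticForm F V) : Prop :=
  Nontrivial V ∧ Module.finrank F Q.polarRadical ≤ 1 ∧
    ∀ v ∈ Q.polarRadical, v ≠ 0 → Q v ≠ 0

/-- Membership in the orthogonal Lie algebra
`𝔬(V) = {x ∈ End(V) | ⟨xv, v⟩ = 0 ∀ v, tr x = 0}`. -/
def QuadraticForm.mem_oLie {F V : Type*} [Field F] [AddCommGroup V] [Module F V]
    (Q : QuadraticForm F V) (x : Module.End F V) : Prop :=
  (∀ v : V, QuadraticMap.polar Q (x v) v = 0) ∧ LinearMap.trace F V x = 0

/-- Two endomorphisms of `V` are conjugate under the orthogonal group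
`O(V) = {g ∈ GL(V) | Q(gv) = Q(v) ∀ v}`. -/
def QuadraticForm.OConj {F V : Type*} [Field F] [AddCommGroup V] [Module F V]
    (Q : QuadraticForm F V) (x y : Module.End F V) : Prop :=
  ∃ g : V ≃ₗ[F] V, (∀ v : V, Q (g v) = Q v) ∧
    y = g.toLinearMap ∘ₗ x ∘ₗ g.symm.toLinearMap

/-- The number of orbits of `O(V)` acting by conjugation on the set of nilpotent
elements of `𝔬(V)`. -/
noncomputable def QuadraticForm.numNilpotentOOrbits {F V : Type*} [Field F] [AddCommGroup V]
    [Module F V] (Q : QuadraticForm F V) : ℕ :=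
  Nat.card (Quot fun x y : {x : Module.End F V // Q.mem_oLie x ∧ IsNilpotent x} =>
    Q.OConj x.1 y.1)


/-- `(V, Q)` contains a totally singular subspace of dimension `d`
(so the Witt index of `Q` is at least `d`). -/
def QuadraticForm.HasTotallySingularSubspace {F V : Type*} [Field F] [AddCommGroup V]
    [Module F V] (Q : QuadraticForm F V) (d : ℕ) : Prop :=
  ∃ W : Submodule F V, Module.finrank F W = d ∧ ∀ w ∈ W, Q w = 0

/-- `(V₁, Q₁, T₁)` over `K` is (isomorphic to) the scalar extension of the form module
`(V₀, Q₀, T₀)` over `F ⊆ K`: there is an additive, `algebraMap`-semilinear map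
`σ : V₀ → V₁` carrying `Q₀` to `Q₁` and intertwining `T₀` with `T₁`, which carries some
`F`-basis of `V₀` to a `K`-basis of `V₁`.  (The extended quadratic form is determined by
its values and the values of its polar form on such a basis.) -/
def QuadraticForm.IsScalarExtension {F K V₀ V₁ : Type*} [Field F] [Field K] [Algebra F K]
    [AddCommGroup V₀] [Module F V₀] [AddCommGroup V₁] [Module K V₁]
    (Q₀ : QuadraticForm F V₀) (T₀ : Module.End F V₀)
    (Q₁ : QuadraticForm K V₁) (T₁ : Module.End K V₁) : Prop :=
  ∃ σ : V₀ →ₛₗ[algebraMap F K] V₁,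
    (∀ v : V₀, Q₁ (σ v) = algebraMap F K (Q₀ v)) ∧
    (∀ v : V₀, σ (T₀ v) = T₁ (σ v)) ∧
    ∃ (n : ℕ) (b : Basis (Fin n) F V₀),
      LinearIndependent K (fun i => σ (b i)) ∧
      Submodule.span K (Set.range fun i => σ (b i)) = ⊤

/-- The index function `χ(V,T) : ℕ → ℕ`,
`χ(m) = min {j ≥ 0 | Q(T^j v) = 0 for all v with T^m v = 0}`. -/
noncomputable def QuadraticForm.indexChi {F V : Type*} [Field F] [AddCommGroup V] [Module F V]
    (Q : QuadraticForm F V) (T : Module.End F V) (m : ℕ) : ℕ :=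
  sInf {j : ℕ | ∀ v : V, (T ^ m) v = 0 → Q ((T ^ j) v) = 0}

/-- `(lam i, chi i, mult i)` for `i < k` is the symbol of the form module `(V, Q, T)`:
`lam 0 > lam 1 > ⋯ > lam (k-1) ≥ 1` are the distinct Jordan block sizes of `T` (encoded by
`dim ker T^j = Σ_i (mult i) · min(j, lam i)` for all `j`), `mult i ≥ 1` are their
multiplicities, and `chi i = χ(V,T)(lam i)`. -/
def QuadraticForm.IsSymbolOf {F V : Type*} [Field F] [AddCommGroup V] [Module F V]
    (Q : QuadraticForm F V) (T : Module.End F V) (k : ℕ) (lam mult chi : ℕ → ℕ) : Prop :=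
  (∀ i : ℕ, i + 1 < k → lam (i + 1) < lam i) ∧
  (∀ i < k, 1 ≤ lam i) ∧
  (∀ i < k, 1 ≤ mult i) ∧
  (∀ j : ℕ, Module.finrank F (LinearMap.ker (T ^ j)) =
      ∑ i ∈ Finset.range k, mult i * min j (lam i)) ∧
  (∀ i < k, chi i = Q.indexChi T (lam i))

/-- `n₁ = #{1 ≤ i ≤ k-1 | χ_i + χ_{i+1} ≤ λ_i, χ_i ≠ λ_i/2}` (in 0-indexed form). -/
def symbolN1 (k : ℕ) (lam chi : ℕ → ℕ) : ℕ :=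
  ((Finset.range k).filter fun i =>
    i + 1 < k ∧ chi i + chi (i + 1) ≤ lam i ∧ 2 * chi i ≠ lam i).card

/-- `n₂ = #{1 ≤ i ≤ k | χ_i + χ_{i+1} ≤ λ_i, χ_i ≠ λ_i/2}` where `χ_{k+1} := 0`
(in 0-indexed form: `χ_k := 0`). -/
def symbolN2 (k : ℕ) (lam chi : ℕ → ℕ) : ℕ :=
  ((Finset.range k).filter fun i =>
    chi i + (if i + 1 < k then chi (i + 1) else 0) ≤ lam i ∧ 2 * chi i ≠ lam i).card

namespace FormMod

universe u v w z t

/-- bundled space with a quadratic form and an endomorphism -/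
structure FM (k : Type u) [Field k] where
  V : Type v
  [acg : AddCommGroup V]
  [mod : Module k V]
  [fd : FiniteDimensional k V]
  Q : QuadraticForm k V
  T : Module.End k V

attribute [instance] FM.acg FM.mod FM.fd

section basics
variable {k : Type u} [Field k]

/-- polar form -/
def FM.B (X : FM.{u, v} k) : LinearMap.BilinForm k X.V := QuadraticMap.polarBilin X.Q

theorem FM.B_def (X : FM.{u, v} k) (a b : X.V) : X.B a b = QuadraticMap.polar X.Q a b := rfl

theorem FM.Q_add (X : FM.{u, v} k) (a b : X.V) : X.Q (a + b) = X.Q a + X.Q b + X.B a b := by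
  rw [X.B_def, QuadraticMap.polar]; ring

theorem FM.Q_smul (X : FM.{u, v} k) (c : k) (a : X.V) : X.Q (c • a) = c * c * X.Q a := by
  rw [QuadraticMap.map_smul]; rfl

theorem FM.B_comm (X : FM.{u, v} k) (a b : X.V) : X.B a b = X.B b a :=
  QuadraticMap.polar_comm _ _ _

theorem FM.tp (X : FM.{u, v} k) (i j : ℕ) (a : X.V) :
    (X.T ^ i) ((X.T ^ j) a) = (X.T ^ (i + j)) a := by
  rw [pow_add]; rfl

theorem FM.tp_succ (X : FM.{u, v} k) (i : ℕ) (a : X.V) :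
    (X.T ^ i) (X.T a) = (X.T ^ (i + 1)) a := by
  rw [pow_succ]; rfl

theorem FM.tp_succ' (X : FM.{u, v} k) (i : ℕ) (a : X.V) :
    X.T ((X.T ^ i) a) = (X.T ^ (i + 1)) a := by
  rw [pow_succ']; rfl

theorem FM.tp_zero_of_le (X : FM.{u, v} k) {i j : ℕ} {a : X.V} (h : (X.T ^ i) a = 0)
    (hij : i ≤ j) : (X.T ^ j) a = 0 := by
  obtain ⟨d, rfl⟩ := Nat.exists_eq_add_of_le hij
  rw [add_comm, ← X.tp, h, map_zero]

/-- `T` belongs to the Lie algebra -/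
def FM.Alt (X : FM.{u, v} k) : Prop := ∀ a, X.B (X.T a) a = 0

/-- admissible form modules -/
structure FM.Adm (X : FM.{u, v} k) : Prop where
  alt : X.Alt
  nil : IsNilpotent X.T
  rad : ∀ a, (∀ b, X.B a b = 0) → X.Q a = 0 → a = 0

/-- nondegenerate polar form -/
def FM.Nondef (X : FM.{u, v} k) : Prop := ∀ a, (∀ b, X.B a b = 0) → a = 0

/-- isometric equivariant maps -/
def IsHom (X : FM.{u, v} k) (Y : FM.{u, w} k) (e : X.V →ₗ[k] Y.V) : Prop :=
  (∀ a, Y.Q (e a) = X.Q a) ∧ ∀ a, e (X.T a) = Y.T (e a)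

/-- isomorphism -/
def Iso (X : FM.{u, v} k) (Y : FM.{u, w} k) : Prop :=
  ∃ g : X.V ≃ₗ[k] Y.V, (∀ a, Y.Q (g a) = X.Q a) ∧ ∀ a, g (X.T a) = Y.T (g a)

theorem Iso.refl (X : FM.{u, v} k) : Iso X X := ⟨LinearEquiv.refl _ _, fun _ => rfl, fun _ => rfl⟩

theorem Iso.symm {X : FM.{u, v} k} {Y : FM.{u, w} k} (h : Iso X Y) : Iso Y X := by
  obtain ⟨g, h1, h2⟩ := h
  refine ⟨g.symm, fun a => ?_, fun a => ?_⟩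
  · rw [← h1]; simp
  · apply g.injective; rw [h2]; simp

theorem Iso.trans {X : FM.{u, v} k} {Y : FM.{u, w} k} {Z : FM.{u, z} k}
    (h : Iso X Y) (h' : Iso Y Z) : Iso X Z := by
  obtain ⟨g, h1, h2⟩ := h
  obtain ⟨g', h1', h2'⟩ := h'
  exact ⟨g.trans g', fun a => by simp [h1, h1'], fun a => by simp [h2, h2']⟩

theorem IsHom.B {X : FM.{u, v} k} {Y : FM.{u, w} k} {e : X.V →ₗ[k] Y.V} (h : IsHom X Y e)
    (a b : X.V) : Y.B (e a) (e b) = X.B a b := by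
  rw [Y.B_def, X.B_def, QuadraticMap.polar, QuadraticMap.polar, ← map_add, h.1, h.1, h.1]

theorem IsHom.tp {X : FM.{u, v} k} {Y : FM.{u, w} k} {e : X.V →ₗ[k] Y.V} (h : IsHom X Y e)
    (n : ℕ) (a : X.V) : e ((X.T ^ n) a) = (Y.T ^ n) (e a) := by
  induction n with
  | zero => simp
  | succ n ih => rw [← X.tp_succ', h.2, ih, Y.tp_succ']

theorem IsHom.injective {X : FM.{u, v} k} {Y : FM.{u, w} k} {e : X.V →ₗ[k] Y.V} (h : IsHom X Y e)
    (hX : X.Adm) : Function.Injective e := by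
  rw [← LinearMap.ker_eq_bot, LinearMap.ker_eq_bot']
  intro a ha
  apply hX.rad
  · intro b; rw [← h.B, ha]; simp
  · rw [← h.1, ha]; simp

theorem IsHom.iso {X : FM.{u, v} k} {Y : FM.{u, w} k} {e : X.V →ₗ[k] Y.V} (h : IsHom X Y e)
    (hX : X.Adm) (hd : finrank k X.V = finrank k Y.V) : Iso X Y :=
  ⟨LinearMap.linearEquivOfInjective e (h.injective hX) hd,
    fun a => by simpa using h.1 a, fun a => by simpa using h.2 a⟩

theorem Iso.hom {X : FM.{u, v} k} {Y : FM.{u, w} k} (h : Iso X Y) :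
    ∃ g : X.V ≃ₗ[k] Y.V, IsHom X Y g.toLinearMap := by
  obtain ⟨g, h1, h2⟩ := h
  exact ⟨g, h1, h2⟩

theorem Iso.finrank {X : FM.{u, v} k} {Y : FM.{u, w} k} (h : Iso X Y) :
    finrank k X.V = finrank k Y.V := by
  obtain ⟨g, _⟩ := h
  exact g.finrank_eq

theorem Iso.alt {X : FM.{u, v} k} {Y : FM.{u, w} k} (h : Iso X Y) (hX : X.Alt) : Y.Alt := by
  obtain ⟨g, hg⟩ := h.symm.hom
  intro a
  rw [← hg.B, hg.2]
  exact hX _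

theorem Iso.nondef {X : FM.{u, v} k} {Y : FM.{u, w} k} (h : Iso X Y) (hX : X.Nondef) :
    Y.Nondef := by
  obtain ⟨g, hg⟩ := h.symm.hom
  intro a ha
  apply g.injective
  rw [map_zero]
  apply hX
  intro b
  obtain ⟨c, rfl⟩ := g.surjective b
  exact (hg.B a c).trans (ha c)

theorem Iso.tpow {X : FM.{u, v} k} {Y : FM.{u, w} k} (h : Iso X Y) {n : ℕ} (hX : X.T ^ n = 0) :
    Y.T ^ n = 0 := by
  obtain ⟨g, hg⟩ := h.symm.hom
  ext a
  apply g.injective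
  have := hg.tp n a
  simp only [LinearEquiv.coe_coe] at this
  rw [this, hX]; simp

theorem Iso.adm {X : FM.{u, v} k} {Y : FM.{u, w} k} (h : Iso X Y) (hX : X.Adm) : Y.Adm := by
  refine ⟨h.alt hX.alt, ?_, ?_⟩
  · obtain ⟨n, hn⟩ := hX.nil
    exact ⟨n, h.tpow hn⟩
  · obtain ⟨g, hg⟩ := h.symm.hom
    intro a ha hq
    apply g.injective
    rw [map_zero]
    apply hX.rad
    · intro b
      obtain ⟨c, rfl⟩ := g.surjective b
      exact (hg.B a c).trans (ha c)
    · exact (hg.1 a).trans hq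

/-- orthogonal direct sum -/
@[reducible] def FM.prod (X : FM.{u, v} k) (Y : FM.{u, w} k) : FM.{u, max v w} k where
  V := X.V × Y.V
  Q := QuadraticMap.prod X.Q Y.Q
  T := X.T.prodMap Y.T

theorem FM.prod_Q (X : FM.{u, v} k) (Y : FM.{u, w} k) (a : X.V) (b : Y.V) :
    (X.prod Y).Q (a, b) = X.Q a + Y.Q b := QuadraticMap.prod_apply _ _ _

theorem FM.prod_B (X : FM.{u, v} k) (Y : FM.{u, w} k) (a a' : X.V) (b b' : Y.V) :
    (X.prod Y).B (a, b) (a', b') = X.B a a' + Y.B b b' := QuadraticMap.polar_prod _ _ _ _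

theorem FM.prod_T (X : FM.{u, v} k) (Y : FM.{u, w} k) (a : X.V) (b : Y.V) :
    (X.prod Y).T (a, b) = (X.T a, Y.T b) := rfl

theorem FM.prod_tp (X : FM.{u, v} k) (Y : FM.{u, w} k) (n : ℕ) (a : X.V) (b : Y.V) :
    ((X.prod Y).T ^ n) (a, b) = ((X.T ^ n) a, (Y.T ^ n) b) := by
  induction n with
  | zero => rfl
  | succ n ih => rw [← FM.tp_succ', ih, FM.prod_T, X.tp_succ', Y.tp_succ']

theorem FM.prod_finrank (X : FM.{u, v} k) (Y : FM.{u, w} k) :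
    finrank k (X.prod Y).V = finrank k X.V + finrank k Y.V :=
  Module.finrank_prod

theorem FM.prod_alt {X : FM.{u, v} k} {Y : FM.{u, w} k} (hX : X.Alt) (hY : Y.Alt) :
    (X.prod Y).Alt := by
  rintro ⟨a, b⟩
  rw [FM.prod_T, FM.prod_B, hX, hY, add_zero]

theorem FM.prod_tpow {X : FM.{u, v} k} {Y : FM.{u, w} k} {n : ℕ} (hX : X.T ^ n = 0)
    (hY : Y.T ^ n = 0) : (X.prod Y).T ^ n = 0 := by
  apply LinearMap.ext
  rintro ⟨a, b⟩
  rw [FM.prod_tp, hX, hY]; rfl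

theorem FM.prod_nil {X : FM.{u, v} k} {Y : FM.{u, w} k} (hX : IsNilpotent X.T)
    (hY : IsNilpotent Y.T) : IsNilpotent (X.prod Y).T := by
  obtain ⟨n, hn⟩ := hX
  obtain ⟨m, hm⟩ := hY
  exact ⟨n + m, FM.prod_tpow (by rw [pow_add, hn, zero_mul]) (by rw [pow_add, hm, mul_zero])⟩

theorem FM.prod_nondef {X : FM.{u, v} k} {Y : FM.{u, w} k} (hX : X.Nondef) (hY : Y.Nondef) :
    (X.prod Y).Nondef := by
  rintro ⟨a, b⟩ h
  have h1 : a = 0 := hX a fun c => by have := h (c, 0); rw [FM.prod_B] at this; simpa using this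
  have h2 : b = 0 := hY b fun c => by have := h (0, c); rw [FM.prod_B] at this; simpa using this
  rw [h1, h2]; rfl

theorem FM.prod_adm {X : FM.{u, v} k} {Y : FM.{u, w} k} (hX : X.Adm) (hX' : X.Nondef)
    (hY : Y.Adm) : (X.prod Y).Adm := by
  refine ⟨FM.prod_alt hX.alt hY.alt, FM.prod_nil hX.nil hY.nil, ?_⟩
  rintro ⟨a, b⟩ h hq
  have h1 : a = 0 := hX' a fun c => by have := h (c, 0); rw [FM.prod_B] at this; simpa using this
  subst h1
  rw [FM.prod_Q] at hq
  have h2 : b = 0 := hY.rad b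
    (fun c => by have := h (0, c); rw [FM.prod_B] at this; simpa using this) (by simpa using hq)
  rw [h2]; rfl

theorem FM.adm_of_prod {X : FM.{u, v} k} {Y : FM.{u, w} k} (h : (X.prod Y).Adm) : Y.Adm := by
  refine ⟨fun a => ?_, ?_, fun a ha hq => ?_⟩
  · have := h.alt (0, a)
    rw [FM.prod_T, FM.prod_B] at this
    simpa using this
  · obtain ⟨n, hn⟩ := h.nil
    refine ⟨n, ?_⟩
    ext a
    have := X.prod_tp Y n 0 a
    rw [hn] at this
    exact (congrArg Prod.snd this).symm
  · have := h.rad (0, a) (fun ⟨b, c⟩ => by rw [FM.prod_B, ha]; simp) (by rw [FM.prod_Q, hq]; simp)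
    exact congrArg Prod.snd this

theorem FM.nondef_of_prod {X : FM.{u, v} k} {Y : FM.{u, w} k} (h : (X.prod Y).Nondef) :
    Y.Nondef := by
  intro a ha
  have := h (0, a) (fun ⟨b, c⟩ => by rw [FM.prod_B, ha]; simp)
  exact congrArg Prod.snd this

theorem FM.tpow_of_prod {X : FM.{u, v} k} {Y : FM.{u, w} k} {n : ℕ} (h : (X.prod Y).T ^ n = 0) :
    Y.T ^ n = 0 := by
  ext a
  have := X.prod_tp Y n 0 a
  rw [h] at this
  exact (congrArg Prod.snd this).symm

theorem IsHom.coprod {X : FM.{u, v} k} {Y : FM.{u, w} k} {Z : FM.{u, z} k}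
    {e : X.V →ₗ[k] Z.V} {f : Y.V →ₗ[k] Z.V} (he : IsHom X Z e) (hf : IsHom Y Z f)
    (ho : ∀ a b, Z.B (e a) (f b) = 0) : IsHom (X.prod Y) Z (e.coprod f) := by
  constructor
  · rintro ⟨a, b⟩
    rw [FM.prod_Q, LinearMap.coprod_apply, Z.Q_add, ho, he.1, hf.1, add_zero]
  · rintro ⟨a, b⟩
    rw [FM.prod_T, LinearMap.coprod_apply, LinearMap.coprod_apply, map_add, he.2, hf.2]

theorem Iso.prod {X : FM.{u, v} k} {Y : FM.{u, w} k} {X' : FM.{u, z} k} {Y' : FM.{u, t} k}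
    (h : Iso X X') (h' : Iso Y Y') : Iso (X.prod Y) (X'.prod Y') := by
  obtain ⟨g, h1, h2⟩ := h
  obtain ⟨g', h1', h2'⟩ := h'
  refine ⟨g.prodCongr g', ?_, ?_⟩
  · rintro ⟨a, b⟩
    exact (FM.prod_Q X' Y' (g a) (g' b)).trans (by rw [h1, h1', FM.prod_Q])
  · rintro ⟨a, b⟩
    exact Prod.ext (h2 a) (h2' b)

theorem Iso.assoc (X : FM.{u, v} k) (Y : FM.{u, w} k) (Z : FM.{u, z} k) :
    Iso ((X.prod Y).prod Z) (X.prod (Y.prod Z)) := by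
  refine ⟨LinearEquiv.prodAssoc k X.V Y.V Z.V, ?_, ?_⟩
  · rintro ⟨⟨a, b⟩, c⟩
    refine (FM.prod_Q X (Y.prod Z) a (b, c)).trans ?_
    rw [FM.prod_Q, FM.prod_Q, FM.prod_Q, add_assoc]
  · rintro ⟨⟨a, b⟩, c⟩
    rfl

theorem Iso.comm (X : FM.{u, v} k) (Y : FM.{u, w} k) :
    Iso (X.prod Y) (Y.prod X) := by
  refine ⟨LinearEquiv.prodComm k X.V Y.V, ?_, ?_⟩
  · rintro ⟨a, b⟩
    refine (FM.prod_Q Y X b a).trans ?_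
    rw [FM.prod_Q, add_comm]
  · rintro ⟨a, b⟩
    rfl

end basics

section chartwo
variable {k : Type u} [Field k] [CharP k 2]

theorem FM.B_self (X : FM.{u, v} k) (a : X.V) : X.B a a = 0 := by
  rw [X.B_def, QuadraticMap.polar_self, two_nsmul, CharTwo.add_self_eq_zero]

theorem FM.Alt.adj {X : FM.{u, v} k} (h : X.Alt) (a b : X.V) : X.B (X.T a) b = X.B a (X.T b) := by
  have h1 := h (a + b)
  simp only [map_add, LinearMap.add_apply, h a, h b, zero_add, add_zero] at h1
  rw [X.B_comm a, ← CharTwo.add_eq_zero, ← h1, add_comm]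

theorem FM.Alt.adjp {X : FM.{u, v} k} (h : X.Alt) (n : ℕ) (a b : X.V) :
    X.B ((X.T ^ n) a) b = X.B a ((X.T ^ n) b) := by
  induction n generalizing a with
  | zero => rfl
  | succ n ih => rw [← X.tp_succ, ih, h.adj, X.tp_succ']

theorem FM.Alt.B_tp {X : FM.{u, v} k} (h : X.Alt) (i j : ℕ) (a b : X.V) :
    X.B ((X.T ^ i) a) ((X.T ^ j) b) = X.B ((X.T ^ (i + j)) a) b := by
  rw [← h.adjp, X.tp, add_comm]

theorem FM.Alt.self_tp {X : FM.{u, v} k} (h : X.Alt) (n : ℕ) (a : X.V) :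
    X.B ((X.T ^ n) a) a = 0 := by
  obtain ⟨p, hp | hp⟩ := Nat.even_or_odd' n
  · rw [hp, two_mul, ← h.B_tp, X.B_self]
  · have : n = (p + 1) + p := by omega
    rw [this, ← h.B_tp, ← X.tp_succ', h]

theorem FM.Alt.self_tp2 {X : FM.{u, v} k} (h : X.Alt) (i j : ℕ) (a : X.V) :
    X.B ((X.T ^ i) a) ((X.T ^ j) a) = 0 := by
  rw [h.B_tp, h.self_tp]

end chartwo

end FormMod

namespace FormMod

universe u v w z t

section blocks
variable {k : Type u} [Field k]

/-- shift operator -/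
def shiftL (k : Type u) [Field k] (a : ℕ) : (Fin a → k) →ₗ[k] (Fin a → k) where
  toFun f := fun i => if h : 1 ≤ i.1 then f ⟨i.1 - 1, by omega⟩ else 0
  map_add' f g := by
    ext i
    simp only [Pi.add_apply]
    split_ifs <;> simp
  map_smul' c f := by
    ext i
    simp only [Pi.smul_apply, RingHom.id_apply]
    split_ifs <;> simp

theorem shiftL_pow (a n : ℕ) (f : Fin a → k) (i : Fin a) :
    ((shiftL k a) ^ n) f i = if h : n ≤ i.1 then f ⟨i.1 - n, by omega⟩ else 0 := by
  induction n generalizing f with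
  | zero => simp
  | succ n ih =>
    rw [pow_succ, Module.End.mul_apply, ih]
    simp only [shiftL, LinearMap.coe_mk, AddHom.coe_mk]
    by_cases h : n + 1 ≤ i.1
    · rw [dif_pos (by omega), dif_pos (by omega), dif_pos h]
      congr 1
    · rw [dif_neg h]
      split_ifs <;> first | rfl | omega

/-- indicator vector -/
def ind (k : Type u) [Field k] (a n : ℕ) : Fin a → k := fun i => if i.1 = n then 1 else 0

theorem shiftL_ind (a n m : ℕ) : ((shiftL k a) ^ n) (ind k a m) = ind k a (m + n) := by
  ext i
  rw [shiftL_pow]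
  simp only [ind]
  split_ifs <;> first | rfl | omega

theorem ind_zero_of_le {a n : ℕ} (h : a ≤ n) : ind k a n = 0 := by
  ext i
  simp only [ind, Pi.zero_apply]
  rw [if_neg (by omega)]

theorem shiftL_apply_sum (a : ℕ) (f : Fin a → k) (i : Fin a) :
    shiftL k a f i = ∑ j : Fin a, if j.1 + 1 = i.1 then f j else 0 := by
  simp only [shiftL, LinearMap.coe_mk, AddHom.coe_mk]
  split_ifs with h
  · rw [Finset.sum_eq_single ⟨i.1 - 1, by omega⟩]
    · rw [if_pos (by simp only; omega)]
    · intro j _ hj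
      rw [if_neg]
      intro h'
      apply hj
      ext
      simp only
      omega
    · simp
  · symm
    apply Finset.sum_eq_zero
    intro j _
    rw [if_neg (by omega)]

/-- the basic pairing -/
def pairing {a b : ℕ} (f : Fin a → k) (g : Fin b → k) : k :=
  ∑ i : Fin a, ∑ j : Fin b, if i.1 + j.1 + 1 = b then f i * g j else 0

theorem pairing_shift {a b : ℕ} (hab : b ≤ a) (f : Fin a → k) (g : Fin b → k) :
    pairing (shiftL k a f) g = pairing f (shiftL k b g) := by
  unfold pairing
  have h1 : ∀ (i : Fin a) (j : Fin b), (if i.1 + j.1 + 1 = b then shiftL k a f i * g j else 0)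
      = ∑ i' : Fin a, if i.1 = i'.1 + 1 ∧ i.1 + j.1 + 1 = b then f i' * g j else 0 := by
    intro i j
    split_ifs with h
    · rw [shiftL_apply_sum, Finset.sum_mul]
      apply Finset.sum_congr rfl
      intro i' _
      by_cases h' : i'.1 + 1 = i.1
      · rw [if_pos h', if_pos ⟨h'.symm, h⟩]
      · rw [if_neg h', if_neg (fun q => h' q.1.symm), zero_mul]
    · symm
      apply Finset.sum_eq_zero
      intro i' _
      rw [if_neg (fun q => h q.2)]
  have h2 : ∀ (i : Fin a) (j : Fin b), (if i.1 + j.1 + 1 = b then f i * shiftL k b g j else 0)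
      = ∑ j' : Fin b, if j.1 = j'.1 + 1 ∧ i.1 + j.1 + 1 = b then f i * g j' else 0 := by
    intro i j
    split_ifs with h
    · rw [shiftL_apply_sum, Finset.mul_sum]
      apply Finset.sum_congr rfl
      intro i' _
      by_cases h' : i'.1 + 1 = j.1
      · rw [if_pos h', if_pos ⟨h'.symm, h⟩]
      · rw [if_neg h', if_neg (fun q => h' q.1.symm), mul_zero]
    · symm
      apply Finset.sum_eq_zero
      intro i' _
      rw [if_neg (fun q => h q.2)]
  simp only [h1, h2]
  have e1 : ∀ (i' : Fin a) (j : Fin b),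
      (∑ i : Fin a, if i.1 = i'.1 + 1 ∧ i.1 + j.1 + 1 = b then f i' * g j else 0) =
      if i'.1 + j.1 + 2 = b then f i' * g j else 0 := by
    intro i' j
    split_ifs with h
    · rw [Finset.sum_eq_single ⟨i'.1 + 1, by omega⟩]
      · rw [if_pos ⟨rfl, by simp only; omega⟩]
      · intro i _ hi
        rw [if_neg]
        rintro ⟨h', -⟩
        exact hi (Fin.ext h')
      · simp
    · apply Finset.sum_eq_zero
      intro i _
      rw [if_neg (by omega)]
  have e2 : ∀ (i : Fin a) (j' : Fin b),
      (∑ j : Fin b, if j.1 = j'.1 + 1 ∧ i.1 + j.1 + 1 = b then f i * g j' else 0) =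
      if i.1 + j'.1 + 2 = b then f i * g j' else 0 := by
    intro i' j
    split_ifs with h
    · rw [Finset.sum_eq_single ⟨j.1 + 1, by omega⟩]
      · rw [if_pos ⟨rfl, by simp only; omega⟩]
      · intro i _ hi
        rw [if_neg]
        rintro ⟨h', -⟩
        exact hi (Fin.ext h')
      · simp
    · apply Finset.sum_eq_zero
      intro i _
      rw [if_neg (by omega)]
  calc _ = ∑ i' : Fin a, ∑ j : Fin b, ∑ i : Fin a,
        (if i.1 = i'.1 + 1 ∧ i.1 + j.1 + 1 = b then f i' * g j else 0) := by
        rw [Finset.sum_comm, Finset.sum_comm (s := (univ : Finset (Fin a)))]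
        exact Finset.sum_congr rfl fun j _ => Finset.sum_comm
    _ = ∑ i : Fin a, ∑ j' : Fin b, ∑ j : Fin b,
        (if j.1 = j'.1 + 1 ∧ i.1 + j.1 + 1 = b then f i * g j' else 0) := by
        simp_rw [e1, e2]
    _ = _ := by
        apply Finset.sum_congr rfl
        intro i _
        rw [Finset.sum_comm]

/-- the quadratic form of a block -/
noncomputable def blkQ (a b : ℕ) (x y : ℕ → k) : QuadraticForm k ((Fin a → k) × (Fin b → k)) :=
  (∑ i : Fin a, x i.1 • QuadraticMap.linMulLin
      ((LinearMap.proj i).comp (LinearMap.fst k (Fin a → k) (Fin b → k)))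
      ((LinearMap.proj i).comp (LinearMap.fst k (Fin a → k) (Fin b → k)))) +
  (∑ j : Fin b, y j.1 • QuadraticMap.linMulLin
      ((LinearMap.proj j).comp (LinearMap.snd k (Fin a → k) (Fin b → k)))
      ((LinearMap.proj j).comp (LinearMap.snd k (Fin a → k) (Fin b → k)))) +
  ∑ i : Fin a, ∑ j : Fin b, (if i.1 + j.1 + 1 = b then (1 : k) else 0) • QuadraticMap.linMulLin
      ((LinearMap.proj i).comp (LinearMap.fst k (Fin a → k) (Fin b → k)))
      ((LinearMap.proj j).comp (LinearMap.snd k (Fin a → k) (Fin b → k)))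

theorem blkQ_apply (a b : ℕ) (x y : ℕ → k) (f : Fin a → k) (g : Fin b → k) :
    blkQ a b x y (f, g) = (∑ i, f i * f i * x i.1) + (∑ j, g j * g j * y j.1) + pairing f g := by
  unfold blkQ pairing
  simp only [_root_.add_apply, _root_.sum_apply, _root_.smul_apply,
    QuadraticMap.linMulLin_apply, LinearMap.comp_apply, LinearMap.fst_apply, LinearMap.snd_apply,
    LinearMap.proj_apply, smul_eq_mul, ite_mul, one_mul, zero_mul]
  simp only [mul_comm]

/-- block -/
@[reducible] noncomputable def Blk (a b : ℕ) (x y : ℕ → k) : FM.{u, u} k where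
  V := (Fin a → k) × (Fin b → k)
  Q := blkQ a b x y
  T := (shiftL k a).prodMap (shiftL k b)

theorem Blk_Q (a b : ℕ) (x y : ℕ → k) (f : Fin a → k) (g : Fin b → k) :
    (Blk a b x y).Q (f, g) =
      (∑ i, f i * f i * x i.1) + (∑ j, g j * g j * y j.1) + pairing f g := blkQ_apply ..

theorem Blk_T (a b : ℕ) (x y : ℕ → k) (f : Fin a → k) (g : Fin b → k) :
    (Blk a b x y).T (f, g) = (shiftL k a f, shiftL k b g) := rfl

theorem Blk_tp (a b : ℕ) (x y : ℕ → k) (n : ℕ) (f : Fin a → k) (g : Fin b → k) :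
    ((Blk a b x y).T ^ n) (f, g) = (((shiftL k a) ^ n) f, ((shiftL k b) ^ n) g) := by
  induction n with
  | zero => rfl
  | succ n ih => rw [← FM.tp_succ', ih, Blk_T, pow_succ', pow_succ']; rfl

theorem Blk_finrank (a b : ℕ) (x y : ℕ → k) : finrank k (Blk a b x y).V = a + b := by
  show finrank k ((Fin a → k) × (Fin b → k)) = a + b
  simp

theorem pairing_add_left {a b : ℕ} (f f' : Fin a → k) (g : Fin b → k) :
    pairing (f + f') g = pairing f g + pairing f' g := by
  unfold pairing
  simp only [← Finset.sum_add_distrib]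
  refine Finset.sum_congr rfl fun i _ => Finset.sum_congr rfl fun j _ => ?_
  split_ifs <;> simp [add_mul]

theorem pairing_add_right {a b : ℕ} (f : Fin a → k) (g g' : Fin b → k) :
    pairing f (g + g') = pairing f g + pairing f g' := by
  unfold pairing
  simp only [← Finset.sum_add_distrib]
  refine Finset.sum_congr rfl fun i _ => Finset.sum_congr rfl fun j _ => ?_
  split_ifs <;> simp [mul_add]

theorem pairing_ind_right {a b : ℕ} (f : Fin a → k) (n : ℕ) (i : Fin a) (h : i.1 + n + 1 = b) :
    pairing f (ind k b n) = f i := by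
  unfold pairing
  rw [Finset.sum_eq_single i, Finset.sum_eq_single ⟨n, by omega⟩]
  · simp [ind, h]
  · intro j _ hj
    rw [if_neg]
    intro h'
    apply hj
    ext
    simp only
    omega
  · simp
  · intro i' _ hi
    apply Finset.sum_eq_zero
    intro j _
    simp only [ind]
    split_ifs with h1 h2
    · exfalso; apply hi; ext; omega
    · simp
    · simp
  · simp

theorem pairing_ind_left {a b : ℕ} (g : Fin b → k) (n : ℕ) (j : Fin b) (h : n + j.1 + 1 = b)
    (hn : n < a) : pairing (ind k a n) g = g j := by
  unfold pairing
  rw [Finset.sum_eq_single ⟨n, hn⟩, Finset.sum_eq_single j]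
  · simp [ind, h]
  · intro j' _ hj
    rw [if_neg]
    intro h'
    apply hj
    ext
    simp only at h'
    omega
  · simp
  · intro i' _ hi
    apply Finset.sum_eq_zero
    intro j _
    simp only [ind]
    split_ifs with h1 h2
    · exfalso; apply hi; ext; simp only; omega
    · simp
    · simp
  · simp

theorem pairing_zero_right {a b : ℕ} (f : Fin a → k) : pairing f (0 : Fin b → k) = 0 := by
  simp [pairing]

theorem pairing_zero_left {a b : ℕ} (g : Fin b → k) : pairing (0 : Fin a → k) g = 0 := by
  simp [pairing]

/-- first generator -/
def gv (a b : ℕ) (x y : ℕ → k) : (Blk a b x y).V := (ind k a 0, 0)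

/-- second generator -/
def gw (a b : ℕ) (x y : ℕ → k) : (Blk a b x y).V := (0, ind k b 0)

theorem gv_tp (a b : ℕ) (x y : ℕ → k) (n : ℕ) :
    ((Blk a b x y).T ^ n) (gv a b x y) = (ind k a n, 0) := by
  unfold gv
  rw [Blk_tp, shiftL_ind, map_zero, zero_add]

theorem gw_tp (a b : ℕ) (x y : ℕ → k) (n : ℕ) :
    ((Blk a b x y).T ^ n) (gw a b x y) = (0, ind k b n) := by
  unfold gw
  rw [Blk_tp, shiftL_ind, map_zero, zero_add]

theorem sum_ind {a : ℕ} (n : ℕ) (x : ℕ → k) :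
    (∑ i : Fin a, ind k a n i * ind k a n i * x i.1) = if n < a then x n else 0 := by
  split_ifs with h
  · rw [Finset.sum_eq_single ⟨n, h⟩]
    · simp [ind]
    · intro i _ hi
      simp only [ind]
      rw [if_neg]
      · simp
      · intro h'; apply hi; ext; exact h'
    · simp
  · rw [ind_zero_of_le (by omega)]
    simp

theorem gv_Q (a b : ℕ) (x y : ℕ → k) (n : ℕ) :
    (Blk a b x y).Q (((Blk a b x y).T ^ n) (gv a b x y)) = if n < a then x n else 0 := by
  rw [gv_tp, Blk_Q, pairing_zero_right, sum_ind]
  simp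

theorem gw_Q (a b : ℕ) (x y : ℕ → k) (n : ℕ) :
    (Blk a b x y).Q (((Blk a b x y).T ^ n) (gw a b x y)) = if n < b then y n else 0 := by
  rw [gw_tp, Blk_Q, pairing_zero_left, sum_ind]
  simp

theorem Q_sum (X : FM.{u, v} k) {ι : Type*} (s : Finset ι) (f : ι → k) (e : ι → X.V)
    (h : ∀ i j, X.B (e i) (e j) = 0) :
    X.Q (∑ i ∈ s, f i • e i) = ∑ i ∈ s, f i * f i * X.Q (e i) := by
  classical
  induction s using Finset.induction_on with
  | empty => simp
  | insert i s hi ih =>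
    rw [Finset.sum_insert hi, Finset.sum_insert hi, X.Q_add, ih, X.Q_smul]
    have : X.B (f i • e i) (∑ j ∈ s, f j • e j) = 0 := by
      rw [map_sum]
      apply Finset.sum_eq_zero
      intro j _
      rw [map_smul, map_smul, LinearMap.smul_apply, h]
      simp
    rw [this, add_zero]

/-- dual pair of vectors -/
structure IsPair (X : FM.{u, v} k) (a b : ℕ) (v w : X.V) : Prop where
  tv : (X.T ^ a) v = 0
  tw : (X.T ^ b) w = 0
  pr : ∀ n, X.B ((X.T ^ n) v) w = if n + 1 = b then 1 else 0

/-- linear map defined by a pair of vectors -/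
def pairMap (X : FM.{u, v} k) (a b : ℕ) (v w : X.V) : ((Fin a → k) × (Fin b → k)) →ₗ[k] X.V :=
  (Fintype.linearCombination k (fun i : Fin a => (X.T ^ i.1) v)).coprod
    (Fintype.linearCombination k (fun i : Fin b => (X.T ^ i.1) w))

theorem pairMap_apply (X : FM.{u, v} k) (a b : ℕ) (v w : X.V) (f : Fin a → k) (g : Fin b → k) :
    pairMap X a b v w (f, g) = (∑ i, f i • (X.T ^ i.1) v) + ∑ j, g j • (X.T ^ j.1) w := by
  simp [pairMap, Fintype.linearCombination_apply]

theorem tp_pairMap (X : FM.{u, v} k) (a b : ℕ) (v w : X.V) (f : Fin a → k) (g : Fin b → k)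
    (s : ℕ) : (X.T ^ s) (pairMap X a b v w (f, g)) =
      (∑ i, f i • (X.T ^ (i.1 + s)) v) + ∑ j, g j • (X.T ^ (j.1 + s)) w := by
  rw [pairMap_apply]
  simp only [map_add, map_sum, map_smul, X.tp]
  simp only [add_comm s]

theorem sum_shift (X : FM.{u, v} k) (a : ℕ) (v : X.V) (f : Fin a → k) (h : (X.T ^ a) v = 0) :
    (∑ i, shiftL k a f i • (X.T ^ i.1) v) = ∑ i, f i • (X.T ^ (i.1 + 1)) v := by
  simp only [shiftL_apply_sum, Finset.sum_smul]
  rw [Finset.sum_comm]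
  apply Finset.sum_congr rfl
  intro i _
  by_cases hi : i.1 + 1 < a
  · rw [Finset.sum_eq_single ⟨i.1 + 1, hi⟩]
    · simp
    · intro j _ hj
      rw [if_neg, zero_smul]
      intro h'; apply hj; ext; exact h'.symm
    · simp
  · rw [X.tp_zero_of_le h (by omega), smul_zero]
    apply Finset.sum_eq_zero
    intro j _
    rw [if_neg (by omega), zero_smul]

theorem Blk_eq_pairMap (a b : ℕ) (x y : ℕ → k) (f : Fin a → k) (g : Fin b → k) :
    pairMap (Blk a b x y) a b (gv a b x y) (gw a b x y) (f, g) = (f, g) := by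
  rw [pairMap_apply]
  have h1 : (∑ i, f i • ((Blk a b x y).T ^ i.1) (gv a b x y)) = (f, 0) := by
    rw [Finset.sum_congr rfl fun i _ => by rw [gv_tp]]
    ext i
    · simp [Prod.fst_sum, ind, Fin.val_inj]
    · simp [Prod.snd_sum]
  have h2 : (∑ i, g i • ((Blk a b x y).T ^ i.1) (gw a b x y)) = (0, g) := by
    rw [Finset.sum_congr rfl fun i _ => by rw [gw_tp]]
    ext i
    · simp [Prod.fst_sum]
    · simp [Prod.snd_sum, ind, Fin.val_inj]
  rw [h1, h2]
  simp

end blocks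

section chartwo
variable {k : Type u} [Field k] [CharP k 2]

theorem Blk_B (a b : ℕ) (x y : ℕ → k) (f f' : Fin a → k) (g g' : Fin b → k) :
    (Blk a b x y).B (f, g) (f', g') = pairing f g' + pairing f' g := by
  have h := (Blk a b x y).Q_add (f, g) (f', g')
  have h1 : ∀ {c : ℕ} (f f' : Fin c → k) (x : ℕ → k),
      (∑ i, (f + f') i * (f + f') i * x i.1) =
      (∑ i, f i * f i * x i.1) + ∑ i, f' i * f' i * x i.1 := by
    intro c f f' x
    rw [← Finset.sum_add_distrib]
    apply Finset.sum_congr rfl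
    intro i _
    rw [Pi.add_apply, CharTwo.add_mul_self]
    ring
  rw [Prod.mk_add_mk, Blk_Q, Blk_Q, Blk_Q, h1, h1, pairing_add_left, pairing_add_right,
    pairing_add_right] at h
  linear_combination -h

theorem Blk_alt {a b : ℕ} (hab : b ≤ a) (x y : ℕ → k) : (Blk a b x y).Alt := by
  rintro ⟨f, g⟩
  rw [Blk_T, Blk_B, pairing_shift hab, CharTwo.add_self_eq_zero]

theorem Blk_nil (a b : ℕ) (x y : ℕ → k) : (Blk a b x y).T ^ (max a b) = 0 := by
  apply LinearMap.ext
  rintro ⟨f, g⟩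
  rw [Blk_tp]
  ext i
  · simp only
    rw [shiftL_pow, dif_neg (by omega)]; rfl
  · simp only
    rw [shiftL_pow, dif_neg (by omega)]; rfl

theorem Blk_nondef (a : ℕ) (x y : ℕ → k) : (Blk a a x y).Nondef := by
  rintro ⟨f, g⟩ h
  have h1 : f = 0 := by
    ext i
    have := h (0, ind k a (a - 1 - i.1))
    rw [Blk_B, pairing_zero_left, pairing_ind_right f _ i (by omega)] at this
    simpa using this
  have h2 : g = 0 := by
    ext i
    have := h (ind k a (a - 1 - i.1), 0)
    rw [Blk_B, pairing_zero_right, pairing_ind_left g _ i (by omega) (by omega)] at this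
    simpa using this
  rw [h1, h2]; rfl

theorem Blk_adm (a : ℕ) (x y : ℕ → k) : (Blk a a x y).Adm :=
  ⟨Blk_alt le_rfl x y, ⟨_, Blk_nil a a x y⟩, fun c h _ => Blk_nondef a x y c h⟩

theorem Blk_adm' (m : ℕ) (x y : ℕ → k) (hx : x m ≠ 0) : (Blk (m + 1) m x y).Adm := by
  refine ⟨Blk_alt (by omega) x y, ⟨_, Blk_nil _ _ x y⟩, ?_⟩
  rintro ⟨f, g⟩ h hq
  have h2 : g = 0 := by
    ext i
    have := h (ind k (m + 1) (m - 1 - i.1), 0)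
    rw [Blk_B, pairing_zero_right, pairing_ind_left g _ i (by omega) (by omega)] at this
    simpa using this
  subst h2
  have h1 : ∀ i : Fin (m + 1), i.1 < m → f i = 0 := by
    intro i hi
    have := h (0, ind k m (m - 1 - i.1))
    rw [Blk_B, pairing_zero_right, pairing_ind_right f _ i (by omega)] at this
    simpa using this
  rw [Blk_Q, pairing_zero_right, Finset.sum_eq_single ⟨m, by omega⟩] at hq
  · simp only [Pi.zero_apply, mul_zero, zero_mul, Finset.sum_const_zero, add_zero,
      mul_eq_zero, or_self, hx, or_false] at hq
    have : f = 0 := by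
      ext i
      by_cases hi : i.1 < m
      · exact h1 i hi
      · have : i = ⟨m, by omega⟩ := by ext; simp only; omega
        rw [this, hq]; rfl
    rw [this]; rfl
  · intro i _ hi
    rw [h1 i]
    · simp
    · have : i.1 ≠ m := fun h => hi (Fin.ext h)
      omega
  · simp

theorem gen_pair {a b : ℕ} (hab : b ≤ a) (x y : ℕ → k) :
    IsPair (Blk a b x y) a b (gv a b x y) (gw a b x y) := by
  refine ⟨?_, ?_, ?_⟩
  · rw [gv_tp, ind_zero_of_le le_rfl]; rfl
  · rw [gw_tp, ind_zero_of_le le_rfl]; rfl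
  · intro n
    rw [gv_tp]
    unfold gw
    rw [Blk_B, pairing_zero_right, add_zero]
    split_ifs with h
    · rw [pairing_ind_right _ 0 ⟨n, by omega⟩ (by simpa using h)]
      simp [ind]
    · unfold pairing
      apply Finset.sum_eq_zero
      intro i _
      apply Finset.sum_eq_zero
      intro j _
      simp only [ind]
      split_ifs <;> first | omega | simp

theorem Q_pairMap (X : FM.{u, v} k) (hX : X.Alt) (a b : ℕ) (v w : X.V)
    (hp : ∀ n, X.B ((X.T ^ n) v) w = if n + 1 = b then 1 else 0)
    (f : Fin a → k) (g : Fin b → k) (s : ℕ) :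
    X.Q ((X.T ^ s) (pairMap X a b v w (f, g))) =
      (∑ i, f i * f i * X.Q ((X.T ^ (i.1 + s)) v)) + (∑ j, g j * g j * X.Q ((X.T ^ (j.1 + s)) w))
      + ∑ i : Fin a, ∑ j : Fin b, if i.1 + j.1 + 2 * s + 1 = b then f i * g j else 0 := by
  rw [tp_pairMap, X.Q_add, Q_sum, Q_sum]
  · congr 1
    rw [map_sum X.B, LinearMap.sum_apply]
    apply Finset.sum_congr rfl
    intro i _
    rw [map_sum]
    apply Finset.sum_congr rfl
    intro j _
    rw [map_smul, map_smul, LinearMap.smul_apply, hX.B_tp, hp]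
    have : (i.1 + s + (j.1 + s) + 1 = b) ↔ (i.1 + j.1 + 2 * s + 1 = b) := by omega
    simp only [this]
    split_ifs <;> simp [mul_comm]
  · intro i j; exact hX.self_tp2 _ _ _
  · intro i j; exact hX.self_tp2 _ _ _

theorem pair_hom (X : FM.{u, v} k) (hX : X.Alt) {a b : ℕ} {v w : X.V} (hp : IsPair X a b v w)
    (x y : ℕ → k) (hx : ∀ n < a, X.Q ((X.T ^ n) v) = x n) (hy : ∀ n < b, X.Q ((X.T ^ n) w) = y n) :
    IsHom (Blk a b x y) X (pairMap X a b v w) := by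
  constructor
  · rintro ⟨f, g⟩
    have := Q_pairMap X hX a b v w hp.pr f g 0
    simp only [pow_zero, Module.End.one_apply, mul_zero, add_zero] at this
    rw [this, Blk_Q]
    unfold pairing
    congr 2
    · exact Finset.sum_congr rfl fun i _ => by rw [hx i.1 i.2]
    · exact Finset.sum_congr rfl fun i _ => by rw [hy i.1 i.2]
  · rintro ⟨f, g⟩
    rw [Blk_T, pairMap_apply, sum_shift X a v f hp.tv, sum_shift X b w g hp.tw]
    have := tp_pairMap X a b v w f g 1
    rw [pow_one] at this
    exact this.symm

/-- formula for `Q (T^s u)` in a block -/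
theorem Blk_Q_tp {a b : ℕ} (hab : b ≤ a) (x y : ℕ → k) (f : Fin a → k) (g : Fin b → k) (s : ℕ) :
    (Blk a b x y).Q (((Blk a b x y).T ^ s) (f, g)) =
      (∑ i : Fin a, f i * f i * (if i.1 + s < a then x (i.1 + s) else 0)) +
      (∑ j : Fin b, g j * g j * (if j.1 + s < b then y (j.1 + s) else 0))
      + ∑ i : Fin a, ∑ j : Fin b, if i.1 + j.1 + 2 * s + 1 = b then f i * g j else 0 := by
  have := Q_pairMap (Blk a b x y) (Blk_alt hab x y) a b _ _ (gen_pair hab x y).pr f g s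
  rw [Blk_eq_pairMap] at this
  rw [this]
  congr 2
  · exact Finset.sum_congr rfl fun i _ => by rw [gv_Q]
  · exact Finset.sum_congr rfl fun i _ => by rw [gw_Q]

end chartwo

end FormMod

namespace FormMod

universe u v w z t

/-- descending elimination -/
theorem kill {α : Type*} {k : Type*} [Zero k] (P : α → Prop) (s : α → ℕ → k) (ex : ℕ → Prop)
    (M : ℕ)
    (step : ∀ a, P a → ∀ n < M, ¬ ex n → ∃ a', P a' ∧ s a' n = 0 ∧ ∀ i, n < i → s a' i = s a i)
    (a : α) (ha : P a) : ∃ a', P a' ∧ ∀ n < M, ¬ ex n → s a' n = 0 := by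
  suffices H : ∀ d ≤ M, ∃ a', P a' ∧ ∀ n < M, M ≤ n + d → ¬ ex n → s a' n = 0 by
    obtain ⟨a', h1, h2⟩ := H M le_rfl
    exact ⟨a', h1, fun n hn hx => h2 n hn (by omega) hx⟩
  intro d
  induction d with
  | zero => intro _; exact ⟨a, ha, fun n hn h => by omega⟩
  | succ d ih =>
    intro hd
    obtain ⟨a', h1, h2⟩ := ih (by omega)
    by_cases hx : ex (M - d - 1)
    · refine ⟨a', h1, fun n hn h hnx => ?_⟩
      rcases Nat.lt_or_ge (M - d - 1) n with h' | h'
      · exact h2 n hn (by omega) hnx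
      · have : n = M - d - 1 := by omega
        subst this; exact absurd hx hnx
    · obtain ⟨a'', h1', h2', h3'⟩ := step a' h1 (M - d - 1) (by omega) hx
      refine ⟨a'', h1', fun n hn h hnx => ?_⟩
      rcases Nat.lt_or_ge (M - d - 1) n with h' | h'
      · rw [h3' n h']; exact h2 n hn (by omega) hnx
      · have : n = M - d - 1 := by omega
        subst this; exact h2'

section chartwo
variable {k : Type u} [Field k] [CharP k 2]

theorem Q_tp_add (X : FM.{u, v} k) (hX : X.Alt) (a b : X.V) (c : k) (N i : ℕ) :
    X.Q ((X.T ^ i) (a + c • (X.T ^ N) b)) =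
      X.Q ((X.T ^ i) a) + c * c * X.Q ((X.T ^ (i + N)) b) + c * X.B ((X.T ^ (2 * i + N)) b) a := by
  rw [map_add, map_smul, X.tp, X.Q_add, X.Q_smul, map_smul, X.B_comm, hX.B_tp]
  rw [smul_eq_mul, show i + N + i = 2 * i + N by omega]

theorem Q_tp_add_self (X : FM.{u, v} k) (hX : X.Alt) (a : X.V) (c : k) (N i : ℕ) :
    X.Q ((X.T ^ i) (a + c • (X.T ^ N) a)) =
      X.Q ((X.T ^ i) a) + c * c * X.Q ((X.T ^ (i + N)) a) := by
  rw [Q_tp_add X hX, hX.self_tp, mul_zero, add_zero]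

theorem B_tp_add (X : FM.{u, v} k) (hX : X.Alt) (a b d : X.V) (c : k) (N i : ℕ) :
    X.B ((X.T ^ i) d) (a + c • (X.T ^ N) b) = X.B ((X.T ^ i) d) a + c * X.B ((X.T ^ (i + N)) d) b := by
  rw [map_add, map_smul, hX.B_tp, smul_eq_mul]

theorem B_tp_add_left (X : FM.{u, v} k) (a b d : X.V) (c : k) (N i : ℕ) :
    X.B ((X.T ^ i) (a + c • (X.T ^ N) b)) d = X.B ((X.T ^ i) a) d + c * X.B ((X.T ^ (i + N)) b) d := by
  rw [map_add, map_smul, X.tp, map_add, map_smul X.B, LinearMap.add_apply, LinearMap.smul_apply,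
    smul_eq_mul]

theorem tp_add_zero (X : FM.{u, v} k) {a b : X.V} (c : k) (N : ℕ) {m : ℕ} (ha : (X.T ^ m) a = 0)
    (hb : (X.T ^ (m + N)) b = 0) : (X.T ^ m) (a + c • (X.T ^ N) b) = 0 := by
  rw [map_add, map_smul, X.tp, ha, hb, smul_zero, add_zero]

theorem IsPair.swap {X : FM.{u, v} k} (hX : X.Alt) {a : ℕ} {v w : X.V} (h : IsPair X a a v w) :
    IsPair X a a w v :=
  ⟨h.tw, h.tv, fun n => by rw [hX.adjp, X.B_comm, h.pr]⟩

/-- make a dual vector exact -/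
theorem lemP (X : FM.{u, v} k) (hX : X.Alt) (v w : X.V) (b : ℕ)
    (h0 : ∀ n, b < n → X.B ((X.T ^ n) v) w = 0) (h1 : X.B ((X.T ^ b) v) w = 1)
    (P : X.V → Prop) (hw : P w) (hP : ∀ a (c : k) N, P a → P (a + c • (X.T ^ N) a)) :
    ∃ w', P w' ∧ ∀ n, X.B ((X.T ^ n) v) w' = if n + 1 = b + 1 then 1 else 0 := by
  obtain ⟨w', ⟨hw1, hw2, hw3⟩, hw4⟩ := kill
    (fun w => P w ∧ (∀ n, b < n → X.B ((X.T ^ n) v) w = 0) ∧ X.B ((X.T ^ b) v) w = 1)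
    (fun w n => X.B ((X.T ^ n) v) w) (fun _ => False) b
    (by
      rintro a ⟨p1, p2, p3⟩ n hn -
      refine ⟨a + (X.B ((X.T ^ n) v) a) • (X.T ^ (b - n)) a, ⟨hP _ _ _ p1, ?_, ?_⟩, ?_, ?_⟩
      · intro i hi
        rw [B_tp_add X hX, p2 i hi, p2 (i + (b - n)) (by omega), mul_zero, add_zero]
      · rw [B_tp_add X hX, p3, p2 (b + (b - n)) (by omega), mul_zero, add_zero]
      · rw [B_tp_add X hX, show n + (b - n) = b by omega, p3, mul_one, CharTwo.add_self_eq_zero]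
      · intro i hi
        rw [B_tp_add X hX, p2 (i + (b - n)) (by omega), mul_zero, add_zero])
    w ⟨hw, h0, h1⟩
  refine ⟨w', hw1, fun n => ?_⟩
  rcases lt_trichotomy n b with h | h | h
  · rw [if_neg (by omega)]; exact hw4 n h (fun h => h)
  · rw [h, if_pos rfl]; exact hw3
  · rw [if_neg (by omega)]; exact hw2 n h

/-- normalise the values of `Q` on a cyclic module -/
theorem normV (hsq : ∀ x : k, ∃ y, y * y = x) (X : FM.{u, v} k) (hX : X.Alt) (v : X.V) (l : ℕ)
    (h0 : ∀ n, l < n → X.Q ((X.T ^ n) v) = 0) (h1 : X.Q ((X.T ^ l) v) = 1)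
    (P : X.V → Prop) (hw : P v) (hP : ∀ a (c : k) N, 1 ≤ N → P a → P (a + c • (X.T ^ N) a)) :
    ∃ v', P v' ∧ ∀ n, X.Q ((X.T ^ n) v') = if n = l then 1 else 0 := by
  obtain ⟨w', ⟨hw1, hw2, hw3⟩, hw4⟩ := kill
    (fun w => P w ∧ (∀ n, l < n → X.Q ((X.T ^ n) w) = 0) ∧ X.Q ((X.T ^ l) w) = 1)
    (fun w n => X.Q ((X.T ^ n) w)) (fun _ => False) l
    (by
      rintro a ⟨p1, p2, p3⟩ n hn -
      obtain ⟨c, hc⟩ := hsq (X.Q ((X.T ^ n) a))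
      refine ⟨a + c • (X.T ^ (l - n)) a, ⟨hP _ _ _ (by omega) p1, ?_, ?_⟩, ?_, ?_⟩
      · intro i hi
        rw [Q_tp_add_self X hX, p2 i hi, p2 _ (by omega), mul_zero, add_zero]
      · rw [Q_tp_add_self X hX, p3, p2 _ (by omega), mul_zero, add_zero]
      · rw [Q_tp_add_self X hX, show n + (l - n) = l by omega, p3, mul_one, hc,
          CharTwo.add_self_eq_zero]
      · intro i hi
        rw [Q_tp_add_self X hX, p2 (i + (l - n)) (by omega), mul_zero, add_zero])
    v ⟨hw, h0, h1⟩
  refine ⟨w', hw1, fun n => ?_⟩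
  rcases lt_trichotomy n l with h | h | h
  · rw [if_neg (by omega)]; exact hw4 n h (fun h => h)
  · rw [h, if_pos rfl]; exact hw3
  · rw [if_neg (by omega)]; exact hw2 n h

/-- replacing `w` by `w + c T^N v` keeps a pair -/
theorem IsPair.addW {X : FM.{u, v} k} (hX : X.Alt) {a b : ℕ} {v w : X.V} (h : IsPair X a b v w)
    (c : k) (N : ℕ) (hN : a ≤ b + N) : IsPair X a b v (w + c • (X.T ^ N) v) := by
  refine ⟨h.tv, tp_add_zero X c N h.tw (X.tp_zero_of_le h.tv hN), fun n => ?_⟩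
  rw [B_tp_add X hX, h.pr, hX.self_tp, mul_zero, add_zero]

/-- value profile of the first generator -/
def wx (k : Type u) [Field k] (μ l : ℕ) (n : ℕ) : k := if n + 1 = l ∧ μ < 2 * l then 1 else 0

/-- value profile of the second generator -/
def wy {k : Type u} [Field k] (μ l : ℕ) (δ : k) (n : ℕ) : k :=
  if n + l = μ ∧ μ < 2 * l then δ else 0

/-- a pair in normal form -/
structure IsW (X : FM.{u, v} k) (μ l : ℕ) (δ : k) (v w : X.V) : Prop where
  pair : IsPair X μ μ v w
  qv : ∀ n, X.Q ((X.T ^ n) v) = wx k μ l n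
  qw : ∀ n, X.Q ((X.T ^ n) w) = wy μ l δ n

theorem norm1 (hsq : ∀ x : k, ∃ y, y * y = x) (X : FM.{u, v} k) (hX : X.Alt) {μ l : ℕ}
    (hl : μ < 2 * l) {v w : X.V} (h : IsPair X μ μ v w)
    (hv : ∀ n, l ≤ n → X.Q ((X.T ^ n) v) = 0) (hw : ∀ n, l ≤ n → X.Q ((X.T ^ n) w) = 0)
    (hne : X.Q ((X.T ^ (l - 1)) v) ≠ 0) : ∃ δ v' w', IsW X μ l δ v' w' := by
  have hl1 : l - 1 < μ := by
    by_contra hc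
    apply hne
    rw [X.tp_zero_of_le h.tv (by omega)]; simp
  obtain ⟨d, hd⟩ := hsq (X.Q ((X.T ^ (l - 1)) v))
  have hd0 : d ≠ 0 := by rintro rfl; apply hne; rw [← hd]; simp
  -- normalise v
  obtain ⟨v', ⟨q1, q2, q3⟩, q4⟩ := normV hsq X hX (d⁻¹ • v) (l - 1)
    (fun n hn => by rw [map_smul, X.Q_smul, hv n (by omega), mul_zero])
    (by rw [map_smul, X.Q_smul, ← hd]; field_simp)
    (fun v' => (X.T ^ μ) v' = 0 ∧ X.B ((X.T ^ (μ - 1)) v') (d • w) = 1 ∧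
      ∀ n, μ - 1 < n → X.B ((X.T ^ n) v') (d • w) = 0)
    ⟨by rw [map_smul, h.tv, smul_zero],
     by simp only [map_smul, LinearMap.smul_apply, h.pr]
        rw [if_pos (by omega)]; simp [hd0],
     by intro n hn
        simp only [map_smul, LinearMap.smul_apply, h.pr]
        rw [if_neg (by omega)]; simp⟩
    (by
      rintro a c N hN ⟨p1, p2, p3⟩
      refine ⟨tp_add_zero X c N p1 (X.tp_zero_of_le p1 (by omega)), ?_, ?_⟩
      · rw [B_tp_add_left,
          p2, p3 _ (by omega), mul_zero, add_zero]
      · intro n hn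
        rw [B_tp_add_left,
          p3 _ (by omega), p3 _ (by omega), mul_zero, add_zero])
  -- new dual vector
  obtain ⟨w1, ⟨r1, r2⟩, r3⟩ := lemP X hX v' (d • w) (μ - 1) q3 q2
    (fun w => (X.T ^ μ) w = 0 ∧ ∀ n, l ≤ n → X.Q ((X.T ^ n) w) = 0)
    ⟨by rw [map_smul, h.tw, smul_zero],
      fun n hn => by rw [map_smul, X.Q_smul, hw n hn, mul_zero]⟩
    (by
      rintro a c N ⟨p1, p2⟩
      refine ⟨tp_add_zero X c N p1 (X.tp_zero_of_le p1 (by omega)), fun n hn => ?_⟩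
      rw [Q_tp_add_self X hX, p2 n hn, p2 _ (by omega), mul_zero, add_zero])
  have hpair : IsPair X μ μ v' w1 := ⟨q1, r1, by rwa [show μ - 1 + 1 = μ by omega] at r3⟩
  obtain ⟨w2, ⟨s1, s2⟩, s3⟩ := kill
    (fun w => IsPair X μ μ v' w ∧ ∀ n, l ≤ n → X.Q ((X.T ^ n) w) = 0)
    (fun w n => X.Q ((X.T ^ n) w)) (fun n => n + l = μ) l
    (by
      rintro a ⟨p1, p2⟩ n hn hne
      rcases Nat.lt_or_ge μ (n + l) with hc | hc
      · obtain ⟨c, hc'⟩ := hsq (X.Q ((X.T ^ n) a))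
        have key : ∀ i, n ≤ i → X.Q ((X.T ^ i) (a + c • (X.T ^ (l - 1 - n)) v')) =
            X.Q ((X.T ^ i) a) + if i = n then c * c else 0 := by
          intro i hi
          rw [Q_tp_add X hX, q4, p1.pr, if_neg (show ¬ (2 * i + (l - 1 - n) + 1 = μ) by omega),
            mul_zero, add_zero]
          congr 1
          by_cases h' : i = n
          · rw [if_pos h', if_pos (by omega), mul_one]
          · rw [if_neg h', if_neg (by omega), mul_zero]
        refine ⟨a + c • (X.T ^ (l - 1 - n)) v', ⟨p1.addW hX _ _ (by omega), ?_⟩, ?_, ?_⟩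
        · intro i hi
          rw [key i (by omega), if_neg (by omega), add_zero, p2 i hi]
        · rw [key n le_rfl, if_pos rfl, hc', CharTwo.add_self_eq_zero]
        · intro i hi
          rw [key i (by omega), if_neg (by omega), add_zero]
      · have hc2 : n + l < μ := lt_of_le_of_ne hc hne
        have key : ∀ i, n ≤ i → ∀ c : k, X.Q ((X.T ^ i) (a + c • (X.T ^ (μ - 1 - 2 * n)) v')) =
            X.Q ((X.T ^ i) a) + if i = n then c else 0 := by
          intro i hi c
          rw [Q_tp_add X hX, q4, p1.pr, if_neg (by omega), mul_zero, add_zero]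
          congr 1
          by_cases h' : i = n
          · rw [if_pos h', if_pos (by omega), mul_one]
          · rw [if_neg h', if_neg (by omega), mul_zero]
        refine ⟨a + (X.Q ((X.T ^ n) a)) • (X.T ^ (μ - 1 - 2 * n)) v',
          ⟨p1.addW hX _ _ (by omega), ?_⟩, ?_, ?_⟩
        · intro i hi
          rw [key i (by omega), if_neg (by omega), add_zero, p2 i hi]
        · rw [key n le_rfl, if_pos rfl, CharTwo.add_self_eq_zero]
        · intro i hi
          rw [key i (by omega), if_neg (by omega), add_zero])
    w1 ⟨hpair, r2⟩
  refine ⟨X.Q ((X.T ^ (μ - l)) w2), v', w2, s1, fun n => ?_, fun n => ?_⟩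
  · rw [q4]
    unfold wx
    by_cases h' : n = l - 1
    · rw [if_pos h', if_pos ⟨by omega, hl⟩]
    · rw [if_neg h', if_neg (by omega)]
  · unfold wy
    by_cases h' : n + l = μ
    · rw [if_pos ⟨h', hl⟩, show μ - l = n by omega]
    · rw [if_neg (fun q => h' q.1)]
      rcases Nat.lt_or_ge n l with h2 | h2
      · exact s3 n h2 h'
      · exact s2 n h2

theorem kill2 (X : FM.{u, v} k) (hX : X.Alt) {l : ℕ}
    {v w : X.V} (h : IsPair X (2 * l) (2 * l) v w)
    (hv : ∀ n, l ≤ n → X.Q ((X.T ^ n) v) = 0) (hw : ∀ n, l ≤ n → X.Q ((X.T ^ n) w) = 0) :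
    ∃ w', IsPair X (2 * l) (2 * l) v w' ∧ ∀ n, X.Q ((X.T ^ n) w') = 0 := by
  obtain ⟨w2, ⟨s1, s2⟩, s3⟩ := kill
    (fun w => IsPair X (2 * l) (2 * l) v w ∧ ∀ n, l ≤ n → X.Q ((X.T ^ n) w) = 0)
    (fun w n => X.Q ((X.T ^ n) w)) (fun _ => False) l
    (by
      rintro a ⟨p1, p2⟩ n hn -
      have key : ∀ i, n ≤ i → ∀ c : k, X.Q ((X.T ^ i) (a + c • (X.T ^ (2 * l - 1 - 2 * n)) v)) =
          X.Q ((X.T ^ i) a) + if i = n then c else 0 := by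
        intro i hi c
        rw [Q_tp_add X hX, p1.pr, hv _ (by omega), mul_zero, add_zero]
        congr 1
        by_cases h' : i = n
        · rw [if_pos h', if_pos (by omega), mul_one]
        · rw [if_neg h', if_neg (by omega), mul_zero]
      refine ⟨a + (X.Q ((X.T ^ n) a)) • (X.T ^ (2 * l - 1 - 2 * n)) v,
        ⟨p1.addW hX _ _ (by omega), ?_⟩, ?_, ?_⟩
      · intro i hi
        rw [key i (by omega), if_neg (by omega), add_zero, p2 i hi]
      · rw [key n le_rfl, if_pos rfl, CharTwo.add_self_eq_zero]
      · intro i hi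
        rw [key i (by omega), if_neg (by omega), add_zero])
    w ⟨h, hw⟩
  refine ⟨w2, s1, fun n => ?_⟩
  rcases Nat.lt_or_ge n l with h2 | h2
  · exact s3 n h2 id
  · exact s2 n h2

theorem norm2 (X : FM.{u, v} k) (hX : X.Alt) {l : ℕ}
    {v w : X.V} (h : IsPair X (2 * l) (2 * l) v w)
    (hv : ∀ n, l ≤ n → X.Q ((X.T ^ n) v) = 0) (hw : ∀ n, l ≤ n → X.Q ((X.T ^ n) w) = 0) :
    ∃ v' w', IsW X (2 * l) l 0 v' w' := by
  obtain ⟨w', h1, h2⟩ := kill2 X hX h hv hw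
  obtain ⟨v', h3, h4⟩ := kill2 X hX (h1.swap hX) (fun n _ => h2 n) hv
  refine ⟨v', w', h3.swap hX, fun n => ?_, fun n => ?_⟩
  · rw [h4]; simp [wx]
  · rw [h2]; simp [wy]

/-- every pair can be normalised -/
theorem norm_pair (hsq : ∀ x : k, ∃ y, y * y = x) (X : FM.{u, v} k) (hX : X.Alt) {μ : ℕ}
    {v w : X.V} (h : IsPair X μ μ v w) :
    ∃ l δ v' w', μ ≤ 2 * l ∧ l ≤ μ ∧ IsW X μ l δ v' w' := by
  classical
  -- least bound
  have hex : ∃ l, μ ≤ 2 * l ∧ (∀ n, l ≤ n → X.Q ((X.T ^ n) v) = 0) ∧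
      (∀ n, l ≤ n → X.Q ((X.T ^ n) w) = 0) :=
    ⟨μ, by omega, fun n hn => by rw [X.tp_zero_of_le h.tv hn]; simp,
      fun n hn => by rw [X.tp_zero_of_le h.tw hn]; simp⟩
  obtain ⟨h1, h2, h3⟩ := Nat.find_spec hex
  have hmin := fun {m} => Nat.find_min hex (m := m)
  have hle : Nat.find hex ≤ μ := Nat.find_min' hex ⟨by omega,
    fun n hn => by rw [X.tp_zero_of_le h.tv hn]; simp,
      fun n hn => by rw [X.tp_zero_of_le h.tw hn]; simp⟩
  generalize Nat.find hex = l at *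
  rcases Nat.eq_or_lt_of_le h1 with he | hlt
  · subst he
    obtain ⟨v', w', hW⟩ := norm2 X hX h h2 h3
    exact ⟨l, 0, v', w', le_rfl, by omega, hW⟩
  · by_cases hv : X.Q ((X.T ^ (l - 1)) v) = 0
    · by_cases hw : X.Q ((X.T ^ (l - 1)) w) = 0
      · -- then μ = 2 l - 1
        have hμ : 2 * l = μ + 1 := by
          by_contra hc
          apply hmin (m := l - 1) (by omega)
          refine ⟨by omega, fun n hn => ?_, fun n hn => ?_⟩
          · rcases Nat.eq_or_lt_of_le hn with e | e
            · rw [← e]; exact hv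
            · exact h2 n (by omega)
          · rcases Nat.eq_or_lt_of_le hn with e | e
            · rw [← e]; exact hw
            · exact h3 n (by omega)
        have hp' : IsPair X μ μ (v + (1 : k) • (X.T ^ 0) w) w :=
          ((h.swap hX).addW hX 1 0 (by omega)).swap hX
        have hQ : ∀ n, X.Q ((X.T ^ n) (v + (1 : k) • (X.T ^ 0) w)) = X.Q ((X.T ^ n) v) +
            X.Q ((X.T ^ n) w) + if 2 * n + 1 = μ then 1 else 0 := by
          intro n
          rw [Q_tp_add X hX, (h.swap hX).pr]
          simp
        obtain ⟨δ, v', w', hW⟩ := norm1 hsq X hX hlt hp' (fun n hn => by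
            rw [hQ, h2 n hn, h3 n hn, if_neg (by omega)]; simp) h3 (by
            rw [hQ, hv, hw, if_pos (by omega)]; simp)
        exact ⟨l, δ, v', w', h1, hle, hW⟩
      · obtain ⟨δ, v', w', hW⟩ := norm1 hsq X hX hlt (h.swap hX) h3 h2 hw
        exact ⟨l, δ, v', w', h1, hle, hW⟩
    · obtain ⟨δ, v', w', hW⟩ := norm1 hsq X hX hlt h h2 h3 hv
      exact ⟨l, δ, v', w', h1, hle, hW⟩

/-- change of `δ` -/
theorem IsW.change {X : FM.{u, v} k} (hX : X.Alt) {μ l : ℕ} {δ : k} {v w : X.V}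
    (h : IsW X μ l δ v w) (hl : μ < 2 * l) (hl' : l ≤ μ) (c : k) :
    IsW X μ l (δ + (c * c + c)) v (w + c • (X.T ^ (2 * l - μ - 1)) v) := by
  refine ⟨h.pair.addW hX _ _ (by omega), h.qv, fun n => ?_⟩
  rw [Q_tp_add X hX, h.qw, h.qv, h.pair.pr]
  unfold wx wy
  by_cases h' : n + l = μ
  · rw [if_pos ⟨h', hl⟩, if_pos (by omega), if_pos (by omega), if_pos ⟨h', hl⟩]
    ring
  · rw [if_neg (fun q => h' q.1), if_neg (by omega), if_neg (by omega), if_neg (fun q => h' q.1)]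
    ring

/-- the block in normal form -/
@[reducible] noncomputable def W (μ l : ℕ) (δ : k) : FM.{u, u} k := Blk μ μ (wx k μ l) (wy μ l δ)

theorem W_gen {μ l : ℕ} (hl : μ ≤ 2 * l) (hl' : l ≤ μ) (δ : k) :
    IsW (W μ l δ) μ l δ (gv _ _ _ _) (gw _ _ _ _) := by
  refine ⟨gen_pair le_rfl _ _, fun n => ?_, fun n => ?_⟩
  · rw [gv_Q]
    split_ifs with h
    · rfl
    · unfold wx; rw [if_neg (by omega)]
  · rw [gw_Q]
    split_ifs with h
    · rfl
    · unfold wy; rw [if_neg (by omega)]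

theorem pair_iso (X : FM.{u, v} k) (hX : X.Alt) {μ : ℕ} {v w : X.V} (h : IsPair X μ μ v w)
    (hd : finrank k X.V = 2 * μ) (x y : ℕ → k) (hx : ∀ n, X.Q ((X.T ^ n) v) = x n)
    (hy : ∀ n, X.Q ((X.T ^ n) w) = y n) : Iso X (Blk μ μ x y) :=
  ((pair_hom X hX h x y (fun n _ => hx n) (fun n _ => hy n)).iso (Blk_adm μ x y)
    (by rw [Blk_finrank, hd, two_mul])).symm

theorem IsW.iso {X : FM.{u, v} k} (hX : X.Alt) {μ l : ℕ} {δ : k} {v w : X.V}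
    (h : IsW X μ l δ v w) (hd : finrank k X.V = 2 * μ) : Iso X (W μ l δ) :=
  pair_iso X hX h.pair hd _ _ h.qv h.qw

theorem W_change {μ l : ℕ} (hl : μ < 2 * l) (hl' : l ≤ μ) (δ c : k) :
    Iso (W μ l δ) (W μ l (δ + (c * c + c))) :=
  ((W_gen hl.le hl' δ).change (Blk_alt le_rfl _ _) hl hl' c).iso (Blk_alt le_rfl _ _)
    (by rw [Blk_finrank, two_mul])

theorem Blk_iso_W (hsq : ∀ x : k, ∃ y, y * y = x) (μ : ℕ) (x y : ℕ → k) :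
    ∃ l δ, μ ≤ 2 * l ∧ l ≤ μ ∧ Iso (Blk μ μ x y) (W μ l δ) := by
  obtain ⟨l, δ, v, w, h1, h2, h3⟩ := norm_pair hsq (Blk μ μ x y) (Blk_alt le_rfl _ _)
    (gen_pair le_rfl x y)
  exact ⟨l, δ, h1, h2, h3.iso (Blk_alt le_rfl _ _) (by rw [Blk_finrank, two_mul])⟩

end chartwo

end FormMod

namespace FormMod

universe u v w z t

section chartwo
variable {k : Type u} [Field k]

theorem IsPair.map {X : FM.{u, v} k} {Y : FM.{u, w} k} {e : X.V →ₗ[k] Y.V} (he : IsHom X Y e)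
    {a b : ℕ} {v w : X.V} (h : IsPair X a b v w) : IsPair Y a b (e v) (e w) :=
  ⟨by rw [← he.tp, h.tv, map_zero], by rw [← he.tp, h.tw, map_zero],
    fun n => by rw [← he.tp, he.B, h.pr]⟩

theorem hom_inl (X : FM.{u, v} k) (Y : FM.{u, w} k) :
    IsHom X (X.prod Y) (LinearMap.inl k X.V Y.V) :=
  ⟨fun a => (FM.prod_Q X Y a 0).trans (by simp), fun a => Prod.ext rfl (map_zero Y.T).symm⟩

theorem hom_inr (X : FM.{u, v} k) (Y : FM.{u, w} k) :
    IsHom Y (X.prod Y) (LinearMap.inr k X.V Y.V) :=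
  ⟨fun a => (FM.prod_Q X Y 0 a).trans (by simp), fun a => Prod.ext (map_zero X.T).symm rfl⟩

theorem orth_inl_inr (X : FM.{u, v} k) (Y : FM.{u, w} k) (a : X.V) (b : Y.V) :
    (X.prod Y).B (LinearMap.inl k X.V Y.V a) (LinearMap.inr k X.V Y.V b) = 0 :=
  (FM.prod_B X Y a 0 0 b).trans (by simp)

/-- orthogonality of two cyclic pairs -/
structure Orth (X : FM.{u, v} k) (v w v' w' : X.V) : Prop where
  vv : ∀ n, X.B ((X.T ^ n) v) v' = 0
  vw : ∀ n, X.B ((X.T ^ n) v) w' = 0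
  wv : ∀ n, X.B ((X.T ^ n) w) v' = 0
  ww : ∀ n, X.B ((X.T ^ n) w) w' = 0

theorem orth_prod (X : FM.{u, v} k) (Y : FM.{u, w} k) (v w : X.V) (v' w' : Y.V) :
    Orth (X.prod Y) (LinearMap.inl k X.V Y.V v) (LinearMap.inl k X.V Y.V w)
      (LinearMap.inr k X.V Y.V v') (LinearMap.inr k X.V Y.V w') :=
  ⟨fun n => by rw [← (hom_inl X Y).tp]; exact orth_inl_inr X Y _ _,
   fun n => by rw [← (hom_inl X Y).tp]; exact orth_inl_inr X Y _ _,
   fun n => by rw [← (hom_inl X Y).tp]; exact orth_inl_inr X Y _ _,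
   fun n => by rw [← (hom_inl X Y).tp]; exact orth_inl_inr X Y _ _⟩

/-- the subspace orthogonal to a pair, as form module -/
def perp (X : FM.{u, v} k) (v w : X.V) : Submodule k X.V where
  carrier := {a | ∀ n, X.B ((X.T ^ n) v) a = 0 ∧ X.B ((X.T ^ n) w) a = 0}
  zero_mem' := by intro n; simp
  add_mem' := by
    intro a b ha hb n
    simp [(ha n).1, (ha n).2, (hb n).1, (hb n).2]
  smul_mem' := by
    intro c a ha n
    simp [(ha n).1, (ha n).2]

theorem mem_perp (X : FM.{u, v} k) (v w a : X.V) :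
    a ∈ perp X v w ↔ ∀ n, X.B ((X.T ^ n) v) a = 0 ∧ X.B ((X.T ^ n) w) a = 0 := Iff.rfl

/-- form module on an invariant subspace -/
@[reducible] def subFM (X : FM.{u, v} k) (S : Submodule k X.V) (hS : ∀ a ∈ S, X.T a ∈ S) :
    FM.{u, v} k where
  V := S
  Q := X.Q.comp S.subtype
  T := X.T.restrict hS

theorem subFM_hom (X : FM.{u, v} k) (S : Submodule k X.V) (hS : ∀ a ∈ S, X.T a ∈ S) :
    IsHom (subFM X S hS) X S.subtype := ⟨fun _ => rfl, fun _ => rfl⟩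

variable [CharP k 2]

theorem orth_map {X : FM.{u, v} k} (hX : X.Alt) {v w v' w' : X.V} (h : Orth X v w v' w')
    {a b c d : ℕ} (p : (Fin a → k) × (Fin b → k)) (q : (Fin c → k) × (Fin d → k)) :
    X.B (pairMap X a b v w p) (pairMap X c d v' w' q) = 0 := by
  obtain ⟨f, g⟩ := p
  obtain ⟨f', g'⟩ := q
  rw [pairMap_apply, pairMap_apply]
  simp only [map_add, map_sum, map_smul, LinearMap.add_apply, LinearMap.sum_apply,
    LinearMap.smul_apply, hX.B_tp, h.vv, h.vw, h.wv, h.ww, smul_zero, Finset.sum_const_zero,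
    add_zero]

theorem two_pairs (X : FM.{u, v} k) (hX : X.Alt) {μ a b : ℕ} {v w v' w' : X.V}
    (h1 : IsPair X μ μ v w) (h2 : IsPair X a b v' w') (ho : Orth X v w v' w')
    (x y x' y' : ℕ → k) (hx : ∀ n, X.Q ((X.T ^ n) v) = x n)
    (hy : ∀ n, X.Q ((X.T ^ n) w) = y n) (hx' : ∀ n, X.Q ((X.T ^ n) v') = x' n)
    (hy' : ∀ n, X.Q ((X.T ^ n) w') = y' n) (hadm : (Blk a b x' y').Adm)
    (hd : finrank k X.V = 2 * μ + (a + b)) :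
    Iso X ((Blk μ μ x y).prod (Blk a b x' y')) :=
  (((pair_hom X hX h1 x y (fun n _ => hx n) (fun n _ => hy n)).coprod
    (pair_hom X hX h2 x' y' (fun n _ => hx' n) (fun n _ => hy' n))
    (fun p q => orth_map hX ho p q)).iso
    (FM.prod_adm (Blk_adm _ _ _) (Blk_nondef _ _ _) hadm)
    (by rw [FM.prod_finrank, Blk_finrank, Blk_finrank, hd, two_mul])).symm

theorem perp_inv {X : FM.{u, v} k} (hX : X.Alt) (v w : X.V) :
    ∀ a ∈ perp X v w, X.T a ∈ perp X v w := by
  intro a ha n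
  rw [← hX.adj, ← hX.adj, X.tp_succ', X.tp_succ']
  exact ha (n + 1)

theorem split (X : FM.{u, v} k) (hX : X.Adm) {μ : ℕ} {v w : X.V} (h : IsPair X μ μ v w) :
    ∃ Y : FM.{u, v} k, Y.Adm ∧ Iso X ((Blk μ μ (fun n => X.Q ((X.T ^ n) v))
      (fun n => X.Q ((X.T ^ n) w))).prod Y) := by
  let S := perp X v w
  let Y := subFM X S (perp_inv hX.alt v w)
  have hb := pair_hom X hX.alt h _ _ (fun n _ => rfl) (fun n _ => rfl)
  have hY := subFM_hom X S (perp_inv hX.alt v w)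
  have ho : ∀ (p : (Blk μ μ (fun n => X.Q ((X.T ^ n) v)) (fun n => X.Q ((X.T ^ n) w))).V) (s : X.V),
      s ∈ S → X.B (pairMap X μ μ v w p) s = 0 := by
    rintro ⟨f, g⟩ s hs
    rw [pairMap_apply]
    simp only [map_add, map_sum, map_smul, LinearMap.add_apply, LinearMap.sum_apply,
      LinearMap.smul_apply, (hs _).1, (hs _).2, smul_zero, Finset.sum_const_zero, add_zero]
  have hc := hb.coprod hY (fun p q => ho p q.1 q.2)
  have hinj : Function.Injective ((pairMap X μ μ v w).coprod S.subtype) := by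
    rw [← LinearMap.ker_eq_bot, LinearMap.ker_eq_bot']
    rintro ⟨p, s⟩ hps
    rw [LinearMap.coprod_apply] at hps
    have hmem : pairMap X μ μ v w p ∈ S := by
      have : pairMap X μ μ v w p = -(S.subtype s) := eq_neg_of_add_eq_zero_left hps
      rw [this]
      exact S.neg_mem s.2
    have hp : p = 0 := by
      apply Blk_nondef μ (fun n => X.Q ((X.T ^ n) v)) (fun n => X.Q ((X.T ^ n) w)) p
      intro q
      rw [← hb.B, X.B_comm]
      exact ho q _ hmem
    subst hp
    rw [map_zero, zero_add] at hps
    have : s = 0 := Subtype.ext hps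
    rw [this]; rfl
  have hdim : finrank k X.V ≤ 2 * μ + finrank k S := by
    let Φ : X.V →ₗ[k] ((Fin μ → k) × (Fin μ → k)) :=
      (LinearMap.pi fun i : Fin μ => X.B ((X.T ^ i.1) v)).prod
        (LinearMap.pi fun i : Fin μ => X.B ((X.T ^ i.1) w))
    have hker : LinearMap.ker Φ ≤ S := by
      intro a ha n
      rw [LinearMap.mem_ker] at ha
      have h1 := congrArg Prod.fst ha
      have h2 := congrArg Prod.snd ha
      rcases Nat.lt_or_ge n μ with hn | hn
      · exact ⟨congrFun h1 ⟨n, hn⟩, congrFun h2 ⟨n, hn⟩⟩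
      · rw [X.tp_zero_of_le h.tv hn, X.tp_zero_of_le h.tw hn]; simp
    have h1 := LinearMap.finrank_range_add_finrank_ker Φ
    have h2 := Submodule.finrank_mono hker
    have h3 := Submodule.finrank_le (LinearMap.range Φ)
    have h4 : finrank k ((Fin μ → k) × (Fin μ → k)) = μ + μ := by simp
    omega
  have hle := LinearMap.finrank_le_finrank_of_injective hinj
  have hprod : finrank k ((Blk μ μ (fun n => X.Q ((X.T ^ n) v)) (fun n => X.Q ((X.T ^ n) w))).V × S)
      = μ + μ + finrank k S := by
    rw [Module.finrank_prod, Blk_finrank]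
  have heq : finrank k ((Blk μ μ (fun n => X.Q ((X.T ^ n) v))
      (fun n => X.Q ((X.T ^ n) w))).V × S) = finrank k X.V := by
    have : finrank k ((Blk μ μ (fun n => X.Q ((X.T ^ n) v)) (fun n => X.Q ((X.T ^ n) w))).V × S)
      ≤ finrank k X.V := hle
    omega
  have hiso : Iso ((Blk μ μ (fun n => X.Q ((X.T ^ n) v)) (fun n => X.Q ((X.T ^ n) w))).prod Y) X :=
    ⟨LinearMap.linearEquivOfInjective _ hinj heq, fun a => hc.1 a, fun a => hc.2 a⟩
  exact ⟨Y, FM.adm_of_prod (hiso.symm.adm hX), hiso.symm⟩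

theorem Blk_norm1 (hsq : ∀ x : k, ∃ y, y * y = x) {μ l : ℕ} (hl : μ < 2 * l) (hl' : l ≤ μ)
    (x y : ℕ → k) (hx : ∀ n, l ≤ n → x n = 0) (hy : ∀ n, l ≤ n → y n = 0) (hne : x (l - 1) ≠ 0) :
    ∃ δ, Iso (Blk μ μ x y) (W μ l δ) := by
  obtain ⟨δ, v, w, h⟩ := norm1 hsq (Blk μ μ x y) (Blk_alt le_rfl _ _) hl (gen_pair le_rfl x y)
    (fun n hn => by rw [gv_Q, hx n hn]; simp) (fun n hn => by rw [gw_Q, hy n hn]; simp)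
    (by rw [gv_Q, if_pos (by omega)]; exact hne)
  exact ⟨δ, h.iso (Blk_alt le_rfl _ _) (by rw [Blk_finrank, two_mul])⟩

theorem IsW.map {X : FM.{u, v} k} {Y : FM.{u, w} k} {e : X.V →ₗ[k] Y.V} (he : IsHom X Y e)
    {μ l : ℕ} {δ : k} {v w : X.V} (h : IsW X μ l δ v w) : IsW Y μ l δ (e v) (e w) :=
  ⟨h.pair.map he, fun n => by rw [← he.tp, he.1, h.qv], fun n => by rw [← he.tp, he.1, h.qw]⟩

theorem B_left_zero_of {X : FM.{u, v} k} (hX : X.Alt) {a b : X.V} (n : ℕ)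
    (h : X.B ((X.T ^ n) b) a = 0) : X.B ((X.T ^ n) a) b = 0 := by
  rw [hX.adjp, X.B_comm, h]

theorem Orth.symm {X : FM.{u, v} k} (hX : X.Alt) {v w v' w' : X.V} (h : Orth X v w v' w') :
    Orth X v' w' v w :=
  ⟨fun n => B_left_zero_of hX n (h.vv n), fun n => B_left_zero_of hX n (h.wv n),
   fun n => B_left_zero_of hX n (h.vw n), fun n => B_left_zero_of hX n (h.ww n)⟩

/-- first move: raise an index -/
theorem raise (hsq : ∀ x : k, ∃ y, y * y = x) {m1 l1 m2 l2 : ℕ} (δ1 δ2 : k)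
    (h1 : m1 ≤ 2 * l1) (h1' : l1 ≤ m1) (h2 : m2 ≤ 2 * l2) (h2' : l2 ≤ m2)
    (hlt : l2 + (m1 - m2) < l1) :
    ∃ δ1' δ2', Iso ((W m1 l1 δ1).prod (W m2 l2 δ2))
      ((W m1 l1 δ1').prod (W m2 (l1 - (m1 - m2)) δ2')) := by
  let X := (W m1 l1 δ1).prod (W m2 l2 δ2)
  have hX : X.Alt := FM.prod_alt (Blk_alt le_rfl _ _) (Blk_alt le_rfl _ _)
  have hd : finrank k X.V = 2 * m1 + (m2 + m2) := by
    rw [FM.prod_finrank, Blk_finrank, Blk_finrank, two_mul]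
  obtain ⟨v1, w1, v2, w2, p1, p2, ho⟩ : ∃ v1 w1 v2 w2 : X.V, IsW X m1 l1 δ1 v1 w1 ∧ IsW X m2 l2 δ2 v2 w2 ∧
      Orth X v1 w1 v2 w2 :=
    ⟨_, _, _, _, (W_gen h1 h1' δ1).map (hom_inl (W m1 l1 δ1) (W m2 l2 δ2)),
      (W_gen h2 h2' δ2).map (hom_inr (W m1 l1 δ1) (W m2 l2 δ2)), orth_prod _ _ _ _ _ _⟩
  have ho' := ho.symm hX
  have q1 : IsPair X m1 m1 v1 (w1 + (1 : k) • (X.T ^ (m2 - m1)) w2) := by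
    refine ⟨p1.pair.tv, tp_add_zero X _ _ p1.pair.tw (X.tp_zero_of_le p2.pair.tw (by omega)),
      fun n => ?_⟩
    rw [B_tp_add X hX, p1.pair.pr, ho.vw, mul_zero, add_zero]
  have q2 : IsPair X m2 m2 (v2 + (1 : k) • (X.T ^ (m1 - m2)) v1) w2 := by
    refine ⟨tp_add_zero X _ _ p2.pair.tv (X.tp_zero_of_le p1.pair.tv (by omega)), p2.pair.tw,
      fun n => ?_⟩
    rw [B_tp_add_left, p2.pair.pr, ho.vw, mul_zero, add_zero]
  have qo : Orth X v1 (w1 + (1 : k) • (X.T ^ (m2 - m1)) w2)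
      (v2 + (1 : k) • (X.T ^ (m1 - m2)) v1) w2 := by
    refine ⟨fun n => ?_, fun n => ho.vw n, fun n => ?_, fun n => ?_⟩
    · rw [B_tp_add X hX, ho.vv, hX.self_tp]; simp
    · rw [B_tp_add_left, B_tp_add X hX, ho.wv, (p1.pair.swap hX).pr, B_tp_add X hX,
        (p2.pair.swap hX).pr, ho'.wv]
      by_cases hc : n + (m1 - m2) + 1 = m1
      · rw [if_pos hc, if_pos (by omega)]
        simp [CharTwo.add_self_eq_zero]
      · rw [if_neg hc, if_neg (by omega)]
        simp
    · rw [B_tp_add_left, ho.ww, hX.self_tp]; simp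
  have hx2 : ∀ n, X.Q ((X.T ^ n) (v2 + (1 : k) • (X.T ^ (m1 - m2)) v1)) =
      wx k m2 l2 n + wx k m1 l1 (n + (m1 - m2)) := by
    intro n
    rw [Q_tp_add X hX, p2.qv, p1.qv, ho.vv]; ring
  have hy1 : ∀ n, X.Q ((X.T ^ n) (w1 + (1 : k) • (X.T ^ (m2 - m1)) w2)) =
      wy m1 l1 δ1 n + wy m2 l2 δ2 (n + (m2 - m1)) := by
    intro n
    rw [Q_tp_add X hX, p1.qw, p2.qw, ho'.ww]; ring
  have hi := two_pairs X hX q1 q2 qo _ _ _ _ p1.qv hy1 hx2 p2.qw (Blk_adm _ _ _) hd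
  obtain ⟨d1, e1⟩ := Blk_norm1 hsq (μ := m1) (l := l1) (by omega) h1' (wx k m1 l1)
    (fun n => wy m1 l1 δ1 n + wy m2 l2 δ2 (n + (m2 - m1)))
    (fun n hn => by unfold wx; rw [if_neg (by omega)])
    (fun n hn => by unfold wy; rw [if_neg (by omega), if_neg (by omega), add_zero])
    (by unfold wx; rw [if_pos (by omega)]; exact one_ne_zero)
  obtain ⟨d2, e2⟩ := Blk_norm1 hsq (μ := m2) (l := l1 - (m1 - m2)) (by omega) (by omega)
    (fun n => wx k m2 l2 n + wx k m1 l1 (n + (m1 - m2))) (wy m2 l2 δ2)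
    (fun n hn => by unfold wx; rw [if_neg (by omega), if_neg (by omega), add_zero])
    (fun n hn => by unfold wy; rw [if_neg (by omega)])
    (by unfold wx; rw [if_neg (by omega), if_pos (by omega)]; simp)
  exact ⟨d1, d2, hi.trans (e1.prod e2)⟩

/-- second move: shift a constant to a smaller block -/
theorem shift (hsq : ∀ x : k, ∃ y, y * y = x) {m1 l1 m2 l2 : ℕ} (δ1 δ2 : k)
    (h1 : m1 < 2 * l1) (h1' : l1 ≤ m1) (h2 : m2 < 2 * l2) (h2' : l2 ≤ m2) (h12 : m2 ≤ m1)
    (hlt : m1 < l1 + l2) :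
    Iso ((W m1 l1 δ1).prod (W m2 l2 δ2)) ((W m1 l1 0).prod (W m2 l2 (δ2 + δ1))) := by
  let X := (W m1 l1 δ1).prod (W m2 l2 δ2)
  have hX : X.Alt := FM.prod_alt (Blk_alt le_rfl _ _) (Blk_alt le_rfl _ _)
  have hd : finrank k X.V = 2 * m1 + (m2 + m2) := by
    rw [FM.prod_finrank, Blk_finrank, Blk_finrank, two_mul]
  obtain ⟨v1, w1, v2, w2, p1, p2, ho⟩ : ∃ v1 w1 v2 w2 : X.V, IsW X m1 l1 δ1 v1 w1 ∧ IsW X m2 l2 δ2 v2 w2 ∧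
      Orth X v1 w1 v2 w2 :=
    ⟨_, _, _, _, (W_gen h1.le h1' δ1).map (hom_inl (W m1 l1 δ1) (W m2 l2 δ2)),
      (W_gen h2.le h2' δ2).map (hom_inr (W m1 l1 δ1) (W m2 l2 δ2)), orth_prod _ _ _ _ _ _⟩
  have ho' := ho.symm hX
  obtain ⟨c, hc⟩ := hsq δ1
  have q1 : IsPair X m1 m1 v1 (w1 + c • (X.T ^ (l1 + l2 - 1 - m1)) v2) := by
    refine ⟨p1.pair.tv, tp_add_zero X _ _ p1.pair.tw (X.tp_zero_of_le p2.pair.tv (by omega)),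
      fun n => ?_⟩
    rw [B_tp_add X hX, p1.pair.pr, ho.vv, mul_zero, add_zero]
  have q2 : IsPair X m2 m2 v2 (w2 + c • (X.T ^ (l1 + l2 - 1 - m2)) v1) := by
    refine ⟨p2.pair.tv, tp_add_zero X _ _ p2.pair.tw (X.tp_zero_of_le p1.pair.tv (by omega)),
      fun n => ?_⟩
    rw [B_tp_add X hX, p2.pair.pr, ho'.vv, mul_zero, add_zero]
  have qo : Orth X v1 (w1 + c • (X.T ^ (l1 + l2 - 1 - m1)) v2)
      v2 (w2 + c • (X.T ^ (l1 + l2 - 1 - m2)) v1) := by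
    refine ⟨fun n => ho.vv n, fun n => ?_, fun n => ?_, fun n => ?_⟩
    · rw [B_tp_add X hX, ho.vw, hX.self_tp]; simp
    · rw [B_tp_add_left, ho.wv, hX.self_tp]; simp
    · rw [B_tp_add_left, B_tp_add X hX, ho.ww, (p1.pair.swap hX).pr, B_tp_add X hX,
        p2.pair.pr, ho'.vv]
      by_cases hc : n + (l1 + l2 - 1 - m2) + 1 = m1
      · rw [if_pos hc, if_pos (by omega)]
        simp [CharTwo.add_self_eq_zero]
      · rw [if_neg hc, if_neg (by omega)]
        simp
  refine two_pairs X hX q1 q2 qo _ _ _ _ p1.qv (fun n => ?_) p2.qv (fun n => ?_)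
    (Blk_adm _ _ _) hd
  · rw [Q_tp_add X hX, p1.qw, p2.qv, ho'.vw, hc]
    unfold wx wy
    by_cases h' : n + l1 = m1
    · rw [if_pos (by omega), if_pos (by omega), if_pos (by omega), mul_one, mul_zero, add_zero,
        CharTwo.add_self_eq_zero]
    · rw [if_neg (by omega), if_neg (by omega), if_neg (by omega)]; ring
  · rw [Q_tp_add X hX, p2.qw, p1.qv, ho.vw, hc]
    unfold wx wy
    by_cases h' : n + l2 = m2
    · rw [if_pos (by omega), if_pos (by omega), if_pos (by omega)]; ring
    · rw [if_neg (by omega), if_neg (by omega), if_neg (by omega)]; ring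

/-- profile of defective block -/
def dx (k : Type u) [Field k] (m : ℕ) (n : ℕ) : k := if n = m then 1 else 0

/-- defective block of sizes `m+1, m` -/
@[reducible] noncomputable def D (k : Type u) [Field k] (m : ℕ) : FM.{u, u} k :=
  Blk (m + 1) m (dx k m) (fun _ => 0)

theorem D_adm (m : ℕ) : (D k m).Adm := Blk_adm' m _ _ (by simp [dx])

/-- pair in the normal form of the defective block -/
structure IsD (X : FM.{u, v} k) (m : ℕ) (v w : X.V) : Prop where
  pair : IsPair X (m + 1) m v w
  qv : ∀ n, X.Q ((X.T ^ n) v) = dx k m n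
  qw : ∀ n, X.Q ((X.T ^ n) w) = 0

theorem IsD.map {X : FM.{u, v} k} {Y : FM.{u, w} k} {e : X.V →ₗ[k] Y.V} (he : IsHom X Y e)
    {m : ℕ} {v w : X.V} (h : IsD X m v w) : IsD Y m (e v) (e w) :=
  ⟨h.pair.map he, fun n => by rw [← he.tp, he.1, h.qv], fun n => by rw [← he.tp, he.1, h.qw]⟩

theorem D_gen (m : ℕ) : IsD (D k m) m (gv _ _ _ _) (gw _ _ _ _) := by
  refine ⟨gen_pair (by omega) _ _, fun n => ?_, fun n => ?_⟩
  · rw [gv_Q]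
    split_ifs with h
    · rfl
    · unfold dx; rw [if_neg (by omega)]
  · rw [gw_Q]; simp

theorem IsPair.smul {X : FM.{u, v} k} {a b : ℕ} {v w : X.V} (h : IsPair X a b v w) {d : k}
    (hd : d ≠ 0) : IsPair X a b (d⁻¹ • v) (d • w) := by
  refine ⟨by rw [map_smul, h.tv, smul_zero], by rw [map_smul, h.tw, smul_zero], fun n => ?_⟩
  rw [map_smul, map_smul, map_smul X.B, LinearMap.smul_apply, h.pr]
  split_ifs <;> simp [hd]

/-- normal form of the defective pair -/
theorem normD (hsq : ∀ x : k, ∃ y, y * y = x) (X : FM.{u, v} k) (hX : X.Alt) {m : ℕ} {v w : X.V}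
    (h : IsPair X (m + 1) m v w) (hne : X.Q ((X.T ^ m) v) ≠ 0) : ∃ v' w', IsD X m v' w' := by
  obtain ⟨d, hd⟩ := hsq (X.Q ((X.T ^ m) v))
  have hd0 : d ≠ 0 := by rintro rfl; apply hne; rw [← hd]; simp
  have h' := h.smul hd0
  obtain ⟨v', ⟨q1, q2, q3⟩, q4⟩ := normV hsq X hX (d⁻¹ • v) m
    (fun n hn => by rw [X.tp_zero_of_le h'.tv (by omega)]; simp)
    (by rw [map_smul, X.Q_smul, ← hd]; field_simp)
    (fun v' => (X.T ^ (m + 1)) v' = 0 ∧ (m ≠ 0 → X.B ((X.T ^ (m - 1)) v') (d • w) = 1) ∧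
      ∀ n, m - 1 < n → X.B ((X.T ^ n) v') (d • w) = 0)
    ⟨h'.tv, fun hm => by rw [h'.pr, if_pos (by omega)],
     by intro n hn
        rw [h'.pr, if_neg (by omega)]⟩
    (by
      rintro a c N hN ⟨p1, p2, p3⟩
      refine ⟨tp_add_zero X c N p1 (X.tp_zero_of_le p1 (by omega)), ?_, ?_⟩
      · intro hm
        rw [B_tp_add_left, p2 hm, p3 _ (by omega), mul_zero, add_zero]
      · intro n hn
        rw [B_tp_add_left, p3 _ (by omega), p3 _ (by omega), mul_zero, add_zero])
  have : ∃ w1, IsPair X (m + 1) m v' w1 := by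
    rcases Nat.eq_zero_or_pos m with hm | hm
    · subst hm
      refine ⟨0, q1, by simp, fun n => by simp⟩
    · obtain ⟨w1, r1, r3⟩ := lemP X hX v' (d • w) (m - 1) q3 (q2 (by omega))
        (fun w => (X.T ^ m) w = 0) h'.tw
        (fun a c N p1 => tp_add_zero X c N p1 (X.tp_zero_of_le p1 (by omega)))
      exact ⟨w1, q1, r1, by rwa [show m - 1 + 1 = m by omega] at r3⟩
  obtain ⟨w1, hp⟩ := this
  obtain ⟨w2, s1, s3⟩ := kill
    (fun w => IsPair X (m + 1) m v' w)
    (fun w n => X.Q ((X.T ^ n) w)) (fun n => False) m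
    (by
      rintro a p1 n hn -
      obtain ⟨c, hc'⟩ := hsq (X.Q ((X.T ^ n) a))
      have key : ∀ i, n ≤ i → X.Q ((X.T ^ i) (a + c • (X.T ^ (m - n)) v')) =
          X.Q ((X.T ^ i) a) + if i = n then c * c else 0 := by
        intro i hi
        rw [Q_tp_add X hX, q4, p1.pr, if_neg (show ¬ (2 * i + (m - n) + 1 = m) by omega),
          mul_zero, add_zero]
        congr 1
        by_cases h' : i = n
        · rw [if_pos h', if_pos (by omega), mul_one]
        · rw [if_neg h', if_neg (by omega), mul_zero]
      refine ⟨a + c • (X.T ^ (m - n)) v', p1.addW hX _ _ (by omega), ?_, ?_⟩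
      · rw [key n le_rfl, if_pos rfl, hc', CharTwo.add_self_eq_zero]
      · intro i hi
        rw [key i (by omega), if_neg (by omega), add_zero])
    w1 hp
  refine ⟨v', w2, s1, q4, fun n => ?_⟩
  rcases Nat.lt_or_ge n m with h2 | h2
  · exact s3 n h2 id
  · rw [X.tp_zero_of_le s1.tw h2]; simp

theorem IsD.iso {X : FM.{u, v} k} (hX : X.Alt) {m : ℕ} {v w : X.V}
    (h : IsD X m v w) (hd : finrank k X.V = 2 * m + 1) : Iso X (D k m) :=
  ((pair_hom X hX h.pair _ _ (fun n _ => h.qv n) (fun n _ => h.qw n)).iso (D_adm m)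
    (by rw [Blk_finrank, hd]; omega)).symm

theorem Blk_iso_D (hsq : ∀ x : k, ∃ y, y * y = x) (m : ℕ) (x y : ℕ → k) (hx : x m ≠ 0) :
    Iso (Blk (m + 1) m x y) (D k m) := by
  obtain ⟨v, w, h⟩ := normD hsq (Blk (m + 1) m x y) (Blk_alt (by omega) _ _)
    (gen_pair (by omega) x y) (by rw [gv_Q, if_pos (by omega)]; exact hx)
  exact h.iso (Blk_alt (by omega) _ _) (by rw [Blk_finrank]; omega)

theorem raiseD (hsq : ∀ x : k, ∃ y, y * y = x) {μ l m : ℕ} (δ : k)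
    (h1 : μ ≤ 2 * l) (h1' : l ≤ μ) (hm : m + 1 < μ) (hl : l ≤ m) :
    ∃ δ', Iso ((W μ l δ).prod (D k m)) ((W μ (m + 1) δ').prod (D k m)) := by
  let X := (W μ l δ).prod (D k m)
  have hX : X.Alt := FM.prod_alt (Blk_alt le_rfl _ _) (D_adm m).alt
  have hd : finrank k X.V = 2 * μ + (m + 1 + m) := by
    rw [FM.prod_finrank, Blk_finrank, Blk_finrank, two_mul]
  obtain ⟨v1, w1, v2, w2, p1, p2, ho⟩ : ∃ v1 w1 v2 w2 : X.V, IsW X μ l δ v1 w1 ∧ IsD X m v2 w2 ∧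
      Orth X v1 w1 v2 w2 :=
    ⟨_, _, _, _, (W_gen h1 h1' δ).map (hom_inl (W μ l δ) (D k m)),
      (D_gen m).map (hom_inr (W μ l δ) (D k m)), orth_prod _ _ _ _ _ _⟩
  have ho' := ho.symm hX
  have q1 : IsPair X μ μ (v1 + (1 : k) • (X.T ^ 0) v2) w1 := by
    refine ⟨tp_add_zero X _ _ p1.pair.tv (X.tp_zero_of_le p2.pair.tv (by omega)), p1.pair.tw,
      fun n => ?_⟩
    rw [B_tp_add_left, p1.pair.pr, ho'.vw, mul_zero, add_zero]
  have q2 : IsPair X (m + 1) m v2 (w2 + (1 : k) • (X.T ^ (μ - m)) w1) := by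
    refine ⟨p2.pair.tv, tp_add_zero X _ _ p2.pair.tw (X.tp_zero_of_le p1.pair.tw (by omega)),
      fun n => ?_⟩
    rw [B_tp_add X hX, p2.pair.pr, ho'.vw, mul_zero, add_zero]
  have qo : Orth X (v1 + (1 : k) • (X.T ^ 0) v2) w1
      v2 (w2 + (1 : k) • (X.T ^ (μ - m)) w1) := by
    refine ⟨fun n => ?_, fun n => ?_, fun n => ho.wv n, fun n => ?_⟩
    · rw [B_tp_add_left, ho.vv, hX.self_tp]; simp
    · rw [B_tp_add_left, B_tp_add X hX, ho.vw, p1.pair.pr, B_tp_add X hX,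
        p2.pair.pr, ho'.vw]
      by_cases hc : n + 1 = m
      · rw [if_pos (by omega), if_pos (by omega)]
        simp [CharTwo.add_self_eq_zero]
      · rw [if_neg (by omega), if_neg (by omega)]
        simp
    · rw [B_tp_add X hX, ho.ww, hX.self_tp]; simp
  have hx1 : ∀ n, X.Q ((X.T ^ n) (v1 + (1 : k) • (X.T ^ 0) v2)) =
      wx k μ l n + dx k m n := by
    intro n
    rw [Q_tp_add X hX, p1.qv, p2.qv, ho'.vv]; simp
  have hi := two_pairs X hX q1 q2 qo _ _ _ _ hx1 p1.qw p2.qv (fun n => rfl)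
    (Blk_adm' _ _ _ (by simp [dx])) hd
  obtain ⟨d1, e1⟩ := Blk_norm1 hsq (μ := μ) (l := m + 1) (by omega) (by omega)
    (fun n => wx k μ l n + dx k m n) (wy μ l δ)
    (fun n hn => by unfold wx dx; rw [if_neg (by omega), if_neg (by omega), add_zero])
    (fun n hn => by unfold wy; rw [if_neg (by omega)])
    (by unfold wx dx; rw [if_neg (by omega), if_pos (by omega)]; simp)
  exact ⟨d1, hi.trans (e1.prod (Blk_iso_D hsq _ _ _ (by simp [dx])))⟩

theorem shiftD (hsq : ∀ x : k, ∃ y, y * y = x) {μ l m : ℕ} (δ : k)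
    (h1 : μ < 2 * l) (h1' : l ≤ μ) (hm : μ ≤ l + m) :
    Iso ((W μ l δ).prod (D k m)) ((W μ l 0).prod (D k m)) := by
  let X := (W μ l δ).prod (D k m)
  have hX : X.Alt := FM.prod_alt (Blk_alt le_rfl _ _) (D_adm m).alt
  have hd : finrank k X.V = 2 * μ + (m + 1 + m) := by
    rw [FM.prod_finrank, Blk_finrank, Blk_finrank, two_mul]
  obtain ⟨v1, w1, v2, w2, p1, p2, ho⟩ : ∃ v1 w1 v2 w2 : X.V, IsW X μ l δ v1 w1 ∧ IsD X m v2 w2 ∧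
      Orth X v1 w1 v2 w2 :=
    ⟨_, _, _, _, (W_gen h1.le h1' δ).map (hom_inl (W μ l δ) (D k m)),
      (D_gen m).map (hom_inr (W μ l δ) (D k m)), orth_prod _ _ _ _ _ _⟩
  have ho' := ho.symm hX
  obtain ⟨c, hc⟩ := hsq δ
  have q1 : IsPair X μ μ v1 (w1 + c • (X.T ^ (m + l - μ)) v2) := by
    refine ⟨p1.pair.tv, tp_add_zero X _ _ p1.pair.tw (X.tp_zero_of_le p2.pair.tv (by omega)),
      fun n => ?_⟩
    rw [B_tp_add X hX, p1.pair.pr, ho.vv, mul_zero, add_zero]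
  have q2 : IsPair X (m + 1) m v2 (w2 + c • (X.T ^ l) v1) := by
    refine ⟨p2.pair.tv, tp_add_zero X _ _ p2.pair.tw (X.tp_zero_of_le p1.pair.tv (by omega)),
      fun n => ?_⟩
    rw [B_tp_add X hX, p2.pair.pr, ho'.vv, mul_zero, add_zero]
  have qo : Orth X v1 (w1 + c • (X.T ^ (m + l - μ)) v2) v2 (w2 + c • (X.T ^ l) v1) := by
    refine ⟨fun n => ho.vv n, fun n => ?_, fun n => ?_, fun n => ?_⟩
    · rw [B_tp_add X hX, ho.vw, hX.self_tp]; simp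
    · rw [B_tp_add_left, ho.wv, hX.self_tp]; simp
    · rw [B_tp_add_left, B_tp_add X hX, ho.ww, (p1.pair.swap hX).pr, B_tp_add X hX,
        p2.pair.pr, ho'.vv]
      by_cases hc : n + l + 1 = μ
      · rw [if_pos hc, if_pos (by omega)]
        simp [CharTwo.add_self_eq_zero]
      · rw [if_neg hc, if_neg (by omega)]
        simp
  refine two_pairs X hX q1 q2 qo _ _ _ _ p1.qv (fun n => ?_) p2.qv (fun n => ?_)
    (D_adm m) hd
  · rw [Q_tp_add X hX, p1.qw, p2.qv, ho'.vw, hc]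
    unfold dx wy
    by_cases h' : n + l = μ
    · rw [if_pos (by omega), if_pos (by omega), if_pos (by omega), mul_one, mul_zero, add_zero,
        CharTwo.add_self_eq_zero]
    · rw [if_neg (by omega), if_neg (by omega), if_neg (by omega)]; ring
  · rw [Q_tp_add X hX, p2.qw, p1.qv, ho.vw, hc]
    unfold wx
    rw [if_neg (by omega)]; ring

end chartwo

end FormMod

namespace FormMod

universe u v w z t

section decomposition
variable {k : Type u} [Field k]

theorem indep (X : FM.{u, v} k) {M s n : ℕ} {v : X.V} (h0 : (X.T ^ (M + 1)) v = 0)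
    (h1 : (X.T ^ M) v ≠ 0) (c : Fin n → k) (h : ∑ i, c i • (X.T ^ (i.1 + s)) v = 0) :
    ∀ i : Fin n, i.1 + s ≤ M → c i = 0 := by
  have key : ∀ N, ∀ i : Fin n, i.1 = N → i.1 + s ≤ M → c i = 0 := by
    intro N
    induction N using Nat.strong_induction_on with
    | _ N ih =>
      intro i hi hs
      have h2 := congrArg (X.T ^ (M - s - i.1)) h
      rw [map_sum, map_zero, Finset.sum_eq_single i] at h2
      · rw [map_smul, X.tp, show M - s - i.1 + (i.1 + s) = M by omega] at h2
        exact (smul_eq_zero.1 h2).resolve_right h1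
      · intro j _ hj
        have hne : j.1 ≠ i.1 := fun h => hj (Fin.ext h)
        rcases Nat.lt_or_ge j.1 i.1 with hlt | hge
        · rw [ih j.1 (by omega) j rfl (by omega), zero_smul, map_zero]
        · rw [map_smul, X.tp, X.tp_zero_of_le h0 (by omega), smul_zero]
      · intro hh
        exact absurd (Finset.mem_univ i) hh
  exact fun i => key i.1 i rfl

/-- isotropic block -/
@[reducible] noncomputable def H (k : Type u) [Field k] (ν : ℕ) : FM.{u, u} k :=
  Blk ν ν (fun _ => 0) (fun _ => 0)

/-- sum of isotropic blocks with a tail -/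
noncomputable def hs (k : Type u) [Field k] (R : FM.{u, u} k) : List ℕ → FM.{u, u} k
  | [] => R
  | ν :: l => (H k ν).prod (hs k R l)

variable [CharP k 2]

theorem rad_unique (hsq : ∀ x : k, ∃ y, y * y = x) {X : FM.{u, v} k} (hX : X.Adm) {a b : X.V}
    (ha : ∀ c, X.B a c = 0) (hb : ∀ c, X.B b c = 0) (hb0 : b ≠ 0) : ∃ s : k, a = s • b := by
  have hq : X.Q b ≠ 0 := fun h => hb0 (hX.rad b hb h)
  obtain ⟨s, hs⟩ := hsq (X.Q a / X.Q b)
  refine ⟨s, ?_⟩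
  have h1 : a + s • b = 0 := by
    apply hX.rad
    · intro c
      rw [map_add, map_smul, LinearMap.add_apply, LinearMap.smul_apply, ha, hb]; simp
    · rw [X.Q_add, X.Q_smul, ha, hs, div_mul_cancel₀ _ hq, add_zero, CharTwo.add_self_eq_zero]
  have h2 : s • b + s • b = 0 := by rw [← add_smul, CharTwo.add_self_eq_zero, zero_smul]
  calc a = a + (s • b + s • b) := by rw [h2, add_zero]
    _ = s • b := by rw [← add_assoc, h1, zero_add]

/-- the cyclic span -/
def cyc (X : FM.{u, v} k) (M : ℕ) (v : X.V) : Submodule k X.V :=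
  Submodule.span k (Set.range fun i : Fin (M + 1) => (X.T ^ i.1) v)

theorem mem_cyc (X : FM.{u, v} k) (M : ℕ) (v y : X.V) :
    y ∈ cyc X M v ↔ ∃ c : Fin (M + 1) → k, ∑ i, c i • (X.T ^ i.1) v = y :=
  Submodule.mem_span_range_iff_exists_fun k

theorem tp_mem_cyc (X : FM.{u, v} k) {M : ℕ} {v : X.V} (h0 : (X.T ^ (M + 1)) v = 0) (n : ℕ) :
    (X.T ^ n) v ∈ cyc X M v := by
  rcases Nat.lt_or_ge n (M + 1) with h | h
  · exact Submodule.subset_span ⟨⟨n, h⟩, rfl⟩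
  · rw [X.tp_zero_of_le h0 h]; exact Submodule.zero_mem _

theorem cyc_tp (X : FM.{u, v} k) {M : ℕ} {v y : X.V} (h0 : (X.T ^ (M + 1)) v = 0) (n : ℕ)
    (hy : y ∈ cyc X M v) : (X.T ^ n) y ∈ cyc X M v := by
  obtain ⟨c, rfl⟩ := (mem_cyc X M v y).1 hy
  rw [map_sum]
  refine Submodule.sum_mem _ fun i _ => ?_
  rw [map_smul, X.tp]
  exact Submodule.smul_mem _ _ (tp_mem_cyc X h0 _)

theorem cyc_orth (X : FM.{u, v} k) {M : ℕ} {v y a : X.V} (hy : y ∈ cyc X M v)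
    (ha : ∀ n, X.B ((X.T ^ n) v) a = 0) : X.B y a = 0 := by
  obtain ⟨c, rfl⟩ := (mem_cyc X M v y).1 hy
  rw [map_sum X.B, LinearMap.sum_apply]
  refine Finset.sum_eq_zero fun i _ => ?_
  rw [map_smul X.B, LinearMap.smul_apply, ha, smul_zero]

theorem cyc_self (X : FM.{u, v} k) (hX : X.Alt) {M : ℕ} {v y : X.V} (hy : y ∈ cyc X M v) (n : ℕ) :
    X.B ((X.T ^ n) v) y = 0 := by
  rw [X.B_comm]
  rw [← hX.adjp] 
  obtain ⟨c, rfl⟩ := (mem_cyc X M v y).1 hy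
  rw [map_sum, map_sum X.B, LinearMap.sum_apply]
  refine Finset.sum_eq_zero fun i _ => ?_
  rw [map_smul, map_smul X.B, LinearMap.smul_apply, X.tp, hX.self_tp, smul_zero]

theorem perp_span (hsq : ∀ x : k, ∃ y, y * y = x) {X : FM.{u, v} k} (hX : X.Adm) {M : ℕ} {v : X.V}
    (h0 : (X.T ^ (M + 1)) v = 0) (h1 : (X.T ^ M) v ≠ 0) (hr : ∀ b, X.B ((X.T ^ M) v) b = 0)
    {y : X.V} (hy : ∀ a, (∀ n, X.B ((X.T ^ n) v) a = 0) → X.B y a = 0) : y ∈ cyc X M v := by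
  have h2 : X.B y ∈ Submodule.span k (Set.range fun i : Fin (M + 1) => X.B ((X.T ^ i.1) v)) := by
    apply mem_span_of_iInf_ker_le_ker
    intro a ha
    rw [Submodule.mem_iInf] at ha
    rw [LinearMap.mem_ker]
    apply hy
    intro n
    rcases Nat.lt_or_ge n (M + 1) with h | h
    · exact ha ⟨n, h⟩
    · rw [X.tp_zero_of_le h0 h]; simp
  obtain ⟨c, hc⟩ := (Submodule.mem_span_range_iff_exists_fun k).1 h2
  obtain ⟨s, hs⟩ := rad_unique hsq hX (a := y - ∑ i, c i • (X.T ^ i.1) v) (by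
    intro b
    rw [map_sub, map_sum X.B, ← hc, LinearMap.sub_apply, LinearMap.sum_apply, LinearMap.sum_apply,
      sub_eq_zero]
    refine Finset.sum_congr rfl fun i _ => ?_
    rw [map_smul X.B]) hr h1
  rw [sub_eq_iff_eq_add] at hs
  rw [hs]
  exact Submodule.add_mem _ (Submodule.smul_mem _ _ (tp_mem_cyc X h0 _)) ((mem_cyc _ _ _ _).2 ⟨c, rfl⟩)

theorem corr (X : FM.{u, v} k) {M μ : ℕ} {v a : X.V} (h0 : X.T ^ (M + 1) = 0)
    (h1 : (X.T ^ M) v ≠ 0) (hμ : μ ≤ M + 1) (ha : (X.T ^ μ) a ∈ cyc X M v) :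
    ∃ s ∈ cyc X M v, (X.T ^ μ) (a + s) = 0 := by
  obtain ⟨c, hc⟩ := (mem_cyc X M v _).1 ha
  have hv : (X.T ^ (M + 1)) v = 0 := by rw [h0]; rfl
  have hz := indep X (s := M + 1 - μ) hv h1 c (by
    have h2 := congrArg (X.T ^ (M + 1 - μ)) hc
    rw [X.tp, show M + 1 - μ + μ = M + 1 by omega, h0, map_sum] at h2
    rw [LinearMap.zero_apply] at h2
    rw [← h2]
    refine Finset.sum_congr rfl fun i _ => ?_
    rw [map_smul, X.tp, add_comm])
  refine ⟨-∑ i : Fin (M + 1), c i • (X.T ^ (i.1 - μ)) v, Submodule.neg_mem _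
    (Submodule.sum_mem _ fun i _ => Submodule.smul_mem _ _ (tp_mem_cyc X hv _)), ?_⟩
  rw [map_add, map_neg, ← hc, map_sum, ← sub_eq_add_neg, sub_eq_zero]
  refine Finset.sum_congr rfl fun i _ => ?_
  rw [map_smul, X.tp]
  rcases Nat.lt_or_ge i.1 μ with h | h
  · rw [hz i (by omega), zero_smul, zero_smul]
  · rw [show μ + (i.1 - μ) = i.1 by omega]

theorem isoKill (hsq : ∀ x : k, ∃ y, y * y = x) (X : FM.{u, v} k) (hX : X.Alt) {M μ : ℕ}
    {v a b : X.V} (h0 : (X.T ^ (M + 1)) v = 0) (hμ : μ ≤ M + 1)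
    (hq : ∀ n, X.Q ((X.T ^ n) v) = if n = M then 1 else 0)
    (ha : ∀ n, X.B ((X.T ^ n) v) a = 0) (hb : ∀ n, X.B ((X.T ^ n) v) b = 0)
    (hp : IsPair X μ μ a b) : ∃ a', (∀ n, X.B ((X.T ^ n) v) a' = 0) ∧ IsPair X μ μ a' b ∧
      ∀ n, X.Q ((X.T ^ n) a') = 0 := by
  obtain ⟨a', ⟨p1, p2⟩, p3⟩ := kill
    (fun a => (∀ n, X.B ((X.T ^ n) v) a = 0) ∧ IsPair X μ μ a b)
    (fun a n => X.Q ((X.T ^ n) a)) (fun n => False) μ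
    (by
      rintro a ⟨p1, p2⟩ n hn -
      obtain ⟨c, hc'⟩ := hsq (X.Q ((X.T ^ n) a))
      have key : ∀ i, X.Q ((X.T ^ i) (a + c • (X.T ^ (M - n)) v)) =
          X.Q ((X.T ^ i) a) + if i = n then c * c else 0 := by
        intro i
        rw [Q_tp_add X hX, hq, p1, mul_zero, add_zero]
        congr 1
        by_cases h' : i = n
        · rw [if_pos h', if_pos (by omega), mul_one]
        · rw [if_neg h', if_neg (by omega), mul_zero]
      refine ⟨a + c • (X.T ^ (M - n)) v, ⟨fun n => ?_, ?_, p2.tw, fun n => ?_⟩, ?_, ?_⟩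
      · rw [B_tp_add X hX, p1, hX.self_tp]; simp
      · exact tp_add_zero X _ _ p2.tv (X.tp_zero_of_le h0 (by omega))
      · rw [B_tp_add_left, p2.pr, hb, mul_zero, add_zero]
      · rw [key n, if_pos rfl, hc', CharTwo.add_self_eq_zero]
      · intro i hi
        rw [key i, if_neg (by omega), add_zero])
    a ⟨ha, hp⟩
  refine ⟨a', p1, p2, fun n => ?_⟩
  rcases Nat.lt_or_ge n μ with h2 | h2
  · exact p3 n h2 id
  · rw [X.tp_zero_of_le p2.tv h2]; simp

theorem decB_base (hsq : ∀ x : k, ∃ y, y * y = x) (X : FM.{u, v} k) (hX : X.Adm) {M : ℕ} {v : X.V}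
    (h0 : X.T ^ (M + 1) = 0) (h1 : (X.T ^ M) v ≠ 0) (hr : ∀ b, X.B ((X.T ^ M) v) b = 0)
    (hN : ∀ a, (∀ n, X.B ((X.T ^ n) v) a = 0) → a ∈ cyc X M v) : Iso X (D k M) := by
  have hv : (X.T ^ (M + 1)) v = 0 := by rw [h0]; rfl
  have hz : ∀ n b, M ≤ n → X.B ((X.T ^ n) v) b = 0 := by
    intro n b hn
    rcases Nat.eq_or_lt_of_le hn with h | h
    · rw [← h, hr]
    · rw [X.tp_zero_of_le hv h]; simp
  have hw : ∃ w, IsPair X (M + 1) M v w := by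
    rcases Nat.eq_zero_or_pos M with hM | hM
    · subst hM
      exact ⟨0, hv, by simp, fun n => by simp⟩
    · have : ∃ w0, X.B ((X.T ^ (M - 1)) v) w0 ≠ 0 := by
        by_contra hcon
        push Not at hcon
        obtain ⟨s, hs⟩ := rad_unique hsq hX hcon hr h1
        apply h1
        have := congrArg X.T hs
        rw [map_smul, X.tp_succ', X.tp_succ', hv, smul_zero] at this
        rwa [show M - 1 + 1 = M by omega] at this
      obtain ⟨w0, hw0⟩ := this
      obtain ⟨w1, -, hw1⟩ := lemP X hX.alt v ((X.B ((X.T ^ (M - 1)) v) w0)⁻¹ • w0) (M - 1)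
        (fun n hn => hz n _ (by omega)) (by rw [map_smul, smul_eq_mul, inv_mul_cancel₀ hw0])
        (fun _ => True) trivial (fun _ _ _ _ => trivial)
      rw [show M - 1 + 1 = M by omega] at hw1
      obtain ⟨c, hc⟩ := (mem_cyc X M v _).1 (hN ((X.T ^ M) w1) (by
        intro n
        rw [hX.alt.B_tp]
        exact hz _ _ (by omega)))
      have hz' := indep X (s := 1) hv h1 c (by
        have h2 := congrArg X.T hc
        rw [X.tp_succ', h0, map_sum, LinearMap.zero_apply] at h2
        rw [← h2]
        refine Finset.sum_congr rfl fun i _ => ?_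
        rw [map_smul, X.tp_succ'])
      rw [Fin.sum_univ_castSucc, Finset.sum_eq_zero, zero_add] at hc
      · refine ⟨w1 + c (Fin.last M) • (X.T ^ 0) v, hv, ?_, fun n => ?_⟩
        · rw [pow_zero, map_add, map_smul, Module.End.one_apply, ← hc]
          change _ + _ • (X.T ^ M) v = 0
          rw [Fin.val_last, ← add_smul, CharTwo.add_self_eq_zero, zero_smul]
        · rw [B_tp_add X hX.alt, hw1, hX.alt.self_tp]; simp
      · intro i _
        rw [hz' _ (by simp), zero_smul]
  obtain ⟨w, hw⟩ := hw
  have hq : X.Q ((X.T ^ M) v) ≠ 0 := fun h => h1 (hX.rad _ hr h)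
  have hle : finrank k (Blk (M + 1) M (fun n => X.Q ((X.T ^ n) v)) fun n => X.Q ((X.T ^ n) w)).V
      ≤ finrank k X.V :=
    LinearMap.finrank_le_finrank_of_injective ((pair_hom X hX.alt hw _ _ (fun n _ => rfl)
      (fun n _ => rfl)).injective (Blk_adm' M _ _ hq))
  rw [Blk_finrank] at hle
  have hge : finrank k X.V ≤ M + (M + 1) := by
    let Φ : X.V →ₗ[k] (Fin M → k) := LinearMap.pi fun i : Fin M => X.B ((X.T ^ i.1) v)
    have hker : LinearMap.ker Φ ≤ cyc X M v := by
      intro a ha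
      rw [LinearMap.mem_ker] at ha
      apply hN
      intro n
      rcases Nat.lt_or_ge n M with hn | hn
      · exact congrFun ha ⟨n, hn⟩
      · exact hz n a hn
    have h1 := LinearMap.finrank_range_add_finrank_ker Φ
    have h2 := Submodule.finrank_mono hker
    have h3 := Submodule.finrank_le (LinearMap.range Φ)
    have h4 : finrank k (Fin M → k) = M := by simp
    have h5 : finrank k (cyc X M v) ≤ M + 1 := by
      have := finrank_range_le_card (R := k) (fun i : Fin (M + 1) => (X.T ^ i.1) v)
      rw [Fintype.card_fin] at this
      exact this
    omega
  obtain ⟨v', w', h⟩ := normD hsq X hX.alt hw hq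
  exact h.iso hX.alt (by omega)

theorem decB (hsq : ∀ x : k, ∃ y, y * y = x) : ∀ (d : ℕ) (X : FM.{u, v} k), finrank k X.V = d →
    X.Adm → ∀ (M : ℕ) (v : X.V), X.T ^ (M + 1) = 0 → (X.T ^ M) v ≠ 0 →
    (∀ b, X.B ((X.T ^ M) v) b = 0) →
    ∃ νs : List ℕ, (∀ ν ∈ νs, 1 ≤ ν ∧ ν ≤ M + 1) ∧ Iso X (hs k (D k M) νs) := by
  intro d
  induction d using Nat.strong_induction_on with
  | _ d ih =>
  intro X hd hX M v0 h0 hv0 hr0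
  -- normalize
  obtain ⟨e, he⟩ := hsq (X.Q ((X.T ^ M) v0))
  have hq0 : X.Q ((X.T ^ M) v0) ≠ 0 := fun h => hv0 (hX.rad _ hr0 h)
  have he0 : e ≠ 0 := by rintro rfl; apply hq0; rw [← he]; simp
  have hz0 : ∀ (n : ℕ) (x : X.V), M < n → (X.T ^ n) x = 0 := fun n x hn =>
    X.tp_zero_of_le (by rw [h0]; rfl) hn
  obtain ⟨v, hv, hq⟩ := normV hsq X hX.alt (e⁻¹ • v0) M
    (fun n hn => by rw [hz0 n _ hn]; simp)
    (by rw [map_smul, X.Q_smul, ← he]; field_simp)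
    (fun v' => (X.T ^ M) v' = e⁻¹ • (X.T ^ M) v0) (map_smul _ _ _)
    (by
      intro a c N hN ha
      rw [map_add, map_smul, X.tp, hz0 (M + N) _ (by omega), smul_zero, add_zero, ha])
  have h1 : (X.T ^ M) v ≠ 0 := by
    rw [hv]; exact smul_ne_zero (inv_ne_zero he0) hv0
  have hr : ∀ b, X.B ((X.T ^ M) v) b = 0 := by
    intro b; rw [hv, map_smul X.B, LinearMap.smul_apply, hr0, smul_zero]
  have hvz : (X.T ^ (M + 1)) v = 0 := hz0 _ _ (by omega)
  classical
  have hex : ∃ μ, ∀ a, (∀ n, X.B ((X.T ^ n) v) a = 0) → (X.T ^ μ) a ∈ cyc X M v :=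
    ⟨M + 1, fun a _ => by rw [hz0 _ _ (by omega)]; exact Submodule.zero_mem _⟩
  have hμle : Nat.find hex ≤ M + 1 := Nat.find_min' hex
    (fun a _ => by rw [hz0 _ _ (by omega)]; exact Submodule.zero_mem _)
  have hμ := Nat.find_spec hex
  have hmin : ∀ {j}, j < Nat.find hex → _ := fun h => Nat.find_min hex h
  generalize Nat.find hex = μ at hμle hμ hmin
  rcases Nat.eq_zero_or_pos μ with h | h
  · subst h
    exact ⟨[], by simp, decB_base hsq X hX h0 h1 hr hμ⟩
  · have h2 := hmin (j := μ - 1) (by omega)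
    push Not at h2
    obtain ⟨a, ha, hac⟩ := h2
    have h3 : ∃ b, (∀ n, X.B ((X.T ^ n) v) b = 0) ∧ X.B ((X.T ^ (μ - 1)) a) b ≠ 0 := by
      by_contra hcon
      push Not at hcon
      exact hac (perp_span hsq hX hvz h1 hr hcon)
    obtain ⟨b0, hb0, hab0⟩ := h3
    set b := (X.B ((X.T ^ (μ - 1)) a) b0)⁻¹ • b0 with hb_def
    have hb : ∀ n, X.B ((X.T ^ n) v) b = 0 := by
      intro n; rw [hb_def, map_smul, hb0, smul_zero]
    have hab : X.B ((X.T ^ (μ - 1)) a) b = 1 := by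
      rw [hb_def, map_smul, smul_eq_mul, inv_mul_cancel₀ hab0]
    obtain ⟨s, hs, has⟩ := corr X h0 h1 hμle (hμ a ha)
    obtain ⟨t, ht, hbt⟩ := corr X h0 h1 hμle (hμ b hb)
    have hN : ∀ {a s : X.V}, (∀ n, X.B ((X.T ^ n) v) a = 0) → s ∈ cyc X M v →
        ∀ n, X.B ((X.T ^ n) v) (a + s) = 0 := by
      intro a s ha hs n
      rw [map_add, ha, cyc_self X hX.alt hs, add_zero]
    have hB1 : X.B ((X.T ^ (μ - 1)) (a + s)) (b + t) = 1 := by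
      rw [map_add (X.T ^ (μ - 1)), map_add X.B, LinearMap.add_apply,
        cyc_orth X (cyc_tp X hvz _ hs) (hN hb ht), add_zero, map_add, hab,
        hX.alt.adjp, X.B_comm, cyc_orth X (cyc_tp X hvz _ ht) ha, add_zero]
    obtain ⟨b', ⟨p1, p2⟩, p3⟩ := lemP X hX.alt (a + s) (b + t) (μ - 1)
      (fun n hn => by rw [X.tp_zero_of_le has (by omega)]; simp) hB1
      (fun x => (∀ n, X.B ((X.T ^ n) v) x = 0) ∧ (X.T ^ μ) x = 0) ⟨hN hb ht, hbt⟩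
      (by
        rintro x c N ⟨q1, q2⟩
        refine ⟨fun n => ?_, tp_add_zero X c N q2 (X.tp_zero_of_le q2 (by omega))⟩
        rw [B_tp_add X hX.alt, q1, q1]; simp)
    rw [show μ - 1 + 1 = μ by omega] at p3
    have hp : IsPair X μ μ (a + s) b' := ⟨has, p2, p3⟩
    obtain ⟨a1, r1, r2, r3⟩ := isoKill hsq X hX.alt hvz hμle hq (hN ha hs) p1 hp
    obtain ⟨b1, s1, s2, s3⟩ := isoKill hsq X hX.alt hvz hμle hq p1 r1 (r2.swap hX.alt)
    obtain ⟨Y, hY, hi⟩ := split X hX s2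
    rw [show (fun n => X.Q ((X.T ^ n) b1)) = fun _ => 0 from funext s3,
      show (fun n => X.Q ((X.T ^ n) a1)) = fun _ => 0 from funext r3] at hi
    have hYT : Y.T ^ (M + 1) = 0 := FM.tpow_of_prod (hi.tpow h0)
    have hYd : finrank k X.V = μ + μ + finrank k Y.V := by
      rw [hi.finrank, FM.prod_finrank, Blk_finrank]
    obtain ⟨g, hg⟩ := hi.hom
    obtain ⟨⟨p, y⟩, hgv⟩ : ∃ r : (H k μ).V × Y.V, r = g v := ⟨_, rfl⟩
    have e1 : g ((X.T ^ M) v) = (((H k μ).T ^ M) p, (Y.T ^ M) y) := by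
      have := hg.tp M v
      rw [← FM.prod_tp, hgv]
      exact this
    have e2 : ∀ c d, (H k μ).B (((H k μ).T ^ M) p) c + Y.B ((Y.T ^ M) y) d = 0 := by
      intro c d
      obtain ⟨x, hx⟩ := g.surjective (c, d)
      rw [← FM.prod_B, ← e1, ← hx]
      exact (hg.B _ _).trans (hr x)
    have e3 : ((H k μ).T ^ M) p = 0 := by
      apply Blk_nondef μ (fun _ => 0) (fun _ => 0)
      intro c
      have := e2 c 0
      rwa [map_zero, add_zero] at this
    have e4 : (Y.T ^ M) y ≠ 0 := by
      intro h
      apply h1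
      apply g.injective
      rw [e1, e3, h, map_zero]; rfl
    obtain ⟨νs, t1, t2⟩ := ih (finrank k Y.V) (by omega) Y rfl hY M y hYT e4 (by
      intro d
      have := e2 0 d
      rwa [map_zero, zero_add] at this)
    refine ⟨μ :: νs, ?_, hi.trans ((Iso.refl _).prod t2)⟩
    intro ν hν
    rcases List.mem_cons.1 hν with rfl | hν
    · exact ⟨h, hμle⟩
    · exact t1 ν hν

end decomposition

end FormMod

namespace FormMod

universe u v w z t

section lists
variable {k : Type u} [Field k]

/-- zero form module -/
@[reducible] noncomputable def Zr (k : Type u) [Field k] : FM.{u, u} k :=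
  Blk 0 0 (fun _ => 0) (fun _ => 0)

/-- tail of a normal form -/
noncomputable def Tl (k : Type u) [Field k] : Option (ℕ × List ℕ) → FM.{u, u} k
  | none => Zr k
  | some p => hs k (D k p.1) p.2

/-- sum of blocks -/
noncomputable def NF (R : FM.{u, u} k) : List (ℕ × ℕ × k) → FM.{u, u} k
  | [] => R
  | t :: L => (W t.1 t.2.1 t.2.2).prod (NF R L)

theorem Iso.left_comm (X : FM.{u, v} k) (Y : FM.{u, w} k) (Z : FM.{u, z} k) :
    Iso (X.prod (Y.prod Z)) (Y.prod (X.prod Z)) :=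
  ((Iso.assoc X Y Z).symm.trans ((Iso.comm X Y).prod (Iso.refl Z))).trans (Iso.assoc Y X Z)

theorem NF_perm (R : FM.{u, u} k) {L L' : List (ℕ × ℕ × k)} (h : L.Perm L') :
    Iso (NF R L) (NF R L') := by
  induction h with
  | nil => exact Iso.refl _
  | cons t _ ih => exact (Iso.refl _).prod ih
  | swap s t L => exact Iso.left_comm _ _ _
  | trans _ _ h1 h2 => exact h1.trans h2

theorem NF_congr {R R' : FM.{u, u} k} (h : Iso R R') (L : List (ℕ × ℕ × k)) :
    Iso (NF R L) (NF R' L) := by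
  induction L with
  | nil => exact h
  | cons t L ih => exact (Iso.refl _).prod ih

theorem hs_congr {R R' : FM.{u, u} k} (h : Iso R R') (L : List ℕ) :
    Iso (hs k R L) (hs k R' L) := by
  induction L with
  | nil => exact h
  | cons t L ih => exact (Iso.refl _).prod ih

theorem NF_move (P R : FM.{u, u} k) (L : List (ℕ × ℕ × k)) :
    Iso (P.prod (NF R L)) (NF (P.prod R) L) := by
  induction L with
  | nil => exact Iso.refl _
  | cons t L ih => exact (Iso.left_comm _ _ _).trans ((Iso.refl _).prod ih)

theorem hs_move (P R : FM.{u, u} k) (L : List ℕ) :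
    Iso (P.prod (hs k R L)) (hs k (P.prod R) L) := by
  induction L with
  | nil => exact Iso.refl _
  | cons t L ih => exact (Iso.left_comm _ _ _).trans ((Iso.refl _).prod ih)

theorem NF_tail_change {P P' R R' : FM.{u, u} k} (h : Iso (P.prod R) (P'.prod R'))
    (νs : List ℕ) (L : List (ℕ × ℕ × k)) :
    Iso (P.prod (NF (hs k R νs) L)) (P'.prod (NF (hs k R' νs) L)) :=
  ((NF_move _ _ _).trans (NF_congr ((hs_move _ _ _).trans
    ((hs_congr h νs).trans (hs_move _ _ _).symm)) L)).trans (NF_move _ _ _).symm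

theorem NF_head2 {s t s' t' : ℕ × ℕ × k}
    (h : Iso ((W s.1 s.2.1 s.2.2).prod (W t.1 t.2.1 t.2.2))
      ((W s'.1 s'.2.1 s'.2.2).prod (W t'.1 t'.2.1 t'.2.2))) (R : FM.{u, u} k)
    (L : List (ℕ × ℕ × k)) : Iso (NF R (s :: t :: L)) (NF R (s' :: t' :: L)) :=
  ((Iso.assoc _ _ _).symm.trans (h.prod (Iso.refl _))).trans (Iso.assoc _ _ _)

/-- radical vector of depth `M` -/
def RadAt (X : FM.{u, v} k) (M : ℕ) : Prop :=
  ∃ a, (X.T ^ M) a ≠ 0 ∧ ∀ b, X.B ((X.T ^ M) a) b = 0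

theorem RadAt.iso {X : FM.{u, v} k} {Y : FM.{u, w} k} {M : ℕ} (h : RadAt X M) (hi : Iso X Y) :
    RadAt Y M := by
  obtain ⟨g, hg⟩ := hi.hom
  obtain ⟨a, h1, h2⟩ := h
  refine ⟨g a, ?_, ?_⟩
  · intro h
    apply h1
    apply g.injective
    rw [map_zero, ← h]
    exact hg.tp M a
  · intro b
    obtain ⟨c, rfl⟩ := g.surjective b
    have := hg.B ((X.T ^ M) a) c
    rw [h2, hg.tp] at this
    exact this

theorem RadAt.prod {Y : FM.{u, w} k} {M : ℕ} (h : RadAt Y M) (X : FM.{u, v} k) :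
    RadAt (X.prod Y) M := by
  obtain ⟨a, h1, h2⟩ := h
  refine ⟨(0, a), ?_, ?_⟩
  · intro h
    apply h1
    rw [FM.prod_tp] at h
    exact congrArg Prod.snd h
  · rintro ⟨b, c⟩
    rw [FM.prod_tp, FM.prod_B, h2]; simp

theorem RadAt.not_nondef {X : FM.{u, w} k} {M : ℕ} (h : RadAt X M) : ¬ X.Nondef := by
  obtain ⟨a, h1, h2⟩ := h
  exact fun h => h1 (h _ h2)

variable [CharP k 2]

theorem D_radAt (M : ℕ) : RadAt (D k M) M := by
  refine ⟨gv _ _ _ _, ?_, ?_⟩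
  · rw [gv_tp]
    intro h
    have h1 := congrFun (congrArg Prod.fst h) ⟨M, by omega⟩
    simp [ind] at h1
  · rintro ⟨f, g⟩
    rw [gv_tp, Blk_B, pairing_zero_right, add_zero]
    unfold pairing
    refine Finset.sum_eq_zero fun i _ => Finset.sum_eq_zero fun j _ => ?_
    split_ifs with h
    · unfold ind
      rw [if_neg (by omega), zero_mul]
    · rfl

theorem hs_radAt {R : FM.{u, u} k} {M : ℕ} (h : RadAt R M) (L : List ℕ) : RadAt (hs k R L) M := by
  induction L with
  | nil => exact h
  | cons t L ih => exact ih.prod _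

theorem NF_radAt {R : FM.{u, u} k} {M : ℕ} (h : RadAt R M) (L : List (ℕ × ℕ × k)) :
    RadAt (NF R L) M := by
  induction L with
  | nil => exact h
  | cons t L ih => exact ih.prod _

theorem NF_none_nondef (L : List (ℕ × ℕ × k)) : (NF (Tl k none) L).Nondef := by
  induction L with
  | nil => exact Blk_nondef _ _ _
  | cons t L ih => exact FM.prod_nondef (Blk_nondef _ _ _) ih

theorem hs_adm {R : FM.{u, u} k} (h : R.Adm) (L : List ℕ) : (hs k R L).Adm := by
  induction L with
  | nil => exact h
  | cons t L ih => exact FM.prod_adm (Blk_adm _ _ _) (Blk_nondef _ _ _) ih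

theorem Tl_adm (o : Option (ℕ × List ℕ)) : (Tl k o).Adm := by
  cases o with
  | none => exact Blk_adm _ _ _
  | some p => exact hs_adm (D_adm _) _

theorem NF_adm {R : FM.{u, u} k} (h : R.Adm) (L : List (ℕ × ℕ × k)) : (NF R L).Adm := by
  induction L with
  | nil => exact h
  | cons t L ih => exact FM.prod_adm (Blk_adm _ _ _) (Blk_nondef _ _ _) ih

/-- conditions on the blocks of a decomposition -/
structure OK (L : List (ℕ × ℕ × k)) (o : Option (ℕ × List ℕ)) : Prop where
  blk : ∀ t ∈ L, 1 ≤ t.1 ∧ t.1 ≤ 2 * t.2.1 ∧ t.2.1 ≤ t.1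
  tl : ∀ p ∈ o, ∀ t ∈ L, p.1 + 1 < t.1
  nu : ∀ p ∈ o, ∀ ν ∈ p.2, 1 ≤ ν ∧ ν ≤ p.1 + 1

theorem zero_iso (X : FM.{u, v} k) (h : finrank k X.V = 0) : Iso X (Zr k) := by
  have : IsHom (Zr k) X 0 := by
    constructor
    · intro a
      have : a = 0 := Subsingleton.elim _ _
      subst this; simp
    · intro a; simp
  exact (this.iso (Blk_adm _ _ _) (by rw [Blk_finrank, h])).symm

theorem dec (hsq : ∀ x : k, ∃ y, y * y = x) : ∀ (d : ℕ) (X : FM.{u, v} k), finrank k X.V = d →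
    X.Adm → ∃ L o, OK (k := k) L o ∧ Iso X (NF (Tl k o) L) := by
  intro d
  induction d using Nat.strong_induction_on with
  | _ d ih =>
  intro X hd hX
  classical
  have hex := hX.nil
  have hN : X.T ^ (Nat.find hex) = 0 := Nat.find_spec hex
  have hmin : ∀ {j}, j < Nat.find hex → X.T ^ j ≠ 0 := fun h => Nat.find_min hex h
  generalize Nat.find hex = N at hN hmin
  rcases Nat.eq_zero_or_pos N with h | h
  · subst h
    refine ⟨[], none, ⟨by simp, by simp, by simp⟩, zero_iso X ?_⟩
    rw [finrank_zero_iff_forall_zero]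
    intro x
    have : (X.T ^ 0) x = 0 := by rw [hN]; rfl
    simpa using this
  · by_cases hB : RadAt X (N - 1)
    · obtain ⟨v, h1, h2⟩ := hB
      obtain ⟨νs, h3, h4⟩ := decB hsq _ X rfl hX (N - 1) v
        (by rw [show N - 1 + 1 = N by omega]; exact hN) h1 h2
      exact ⟨[], some (N - 1, νs), ⟨by simp, by simp, by simpa using h3⟩, h4⟩
    · obtain ⟨v, hv⟩ : ∃ v, (X.T ^ (N - 1)) v ≠ 0 := by
        by_contra hcon
        push Not at hcon
        exact hmin (j := N - 1) (by omega) (LinearMap.ext hcon)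
      obtain ⟨w0, hw0⟩ : ∃ w0, X.B ((X.T ^ (N - 1)) v) w0 ≠ 0 := by
        by_contra hcon
        push Not at hcon
        exact hB ⟨v, hv, hcon⟩
      have hz : ∀ x : X.V, (X.T ^ N) x = 0 := fun x => by rw [hN]; rfl
      obtain ⟨w, -, hw⟩ := lemP X hX.alt v ((X.B ((X.T ^ (N - 1)) v) w0)⁻¹ • w0) (N - 1)
        (fun n hn => by rw [X.tp_zero_of_le (hz v) (by omega)]; simp)
        (by rw [map_smul, smul_eq_mul, inv_mul_cancel₀ hw0])
        (fun _ => True) trivial (fun _ _ _ _ => trivial)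
      rw [show N - 1 + 1 = N by omega] at hw
      obtain ⟨Y, hY, hi⟩ := split X hX (μ := N) ⟨hz v, hz w, hw⟩
      obtain ⟨l, δ, hl1, hl2, hW⟩ := Blk_iso_W hsq N (fun n => X.Q ((X.T ^ n) v))
        (fun n => X.Q ((X.T ^ n) w))
      have hi' := hi.trans (hW.prod (Iso.refl Y))
      have hYd : finrank k X.V = N + N + finrank k Y.V := by
        rw [hi.finrank, FM.prod_finrank, Blk_finrank]
      have hYT : Y.T ^ N = 0 := FM.tpow_of_prod (hi.tpow hN)
      obtain ⟨L, o, hok, hL⟩ := ih (finrank k Y.V) (by omega) Y rfl hY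
      refine ⟨(N, l, δ) :: L, o, ⟨?_, ?_, hok.nu⟩, hi'.trans ((Iso.refl _).prod hL)⟩
      · intro t ht
        rcases List.mem_cons.1 ht with rfl | ht
        · exact ⟨h, hl1, hl2⟩
        · exact hok.blk t ht
      · intro p hp t ht
        rcases List.mem_cons.1 ht with rfl | ht
        · have hr : RadAt Y p.1 := by
            have : o = some p := hp
            subst this
            exact (NF_radAt (hs_radAt (D_radAt p.1) p.2) L).iso hL.symm
          have hr' : RadAt X p.1 := (hr.prod _).iso hi.symm
          by_contra hcon
          change ¬ (p.1 + 1 < N) at hcon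
          rcases Nat.lt_or_ge p.1 N with h' | h'
          · apply hB
            rwa [show N - 1 = p.1 by omega]
          · obtain ⟨a, ha, -⟩ := hr'
            exact ha (X.tp_zero_of_le (hz a) h')
        · exact hok.tl p hp t ht

theorem NF_finrank_le (R : FM.{u, u} k) (o : Option (ℕ × List ℕ)) (L : List (ℕ × ℕ × k))
    (h : OK L o) : (L.map fun t => t.2.1).sum ≤ finrank k (NF R L).V := by
  replace h := h.blk
  induction L with
  | nil => simp
  | cons t L ih =>
    have h1 := ih (fun t ht => h t (List.mem_cons_of_mem _ ht))
    have h2 := h t List.mem_cons_self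
    change _ ≤ finrank k ((W t.1 t.2.1 t.2.2).prod (NF R L)).V
    rw [FM.prod_finrank, Blk_finrank, List.map_cons, List.sum_cons]
    omega

/-- closed decompositions -/
structure Closed (L : List (ℕ × ℕ × k)) (o : Option (ℕ × List ℕ)) : Prop where
  cl : ∀ s ∈ L, ∀ t ∈ L, s.2.1 ≤ t.2.1 + (s.1 - t.1)
  ct : ∀ p ∈ o, ∀ t ∈ L, p.1 + 1 ≤ t.2.1

theorem OK.perm {L L' : List (ℕ × ℕ × k)} {o : Option (ℕ × List ℕ)} (h : OK L o)
    (hp : L.Perm L') : OK L' o :=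
  ⟨fun t ht => h.blk t (hp.mem_iff.2 ht), fun p hpo t ht => h.tl p hpo t (hp.mem_iff.2 ht), h.nu⟩

theorem dec_closed (hsq : ∀ x : k, ∃ y, y * y = x) (X : FM.{u, v} k) (hX : X.Adm) :
    ∃ L o, OK (k := k) L o ∧ Closed L o ∧ Iso X (NF (Tl k o) L) := by
  classical
  obtain ⟨L0, o0, h0, h0'⟩ := dec hsq _ X rfl hX
  let P : ℕ → Prop := fun s => ∃ L o, OK (k := k) L o ∧ Iso X (NF (Tl k o) L) ∧
    (L.map fun t => t.2.1).sum = s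
  have hb : ∀ s, P s → s ≤ finrank k X.V := by
    rintro s ⟨L, o, h1, h2, rfl⟩
    rw [h2.finrank]
    exact NF_finrank_le _ _ _ h1
  have hP0 : P (L0.map fun t => t.2.1).sum := ⟨L0, o0, h0, h0', rfl⟩
  have hg := Nat.findGreatest_spec (hb _ hP0) hP0
  have hmax : ∀ s, P s → s ≤ Nat.findGreatest P (finrank k X.V) :=
    fun s hs => Nat.le_findGreatest (hb s hs) hs
  generalize Nat.findGreatest P (finrank k X.V) = S at hg hmax
  obtain ⟨L, o, h1, h2, h3⟩ := hg
  refine ⟨L, o, h1, ⟨?_, ?_⟩, h2⟩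
  · intro s hs t ht
    by_contra hcon
    have hne : t ≠ s := by rintro rfl; omega
    have hp1 := List.perm_cons_erase hs
    have hp2 := List.perm_cons_erase ((List.mem_erase_of_ne hne).2 ht)
    have hp : L.Perm (s :: t :: (L.erase s).erase t) := hp1.trans (hp2.cons s)
    generalize (L.erase s).erase t = L' at hp
    have b1 := h1.blk s hs
    have b2 := h1.blk t ht
    obtain ⟨d1, d2, hi⟩ := raise hsq s.2.2 t.2.2 b1.2.1 b1.2.2 b2.2.1 b2.2.2
      (show t.2.1 + (s.1 - t.1) < s.2.1 by omega)
    have hok := h1.perm hp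
    have : P (((s.1, s.2.1, d1) :: (t.1, s.2.1 - (s.1 - t.1), d2) :: L').map fun t => t.2.1).sum := by
      refine ⟨_, o, ⟨?_, ?_, h1.nu⟩, h2.trans ((NF_perm _ hp).trans (NF_head2 hi _ _)), rfl⟩
      · intro r hr
        rcases List.mem_cons.1 hr with rfl | hr
        · exact b1
        · rcases List.mem_cons.1 hr with rfl | hr
          · refine ⟨b2.1, ?_, ?_⟩ <;> dsimp only <;> omega
          · exact hok.blk r (List.mem_cons_of_mem _ (List.mem_cons_of_mem _ hr))
      · intro p hp r hr
        rcases List.mem_cons.1 hr with rfl | hr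
        · exact h1.tl p hp s hs
        · rcases List.mem_cons.1 hr with rfl | hr
          · exact h1.tl p hp t ht
          · exact hok.tl p hp r (List.mem_cons_of_mem _ (List.mem_cons_of_mem _ hr))
    have h4 := hmax _ this
    have h5 := (hp.map fun t => t.2.1).sum_eq
    simp only [List.map_cons, List.sum_cons] at h4 h5
    omega
  · intro p hp t ht
    by_contra hcon
    have hpm := List.perm_cons_erase ht
    generalize L.erase t = L' at hpm
    have b1 := h1.blk t ht
    have b2 := h1.tl p hp t ht
    have ho : o = some p := hp
    obtain ⟨d, hi⟩ := raiseD hsq t.2.2 b1.2.1 b1.2.2 b2 (show t.2.1 ≤ p.1 by omega)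
    have hok := h1.perm hpm
    have : P (((t.1, p.1 + 1, d) :: L').map fun t => t.2.1).sum := by
      refine ⟨_, o, ⟨?_, ?_, h1.nu⟩, ?_, rfl⟩
      · intro r hr
        rcases List.mem_cons.1 hr with rfl | hr
        · refine ⟨b1.1, ?_, ?_⟩ <;> dsimp only <;> omega
        · exact hok.blk r (List.mem_cons_of_mem _ hr)
      · intro p hp r hr
        rcases List.mem_cons.1 hr with rfl | hr
        · exact h1.tl p hp t ht
        · exact hok.tl p hp r (List.mem_cons_of_mem _ hr)
      · subst ho
        exact h2.trans ((NF_perm _ hpm).trans (NF_tail_change hi p.2 L'))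
    have h4 := hmax _ this
    have h5 := (hpm.map fun t => t.2.1).sum_eq
    simp only [List.map_cons, List.sum_cons] at h4 h5
    omega

end lists

end FormMod

namespace FormMod

universe u v w z t

section normalform
variable {k : Type u} [Field k]

/-- the list of blocks of a normal form -/
noncomputable def nf (χ : ℕ → ℕ) (ε : ℕ → k) : List ℕ → List (ℕ × ℕ × k)
  | [] => []
  | μ :: M => (μ, χ μ, if μ ∈ M then 0 else ε μ) :: nf χ ε M

/-- break positions -/
structure IsBrk (M : List ℕ) (χ : ℕ → ℕ) (o : Option (ℕ × List ℕ)) (μ : ℕ) : Prop where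
  mem : μ ∈ M
  lt : μ < 2 * χ μ
  sm : ∀ ν ∈ M, ν < μ → χ μ + χ ν ≤ μ
  tl : ∀ p ∈ o, χ μ + (p.1 + 1) ≤ μ

/-- valid skeletons -/
structure Valid (M : List ℕ) (χ : ℕ → ℕ) (o : Option (ℕ × List ℕ)) : Prop where
  sorted : M.Pairwise (fun a b => b ≤ a)
  blk : ∀ μ ∈ M, 1 ≤ μ ∧ μ ≤ 2 * χ μ ∧ χ μ ≤ μ
  cl : ∀ μ ∈ M, ∀ ν ∈ M, χ μ ≤ χ ν + (μ - ν)
  tl : ∀ p ∈ o, ∀ μ ∈ M, p.1 + 1 < μ ∧ p.1 + 1 ≤ χ μ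
  nu : ∀ p ∈ o, ∀ ν ∈ p.2, 1 ≤ ν ∧ ν ≤ p.1 + 1

theorem nf_congr (χ : ℕ → ℕ) {ε ε' : ℕ → k} (M : List ℕ) (h : ∀ μ ∈ M, ε μ = ε' μ) :
    nf χ ε M = nf χ ε' M := by
  induction M with
  | nil => rfl
  | cons μ M ih =>
    unfold nf
    rw [ih (fun ν hν => h ν (List.mem_cons_of_mem _ hν)), h μ List.mem_cons_self]

theorem W_half (μ l : ℕ) (δ δ' : k) (h : μ = 2 * l) : W μ l δ = W μ l δ' := by
  have : wy μ l δ = wy μ l δ' := by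
    funext n
    unfold wy
    rw [if_neg (by omega), if_neg (by omega)]
  unfold W
  rw [this]

variable [CharP k 2]

theorem collapse_shift (hsq : ∀ x : k, ∃ y, y * y = x) (R : FM.{u, u} k) {m1 l1 m2 l2 : ℕ}
    (δ δ2 : k) (h1 : m1 < 2 * l1) (h2 : l1 ≤ m1) (h3 : m2 < 2 * l2) (h4 : l2 ≤ m2) (h5 : m2 ≤ m1)
    (h6 : m1 < l1 + l2) (A C : List (ℕ × ℕ × k)) :
    Iso (NF R ((m1, l1, δ) :: (A ++ (m2, l2, δ2) :: C)))
      (NF R ((m1, l1, 0) :: (A ++ (m2, l2, δ2 + δ) :: C))) := by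
  have hsh : Iso ((W m1 l1 δ).prod (W m2 l2 δ2)) ((W m1 l1 0).prod (W m2 l2 (δ2 + δ))) :=
    shift hsq δ δ2 h1 h2 h3 h4 h5 h6
  have a1 := NF_perm R (show List.Perm ((m1, l1, δ) :: (A ++ (m2, l2, δ2) :: C))
    ((m1, l1, δ) :: (m2, l2, δ2) :: (A ++ C)) from List.perm_middle.cons _)
  have a3 := NF_perm R (show List.Perm ((m1, l1, 0) :: (A ++ (m2, l2, δ2 + δ) :: C))
    ((m1, l1, 0) :: (m2, l2, δ2 + δ) :: (A ++ C)) from List.perm_middle.cons _)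
  have a2 := NF_head2 (s := (m1, l1, δ)) (t := (m2, l2, δ2)) (s' := (m1, l1, 0))
    (t' := (m2, l2, δ2 + δ)) hsh R (A ++ C)
  exact a1.trans (a2.trans a3.symm)

theorem collapse_shiftD (hsq : ∀ x : k, ∃ y, y * y = x) {μ l m : ℕ} (δ : k)
    (h1 : μ < 2 * l) (h2 : l ≤ μ) (h3 : μ < l + (m + 1)) (νs : List ℕ) (L : List (ℕ × ℕ × k)) :
    Iso (NF (Tl k (some (m, νs))) ((μ, l, δ) :: L))
      (NF (Tl k (some (m, νs))) ((μ, l, 0) :: L)) := by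
  have hsh : Iso ((W μ l δ).prod (D k m)) ((W μ l 0).prod (D k m)) :=
    shiftD hsq δ h1 h2 (by omega)
  exact NF_tail_change hsh νs L

theorem collapse (hsq : ∀ x : k, ∃ y, y * y = x) (o : Option (ℕ × List ℕ)) (χ : ℕ → ℕ) :
    ∀ (n : ℕ) (L : List (ℕ × ℕ × k)), L.length = n → (∀ t ∈ L, t.2.1 = χ t.1) →
      Valid (L.map fun t => t.1) χ o →
      ∃ ε : ℕ → k, (∀ μ, ε μ ≠ 0 → IsBrk (L.map fun t => t.1) χ o μ) ∧
        Iso (NF (Tl k o) L) (NF (Tl k o) (nf χ ε (L.map fun t => t.1))) := by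
  classical
  intro n
  induction n with
  | zero =>
    intro L hL hχ hv
    have : L = [] := List.length_eq_zero_iff.1 hL
    subst this
    exact ⟨fun _ => 0, fun μ h => absurd rfl h, Iso.refl _⟩
  | succ n ih =>
    intro L hL hχ hv
    obtain ⟨⟨μ, l, δ⟩, L', rfl⟩ : ∃ t L', L = t :: L' := by
      cases L with
      | nil => simp at hL
      | cons t L' => exact ⟨t, L', rfl⟩
    have hl : l = χ μ := hχ _ List.mem_cons_self
    subst hl
    set M' := L'.map fun t => t.1 with hM'
    have hMM : (((μ, χ μ, δ) :: L').map fun t => t.1) = μ :: M' := rfl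
    rw [hMM] at hv ⊢
    have hbμ := hv.blk μ List.mem_cons_self
    have hv' : Valid M' χ o :=
      ⟨(List.pairwise_cons.1 hv.sorted).2, fun ν hν => hv.blk ν (List.mem_cons_of_mem _ hν),
        fun ν hν ρ hρ => hv.cl ν (List.mem_cons_of_mem _ hν) ρ (List.mem_cons_of_mem _ hρ),
        fun p hp ν hν => hv.tl p hp ν (List.mem_cons_of_mem _ hν), hv.nu⟩
    have hle : ∀ ν ∈ M', ν ≤ μ := (List.pairwise_cons.1 hv.sorted).1
    -- reduce the head
    have head : ∃ (δ' : k) (L'' : List (ℕ × ℕ × k)), L''.map (fun t => t.1) = M' ∧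
        (∀ t ∈ L'', t.2.1 = χ t.1) ∧
        (δ' ≠ 0 → μ ∉ M' ∧ IsBrk (μ :: M') χ o μ) ∧
        Iso (NF (Tl k o) ((μ, χ μ, δ) :: L')) (NF (Tl k o) ((μ, χ μ, δ') :: L'')) := by
      have hχ' : ∀ t ∈ L', t.2.1 = χ t.1 := fun t ht => hχ t (List.mem_cons_of_mem _ ht)
      by_cases h1 : μ = 2 * χ μ
      · refine ⟨0, L', rfl, hχ', fun h => absurd rfl h, ?_⟩
        change Iso ((W μ (χ μ) δ).prod _) ((W μ (χ μ) 0).prod _)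
        rw [W_half μ (χ μ) δ 0 h1]
        exact Iso.refl _
      by_cases h2 : ∃ t ∈ L', μ < χ μ + t.2.1
      · obtain ⟨⟨ν, l, δ2⟩, ht, hlt⟩ := h2
        have hl : l = χ ν := hχ' _ ht
        subst hl
        change μ < χ μ + χ ν at hlt
        have hνM : ν ∈ M' := List.mem_map.2 ⟨_, ht, rfl⟩
        have hbν := hv'.blk ν hνM
        have hνμ := hle ν hνM
        have hcl := hv.cl μ List.mem_cons_self ν (List.mem_cons_of_mem _ hνM)
        obtain ⟨A, C, rfl⟩ := List.append_of_mem ht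
        refine ⟨0, A ++ (ν, χ ν, δ2 + δ) :: C, ?_, ?_, fun h => absurd rfl h, ?_⟩
        · rw [hM']; simp
        · intro t ht'
          rw [List.mem_append, List.mem_cons] at ht'
          rcases ht' with h | rfl | h
          · exact hχ' t (by simp [h])
          · rfl
          · exact hχ' t (by simp [h])
        · exact collapse_shift hsq (Tl k o) δ δ2 (by omega) hbμ.2.2 (by omega) hbν.2.2 hνμ hlt A C
      push Not at h2
      by_cases h3 : ∃ p ∈ o, μ < χ μ + (p.1 + 1)
      · obtain ⟨p, hp, hlt⟩ := h3
        have ho : o = some p := hp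
        subst ho
        exact ⟨0, L', rfl, hχ', fun h => absurd rfl h,
          collapse_shiftD hsq δ (by omega) hbμ.2.2 hlt p.2 L'⟩
      push Not at h3
      refine ⟨δ, L', rfl, hχ', fun _ => ?_, Iso.refl _⟩
      have h4 : ∀ ν ∈ M', χ μ + χ ν ≤ μ := by
        intro ν hν
        obtain ⟨t, ht, rfl⟩ := List.mem_map.1 hν
        rw [← hχ' t ht]
        exact h2 t ht
      refine ⟨fun hμ => ?_, List.mem_cons_self, by omega, ?_, h3⟩
      · have := h4 μ hμ
        omega
      · intro ν hν hlt
        rcases List.mem_cons.1 hν with rfl | hν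
        · omega
        · exact h4 ν hν
    obtain ⟨δ', L'', e1, e2, e3, e4⟩ := head
    obtain ⟨ε', f1, f2⟩ := ih L'' (by
      have := congrArg List.length e1
      rw [hM'] at this
      simp at this hL
      omega) e2 (by rw [e1]; exact hv')
    rw [e1] at f1 f2
    have f1' : ∀ ν, ε' ν ≠ 0 → IsBrk (μ :: M') χ o ν := by
      intro ν hν
      have h := f1 ν hν
      refine ⟨List.mem_cons_of_mem _ h.mem, h.lt, ?_, h.tl⟩
      intro ρ hρ hlt
      rcases List.mem_cons.1 hρ with rfl | hρ
      · have := hle ν h.mem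
        omega
      · exact h.sm ρ hρ hlt
    by_cases hμ : μ ∈ M'
    · refine ⟨ε', f1', e4.trans ?_⟩
      have h0 : δ' = 0 := by
        by_contra h
        exact (e3 h).1 hμ
      subst h0
      unfold nf
      rw [if_pos hμ]
      exact (Iso.refl _).prod f2
    · refine ⟨Function.update ε' μ δ', ?_, e4.trans ?_⟩
      · intro ν hν
        by_cases h : ν = μ
        · subst h
          rw [Function.update_self] at hν
          exact (e3 hν).2
        · rw [Function.update_of_ne h] at hν
          exact f1' ν hν
      · unfold nf
        rw [if_neg hμ, Function.update_self, nf_congr χ (ε' := ε') M' (by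
          intro ν hν
          rw [Function.update_of_ne]
          rintro rfl
          exact hμ hν)]
        exact (Iso.refl _).prod f2

theorem normal_form (hsq : ∀ x : k, ∃ y, y * y = x) (X : FM.{u, v} k) (hX : X.Adm) :
    ∃ M χ o, ∃ ε : ℕ → k, Valid M χ o ∧ (∀ μ, ε μ ≠ 0 → IsBrk M χ o μ) ∧
      Iso X (NF (Tl k o) (nf χ ε M)) := by
  classical
  obtain ⟨L0, o, h1, h2, h3⟩ := dec_closed hsq X hX
  let r : (ℕ × ℕ × k) → (ℕ × ℕ × k) → Prop := fun s t => t.1 ≤ s.1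
  haveI : Std.Total r := ⟨fun s t => le_total t.1 s.1⟩
  haveI : IsTrans _ r := ⟨fun a b c h h' => le_trans h' h⟩
  have hp := List.perm_insertionSort r L0
  have hs := List.pairwise_insertionSort r L0
  generalize List.insertionSort r L0 = L at hp hs
  have hχ : ∃ χ : ℕ → ℕ, ∀ t ∈ L, t.2.1 = χ t.1 := by
    have : ∀ μ, ∃ l, ∀ t ∈ L, t.1 = μ → t.2.1 = l := by
      intro μ
      by_cases h : ∃ t ∈ L, t.1 = μ
      · obtain ⟨t, ht, rfl⟩ := h
        refine ⟨t.2.1, fun s hs hst => ?_⟩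
        have c1 := h2.cl s (hp.mem_iff.1 hs) t (hp.mem_iff.1 ht)
        have c2 := h2.cl t (hp.mem_iff.1 ht) s (hp.mem_iff.1 hs)
        omega
      · exact ⟨0, fun t ht hh => absurd ⟨t, ht, hh⟩ h⟩
    choose χ hχ using this
    exact ⟨χ, fun t ht => hχ t.1 t ht rfl⟩
  obtain ⟨χ, hχ⟩ := hχ
  have hv : Valid (L.map fun t => t.1) χ o := by
    refine ⟨?_, ?_, ?_, ?_, h1.nu⟩
    · rw [List.pairwise_map]
      exact hs
    · intro μ hμ
      obtain ⟨t, ht, rfl⟩ := List.mem_map.1 hμ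
      rw [← hχ t ht]
      exact h1.blk t (hp.mem_iff.1 ht)
    · intro μ hμ ν hν
      obtain ⟨t, ht, rfl⟩ := List.mem_map.1 hμ
      obtain ⟨s, hs, rfl⟩ := List.mem_map.1 hν
      rw [← hχ t ht, ← hχ s hs]
      exact h2.cl t (hp.mem_iff.1 ht) s (hp.mem_iff.1 hs)
    · intro p hpo μ hμ
      obtain ⟨t, ht, rfl⟩ := List.mem_map.1 hμ
      rw [← hχ t ht]
      exact ⟨h1.tl p hpo t (hp.mem_iff.1 ht), h2.ct p hpo t (hp.mem_iff.1 ht)⟩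
  obtain ⟨ε, f1, f2⟩ := collapse hsq o χ _ L rfl hχ hv
  exact ⟨_, χ, o, ε, hv, f1, h3.trans ((NF_perm _ hp.symm).trans f2)⟩

theorem nf_change (R : FM.{u, u} k) (χ : ℕ → ℕ) (ε ε' : ℕ → k) (M : List ℕ)
    (hb : ∀ μ ∈ M, 1 ≤ μ ∧ μ ≤ 2 * χ μ ∧ χ μ ≤ μ)
    (h : ∀ μ ∈ M, ε' μ = ε μ ∨ (μ < 2 * χ μ ∧ ∃ c, ε' μ = ε μ + (c * c + c))) :
    Iso (NF R (nf χ ε M)) (NF R (nf χ ε' M)) := by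
  induction M with
  | nil => exact Iso.refl _
  | cons μ M ih =>
    have h1 := ih (fun ν hν => hb ν (List.mem_cons_of_mem _ hν))
      (fun ν hν => h ν (List.mem_cons_of_mem _ hν))
    unfold nf
    refine Iso.prod ?_ h1
    dsimp only
    by_cases hμ : μ ∈ M
    · rw [if_pos hμ, if_pos hμ]; exact Iso.refl _
    · rw [if_neg hμ, if_neg hμ]
      rcases h μ List.mem_cons_self with h2 | ⟨h2, c, hc⟩
      · rw [h2]; exact Iso.refl _
      · rw [hc]
        exact W_change h2 (hb μ List.mem_cons_self).2.2 _ _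

end normalform

end FormMod

namespace FormMod

universe u v w z t

section kdim
variable {k : Type u} [Field k]

/-- kernel dimensions -/
noncomputable def kd (X : FM.{u, v} k) (j : ℕ) : ℕ := finrank k (LinearMap.ker (X.T ^ j))

theorem kd_iso {X : FM.{u, v} k} {Y : FM.{u, w} k} (h : Iso X Y) (j : ℕ) : kd X j = kd Y j := by
  obtain ⟨g, hg⟩ := h.hom
  have e : (LinearMap.ker (X.T ^ j)).map g.toLinearMap = LinearMap.ker (Y.T ^ j) := by
    ext y
    constructor
    · rintro ⟨x, hx, rfl⟩
      rw [SetLike.mem_coe, LinearMap.mem_ker] at hx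
      rw [LinearMap.mem_ker, ← hg.tp, hx, map_zero]
    · intro hy
      rw [LinearMap.mem_ker] at hy
      refine ⟨g.symm y, ?_, by simp⟩
      rw [SetLike.mem_coe, LinearMap.mem_ker]
      apply g.injective
      have := hg.tp j (g.symm y)
      simp only [LinearEquiv.coe_coe, LinearEquiv.apply_symm_apply] at this
      rw [this, hy, map_zero]
  unfold kd
  rw [← e]
  exact (g.finrank_map_eq _).symm

theorem finrank_ker_prodMap {V : Type v} {W : Type w} [AddCommGroup V] [Module k V]
    [FiniteDimensional k V] [AddCommGroup W] [Module k W] [FiniteDimensional k W]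
    (A : V →ₗ[k] V) (C : W →ₗ[k] W) :
    finrank k (LinearMap.ker (A.prodMap C)) =
      finrank k (LinearMap.ker A) + finrank k (LinearMap.ker C) := by
  have h1 := LinearMap.finrank_range_add_finrank_ker (A.prodMap C)
  have h2 := LinearMap.finrank_range_add_finrank_ker A
  have h3 := LinearMap.finrank_range_add_finrank_ker C
  rw [← Module.finrank_prod]
  rw [LinearMap.ker_prodMap]
  exact (LinearEquiv.finrank_eq
    { toFun := fun x : (LinearMap.ker A).prod (LinearMap.ker C) =>
        ((⟨x.1.1, x.2.1⟩ : LinearMap.ker A), (⟨x.1.2, x.2.2⟩ : LinearMap.ker C))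
      invFun := fun y => ⟨(y.1.1, y.2.1), y.1.2, y.2.2⟩
      map_add' := fun _ _ => rfl
      map_smul' := fun _ _ => rfl
      left_inv := fun _ => rfl
      right_inv := fun _ => rfl })

theorem prodMap_pow' {V : Type v} {W : Type w} [AddCommGroup V] [Module k V]
    [AddCommGroup W] [Module k W] (A : Module.End k V) (C : Module.End k W) (n : ℕ) :
    (A.prodMap C : Module.End k (V × W)) ^ n = (A ^ n).prodMap (C ^ n) := by
  induction n with
  | zero => rfl
  | succ n ih => rw [pow_succ, ih, pow_succ, pow_succ]; rfl

theorem kd_prod (X : FM.{u, v} k) (Y : FM.{u, w} k) (j : ℕ) :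
    kd (X.prod Y) j = kd X j + kd Y j := by
  unfold kd
  rw [← finrank_ker_prodMap, ← prodMap_pow']

theorem finrank_ker_shift (a j : ℕ) : finrank k (LinearMap.ker ((shiftL k a) ^ j)) = min j a := by
  let g : Fin (a - j) → Fin a := fun i => ⟨i.1, by omega⟩
  have hg : Function.Injective g := by
    intro i i' h
    have := congrArg Fin.val h
    exact Fin.ext this
  have e : LinearMap.ker ((shiftL k a) ^ j) = LinearMap.ker (LinearMap.funLeft k k g) := by
    ext f
    rw [LinearMap.mem_ker, LinearMap.mem_ker]
    constructor
    · intro h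
      ext i
      have := congrFun h ⟨i.1 + j, by omega⟩
      rw [shiftL_pow, dif_pos (by simp)] at this
      simpa [LinearMap.funLeft_apply, g] using this
    · intro h
      ext i
      rw [shiftL_pow]
      split_ifs with hi
      · have := congrFun h ⟨i.1 - j, by omega⟩
        simpa [LinearMap.funLeft_apply, g] using this
      · rfl
  rw [e]
  have h1 := LinearMap.finrank_range_add_finrank_ker (LinearMap.funLeft k k g)
  rw [LinearMap.range_eq_top.2 (LinearMap.funLeft_surjective_of_injective k k g hg), finrank_top] at h1
  simp at h1
  omega

theorem kd_Blk (a b : ℕ) (x y : ℕ → k) (j : ℕ) : kd (Blk a b x y) j = min j a + min j b := by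
  unfold kd
  rw [← finrank_ker_shift (k := k) a j, ← finrank_ker_shift (k := k) b j, ← finrank_ker_prodMap, ← prodMap_pow']

/-- tail sizes -/
def tlJ : Option (ℕ × List ℕ) → List ℕ
  | none => []
  | some p => (p.1 + 1) :: p.1 :: (p.2 ++ p.2)

/-- all block sizes -/
def JJ (M : List ℕ) (o : Option (ℕ × List ℕ)) : List ℕ := (M ++ M) ++ tlJ o

/-- sums of minima -/
def ms (L : List ℕ) (j : ℕ) : ℕ := (L.map (min j)).sum

theorem ms_append (L L' : List ℕ) (j : ℕ) : ms (L ++ L') j = ms L j + ms L' j := by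
  unfold ms; simp

theorem ms_cons (a : ℕ) (L : List ℕ) (j : ℕ) : ms (a :: L) j = min j a + ms L j := by
  unfold ms; simp

theorem kd_hs (R : FM.{u, u} k) (L : List ℕ) (j : ℕ) :
    kd (hs k R L) j = kd R j + 2 * ms L j := by
  induction L with
  | nil => simp [hs, ms]
  | cons a L ih =>
    unfold hs
    rw [kd_prod, ih, ms_cons, H, kd_Blk]; ring

theorem kd_NF (R : FM.{u, u} k) (χ : ℕ → ℕ) (ε : ℕ → k) (L : List ℕ) (j : ℕ) :
    kd (NF R (nf χ ε L)) j = kd R j + 2 * ms L j := by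
  induction L with
  | nil => simp [NF, nf, ms]
  | cons a L ih =>
    unfold nf NF
    rw [kd_prod, ih, ms_cons, W, kd_Blk]; ring

theorem kd_Tl (o : Option (ℕ × List ℕ)) (j : ℕ) : kd (Tl k o) j = ms (tlJ o) j := by
  cases o with
  | none => unfold Tl; rw [Zr, kd_Blk]; simp [tlJ, ms]
  | some p =>
    unfold Tl tlJ
    rw [kd_hs, D, kd_Blk, ms_cons, ms_cons, ms_append]; ring

theorem kd_model (M : List ℕ) (χ : ℕ → ℕ) (o : Option (ℕ × List ℕ)) (ε : ℕ → k) (j : ℕ) :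
    kd (NF (Tl k o) (nf χ ε M)) j = ms (JJ M o) j := by
  rw [kd_NF, kd_Tl, JJ, ms_append, ms_append]; ring

theorem ms_count (L : List ℕ) {s : ℕ} (hs : 1 ≤ s) :
    2 * ms L s = ms L (s - 1) + ms L (s + 1) + L.count s := by
  induction L with
  | nil => simp [ms]
  | cons a L ih =>
    rw [ms_cons, ms_cons, ms_cons, List.count_cons]
    have : (if (a == s) = true then 1 else 0) = if a = s then 1 else 0 := by simp
    rw [this]
    split_ifs <;> omega

theorem count_of_ms {L L' : List ℕ} (h : ∀ j, ms L j = ms L' j) {s : ℕ} (hs : 1 ≤ s) :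
    L.count s = L'.count s := by
  have h1 := ms_count L hs
  have h2 := ms_count L' hs
  rw [h, h, h] at h1
  omega

theorem sym_count (K : ℕ) (mult lam : ℕ → ℕ) {s : ℕ} (hs : 1 ≤ s) :
    2 * (∑ i ∈ Finset.range K, mult i * min s (lam i)) =
      ∑ i ∈ Finset.range K, mult i * min (s - 1) (lam i) +
      ∑ i ∈ Finset.range K, mult i * min (s + 1) (lam i) +
      ∑ i ∈ Finset.range K, (if lam i = s then mult i else 0) := by
  rw [Finset.mul_sum, ← Finset.sum_add_distrib, ← Finset.sum_add_distrib]
  refine Finset.sum_congr rfl fun i _ => ?_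
  have : 2 * min s (lam i) = min (s - 1) (lam i) + min (s + 1) (lam i) +
      (if lam i = s then 1 else 0) := by split_ifs <;> omega
  have h2 : (if lam i = s then mult i else 0) = mult i * (if lam i = s then 1 else 0) := by simp
  rw [h2, ← mul_add, ← mul_add, ← this]; ring

theorem tl_count_odd {p : ℕ × List ℕ} (M : List ℕ) (s : ℕ) (hs : 1 ≤ s) :
    (JJ M (some p)).count s % 2 = if s = p.1 + 1 ∨ s = p.1 then 1 else 0 := by
  unfold JJ tlJ
  simp only [List.count_append, List.count_cons, beq_iff_eq]
  split_ifs <;> omega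

theorem none_count (M : List ℕ) (s : ℕ) :
    (JJ M none).count s = 2 * M.count s := by
  unfold JJ tlJ
  simp only [List.count_append, List.count_nil]
  omega

theorem skel_unique {M M' : List ℕ} {χ χ' : ℕ → ℕ} {o o' : Option (ℕ × List ℕ)}
    (hv : Valid M χ o) (hv' : Valid M' χ' o') (h : ∀ j, ms (JJ M o) j = ms (JJ M' o') j) :
    M = M' ∧ ((o = none ∧ o' = none) ∨
      ∃ m νs νs', o = some (m, νs) ∧ o' = some (m, νs') ∧ νs.Perm νs') := by
  have hc : ∀ s, 1 ≤ s → _ := fun s hs => count_of_ms h hs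
  have heq : M.Perm M' → M = M' := fun hp =>
    hp.eq_of_pairwise (fun a b _ _ h1 h2 => le_antisymm h2 h1) hv.sorted hv'.sorted
  have h0 : M.count 0 = 0 := List.count_eq_zero.2 fun hh => by have := hv.blk 0 hh; omega
  have h0' : M'.count 0 = 0 := List.count_eq_zero.2 fun hh => by have := hv'.blk 0 hh; omega
  rcases o with _ | ⟨m, νs⟩ <;> rcases o' with _ | ⟨m', νs'⟩
  · refine ⟨heq (List.perm_iff_count.2 fun s => ?_), Or.inl ⟨rfl, rfl⟩⟩
    rcases Nat.eq_zero_or_pos s with rfl | hs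
    · rw [h0, h0']
    · have := hc s hs
      rw [none_count, none_count] at this
      omega
  · exfalso
    have h1 := hc (m' + 1) (by omega)
    have h2 := tl_count_odd (p := (m', νs')) M' (m' + 1) (by omega)
    rw [← h1, none_count, if_pos (Or.inl rfl)] at h2
    omega
  · exfalso
    have h1 := hc (m + 1) (by omega)
    have h2 := tl_count_odd (p := (m, νs)) M (m + 1) (by omega)
    rw [h1, none_count, if_pos (Or.inl rfl)] at h2
    omega
  · have hm : m = m' := by
      have h1 := tl_count_odd (p := (m, νs)) M (m + 1) (by omega)
      have h2 := tl_count_odd (p := (m', νs')) M' (m + 1) (by omega)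
      have h3 := tl_count_odd (p := (m, νs)) M (m' + 1) (by omega)
      have h4 := tl_count_odd (p := (m', νs')) M' (m' + 1) (by omega)
      have e1 := hc (m + 1) (by omega)
      have e2 := hc (m' + 1) (by omega)
      rw [if_pos (Or.inl rfl)] at h1 h4
      by_contra hne
      rcases Nat.lt_or_gt_of_ne hne with hlt | hlt
      · rw [if_neg (by simp only; omega)] at h3
        omega
      · rw [if_neg (by simp only; omega)] at h2
        omega
    subst hm
    have hcc : ∀ s, 1 ≤ s → M.count s + νs.count s = M'.count s + νs'.count s := by
      intro s hs
      have := hc s hs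
      unfold JJ tlJ at this
      simp only [List.count_append, List.count_cons] at this
      omega
    have z1 : ∀ s, s ≤ m + 1 → M.count s = 0 := fun s hs => List.count_eq_zero.2 fun hh => by
      have := (hv.tl _ rfl s hh).1; simp only at this; omega
    have z2 : ∀ s, s ≤ m + 1 → M'.count s = 0 := fun s hs => List.count_eq_zero.2 fun hh => by
      have := (hv'.tl _ rfl s hh).1; simp only at this; omega
    have z3 : ∀ s, ¬ (1 ≤ s ∧ s ≤ m + 1) → νs.count s = 0 := fun s hs =>
      List.count_eq_zero.2 fun hh => hs (hv.nu _ rfl s hh)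
    have z4 : ∀ s, ¬ (1 ≤ s ∧ s ≤ m + 1) → νs'.count s = 0 := fun s hs =>
      List.count_eq_zero.2 fun hh => hs (hv'.nu _ rfl s hh)
    refine ⟨heq (List.perm_iff_count.2 fun s => ?_), Or.inr ⟨m, νs, νs', rfl, rfl,
      List.perm_iff_count.2 fun s => ?_⟩⟩
    · by_cases hs : s ≤ m + 1
      · rw [z1 s hs, z2 s hs]
      · have := hcc s (by omega)
        rw [z3 s (by omega), z4 s (by omega)] at this
        exact this
    · by_cases hs : 1 ≤ s ∧ s ≤ m + 1
      · have := hcc s (by omega)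
        rw [z1 s hs.2, z2 s hs.2] at this
        omega
      · rw [z3 s hs, z4 s hs]

theorem hs_perm (R : FM.{u, u} k) {L L' : List ℕ} (h : L.Perm L') :
    Iso (hs k R L) (hs k R L') := by
  induction h with
  | nil => exact Iso.refl _
  | cons t _ ih => exact (Iso.refl _).prod ih
  | swap s t L => exact Iso.left_comm _ _ _
  | trans _ _ h1 h2 => exact h1.trans h2

end kdim

end FormMod

namespace FormMod

universe u v w z t

section chi
variable {k : Type u} [Field k]

/-- vanishing predicate of the index function -/
def AA (X : FM.{u, v} k) (p j : ℕ) : Prop := ∀ v : X.V, (X.T ^ p) v = 0 → X.Q ((X.T ^ j) v) = 0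

theorem AA.iso {X : FM.{u, v} k} {Y : FM.{u, w} k} (h : Iso X Y) {p j : ℕ} (hA : AA X p j) :
    AA Y p j := by
  obtain ⟨g, hg⟩ := h.symm.hom
  intro v hv
  have h1 := hA (g v) (by
    have := hg.tp p v
    rw [hv, map_zero] at this
    exact this.symm)
  rw [← h1, ← hg.1, hg.tp]
  rfl

theorem AA.prod {X : FM.{u, v} k} {Y : FM.{u, w} k} {p j : ℕ} (hX : AA X p j) (hY : AA Y p j) :
    AA (X.prod Y) p j := by
  rintro ⟨a, b⟩ h
  rw [FM.prod_tp] at h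
  rw [FM.prod_tp, FM.prod_Q, hX a (congrArg Prod.fst h), hY b (congrArg Prod.snd h), add_zero]

theorem AA.left {X : FM.{u, v} k} {Y : FM.{u, w} k} {p j : ℕ} (h : AA (X.prod Y) p j) :
    AA X p j := by
  intro a ha
  have := h (a, 0) (by rw [FM.prod_tp, ha, map_zero]; rfl)
  rw [FM.prod_tp, FM.prod_Q] at this
  simpa using this

theorem AA.right {X : FM.{u, v} k} {Y : FM.{u, w} k} {p j : ℕ} (h : AA (X.prod Y) p j) :
    AA Y p j := by
  intro a ha
  have := h (0, a) (by rw [FM.prod_tp, ha, map_zero]; rfl)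
  rw [FM.prod_tp, FM.prod_Q] at this
  simpa using this

theorem AA.succ {X : FM.{u, v} k} {p j : ℕ} (h : AA X p j) : AA X p (j + 1) := by
  intro a ha
  rw [← X.tp_succ]
  exact h _ (by rw [X.tp_succ, X.tp_zero_of_le ha (by omega)])

theorem AA.mono {X : FM.{u, v} k} {p j j' : ℕ} (h : AA X p j) (hj : j ≤ j') : AA X p j' := by
  induction j', hj using Nat.le_induction with
  | base => exact h
  | succ n _ ih => exact ih.succ

theorem AA_self (X : FM.{u, v} k) (p : ℕ) : AA X p p := by
  intro a ha
  rw [ha, map_zero]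

/-- index function -/
noncomputable def ic (X : FM.{u, v} k) (p : ℕ) : ℕ := X.Q.indexChi X.T p

theorem ic_AA (X : FM.{u, v} k) (p : ℕ) : AA X p (ic X p) :=
  Nat.sInf_mem (s := {j : ℕ | AA X p j}) ⟨p, AA_self X p⟩

theorem ic_le {X : FM.{u, v} k} {p j : ℕ} (h : AA X p j) : ic X p ≤ j :=
  Nat.sInf_le (s := {j : ℕ | AA X p j}) h

theorem ic_mono (X : FM.{u, v} k) {p q : ℕ} (h : p ≤ q) : ic X p ≤ ic X q :=
  ic_le fun a ha => ic_AA X q a (X.tp_zero_of_le ha h)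

theorem ic_eq {X : FM.{u, v} k} {p j : ℕ} (hj : 1 ≤ j) (h : AA X p j) (h' : ¬ AA X p (j - 1)) :
    ic X p = j := by
  refine le_antisymm (ic_le h) ?_
  by_contra hc
  exact h' ((ic_AA X p).mono (by omega))

theorem ic_iso {X : FM.{u, v} k} {Y : FM.{u, w} k} (h : Iso X Y) (p : ℕ) : ic X p = ic Y p :=
  le_antisymm (ic_le ((ic_AA Y p).iso h.symm)) (ic_le ((ic_AA X p).iso h))

theorem AA_of_tpow {X : FM.{u, v} k} {j : ℕ} (h : X.T ^ j = 0) (p : ℕ) : AA X p j := by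
  intro a _
  rw [h]; simp

variable [CharP k 2]

theorem AA_W {μ l : ℕ} (δ : k) (h1 : μ ≤ 2 * l) {p j : ℕ} (h : l ≤ j + (μ - p)) :
    AA (W μ l δ) p j := by
  rintro ⟨f, g⟩ hv
  rw [Blk_tp] at hv
  have hf : ∀ i : Fin μ, i.1 < μ - p → f i = 0 := by
    intro i hi
    have : ((shiftL k μ) ^ p) f ⟨i.1 + p, by omega⟩ = 0 :=
      congrFun (congrArg Prod.fst hv) ⟨i.1 + p, by omega⟩
    rw [shiftL_pow, dif_pos (by simp)] at this
    simpa using this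
  have hg : ∀ i : Fin μ, i.1 < μ - p → g i = 0 := by
    intro i hi
    have : ((shiftL k μ) ^ p) g ⟨i.1 + p, by omega⟩ = 0 :=
      congrFun (congrArg Prod.snd hv) ⟨i.1 + p, by omega⟩
    rw [shiftL_pow, dif_pos (by simp)] at this
    simpa using this
  rw [Blk_Q_tp le_rfl]
  have e1 : ∀ i : Fin μ, f i * f i * (if i.1 + j < μ then wx k μ l (i.1 + j) else 0) = 0 := by
    intro i
    by_cases hi : i.1 < μ - p
    · rw [hf i hi]; ring
    · unfold wx
      rw [if_neg (fun h => by omega : ¬ (i.1 + j + 1 = l ∧ μ < 2 * l))]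
      simp
  have e2 : ∀ i : Fin μ, g i * g i * (if i.1 + j < μ then wy μ l δ (i.1 + j) else 0) = 0 := by
    intro i
    by_cases hi : i.1 < μ - p
    · rw [hg i hi]; ring
    · unfold wy
      rw [if_neg (fun h => by omega : ¬ (i.1 + j + l = μ ∧ μ < 2 * l))]
      simp
  have e3 : ∀ i i' : Fin μ, (if i.1 + i'.1 + 2 * j + 1 = μ then f i * g i' else 0) = 0 := by
    intro i i'
    by_cases hi : i.1 < μ - p
    · rw [hf i hi]; simp
    by_cases hi : i'.1 < μ - p
    · rw [hg i' hi]; simp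
    rw [if_neg (by omega)]
  rw [Finset.sum_eq_zero fun i _ => e1 i, Finset.sum_eq_zero fun i _ => e2 i,
    Finset.sum_eq_zero fun i _ => Finset.sum_eq_zero fun j _ => e3 i j]
  simp

theorem not_AA_W {μ l : ℕ} (δ : k) (h0 : 1 ≤ μ) (h1 : μ ≤ 2 * l) (h2 : l ≤ μ) :
    ¬ AA (W μ l δ) μ (l - 1) := by
  have hW := W_gen h1 h2 δ
  intro h
  by_cases h3 : μ < 2 * l
  · have := h _ hW.pair.tv
    rw [hW.qv] at this
    unfold wx at this
    rw [if_pos (by omega)] at this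
    exact one_ne_zero this
  · have := h (gv _ _ _ _ + (W μ l δ).T (gw _ _ _ _)) (by
      rw [map_add, hW.pair.tv, FM.tp_succ, FM.tp_zero_of_le _ hW.pair.tw (by omega), add_zero])
    rw [map_add, FM.tp_succ, FM.Q_add, hW.qv, hW.qw, ← (Blk_alt le_rfl _ _ : (W μ l δ).Alt).adjp, FM.tp, hW.pair.pr, wx, wy, if_neg (by omega),
      if_neg (by omega), if_pos (by omega)] at this
    simp at this

theorem Tl_tpow (o : Option (ℕ × List ℕ)) {n : ℕ} (h1 : ∀ p ∈ o, p.1 + 1 ≤ n)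
    (h2 : ∀ p ∈ o, ∀ ν ∈ p.2, ν ≤ n) : (Tl k o).T ^ n = 0 := by
  have hb : ∀ (a b : ℕ) (x y : ℕ → k), a ≤ n → b ≤ n → (Blk a b x y).T ^ n = 0 := by
    intro a b x y ha hb
    have := Blk_nil a b x y
    exact pow_eq_zero_of_le (by omega) this
  cases o with
  | none => exact hb 0 0 _ _ (by omega) (by omega)
  | some p =>
    have h1' := h1 p rfl
    have h2' := h2 p rfl
    change (hs k (D k p.1) p.2).T ^ n = 0
    generalize p.2 = L at h2'
    induction L with
    | nil => exact hb _ _ _ _ h1' (by omega)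
    | cons a L ih =>
      exact FM.prod_tpow (hb _ _ _ _ (h2' a List.mem_cons_self) (h2' a List.mem_cons_self))
        (ih fun ν hν => h2' ν (List.mem_cons_of_mem _ hν))

theorem AA_NF {R : FM.{u, u} k} {p j : ℕ} (hR : AA R p j) (χ : ℕ → ℕ) (ε : ℕ → k) (L : List ℕ)
    (h : ∀ μ ∈ L, μ ≤ 2 * χ μ ∧ χ μ ≤ j + (μ - p)) : AA (NF R (nf χ ε L)) p j := by
  induction L with
  | nil => exact hR
  | cons μ L ih =>
    obtain ⟨h1, h2⟩ := h μ List.mem_cons_self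
    exact (AA_W _ h1 h2).prod (ih fun ν hν => h ν (List.mem_cons_of_mem _ hν))

theorem not_AA_NF {R : FM.{u, u} k} {p j : ℕ} (χ : ℕ → ℕ) (ε : ℕ → k) (L : List ℕ)
    (h : ∃ μ ∈ L, ∀ δ : k, ¬ AA (W μ (χ μ) δ) p j) : ¬ AA (NF R (nf χ ε L)) p j := by
  induction L with
  | nil => obtain ⟨μ, h, _⟩ := h; simp at h
  | cons μ L ih =>
    obtain ⟨ν, hν, hh⟩ := h
    intro hA
    rcases List.mem_cons.1 hν with rfl | hν
    · exact hh _ (AA.left (X := W ν (χ ν) (if ν ∈ L then 0 else ε ν)) hA)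
    · exact ih ⟨ν, hν, hh⟩ (AA.right (X := W μ (χ μ) (if μ ∈ L then 0 else ε μ)) hA)

theorem ic_model {M : List ℕ} {χ : ℕ → ℕ} {o : Option (ℕ × List ℕ)} (hv : Valid M χ o)
    (ε : ℕ → k) {μ : ℕ} (hμ : μ ∈ M) : ic (NF (Tl k o) (nf χ ε M)) μ = χ μ := by
  have hb := hv.blk μ hμ
  refine ic_eq (by omega) (AA_NF (AA_of_tpow (Tl_tpow o ?_ ?_) _) _ _ _ ?_)
    (not_AA_NF _ _ _ ⟨μ, hμ, fun δ => not_AA_W δ hb.1 hb.2.1 hb.2.2⟩)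
  · exact fun p hp => (hv.tl p hp μ hμ).2
  · exact fun p hp ν hν => ((hv.nu p hp ν hν).2).trans (hv.tl p hp μ hμ).2
  · exact fun ν hν => ⟨(hv.blk ν hν).2.1, hv.cl ν hν μ hμ⟩

theorem ic_model_low (χ : ℕ → ℕ) (M νs : List ℕ) (m : ℕ)
    (ε : ℕ → k) {ν : ℕ} (h1 : 1 ≤ ν) (h2 : ν ≤ m + 1) :
    ic (NF (Tl k (some (m, νs))) (nf χ ε M)) ν = ν := by
  refine ic_eq h1 (AA_self _ _) ?_
  have hD : ¬ AA (D k m) ν (ν - 1) := by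
    intro h
    have := h (((D k m).T ^ (m + 1 - ν)) (gv _ _ _ _)) (by
      rw [FM.tp, gv_tp, ind_zero_of_le (by omega)]; rfl)
    rw [FM.tp, gv_Q, if_pos (by omega), dx, if_pos (by omega)] at this
    exact one_ne_zero this
  have hh : ¬ AA (Tl k (some (m, νs))) ν (ν - 1) := by
    unfold Tl
    dsimp only
    induction νs with
    | nil => exact hD
    | cons a L ih => exact fun h => ih (AA.right (X := H k a) h)
  generalize Tl k (some (m, νs)) = R at hh
  induction M with
  | nil => exact hh
  | cons μ L ih =>
    exact fun h => ih (AA.right (X := W μ (χ μ) (if μ ∈ L then 0 else ε μ)) h)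

theorem iso_skel {X : FM.{u, v} k} {M M' : List ℕ} {χ χ' : ℕ → ℕ} {o o' : Option (ℕ × List ℕ)}
    {ε ε' : ℕ → k} (hv : Valid M χ o) (hv' : Valid M' χ' o')
    (h : Iso X (NF (Tl k o) (nf χ ε M))) (h' : Iso X (NF (Tl k o') (nf χ' ε' M'))) :
    M = M' ∧ (∀ μ ∈ M, χ μ = χ' μ) ∧ ((o = none ∧ o' = none) ∨
      ∃ m νs νs', o = some (m, νs) ∧ o' = some (m, νs') ∧ νs.Perm νs') := by
  obtain ⟨e, h2⟩ := skel_unique hv hv' (fun j => by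
    rw [← kd_model (k := k) M χ o ε j, ← kd_model (k := k) M' χ' o' ε' j, ← kd_iso h, ← kd_iso h'])
  subst e
  refine ⟨rfl, fun μ hμ => ?_, h2⟩
  rw [← ic_model hv ε hμ, ← ic_model hv' ε' hμ, ← ic_iso h, ← ic_iso h']

end chi

end FormMod

namespace FormMod

universe u v w z t

section counting
variable {k : Type u} [Field k] [CharP k 2]

theorem sym_mem {X : FM.{u, v} k} {M : List ℕ} {χ : ℕ → ℕ} {o : Option (ℕ × List ℕ)}
    {ε : ℕ → k} (h : Iso X (NF (Tl k o) (nf χ ε M))) {K : ℕ} {lam mult chi : ℕ → ℕ}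
    (hsy : X.Q.IsSymbolOf X.T K lam mult chi) {s : ℕ} (hs : 1 ≤ s) :
    s ∈ JJ M o ↔ ∃ i < K, lam i = s := by
  obtain ⟨_, _, h3, h4, _⟩ := hsy
  have e : ∀ j, ms (JJ M o) j = ∑ i ∈ Finset.range K, mult i * min j (lam i) := by
    intro j
    rw [← h4, ← kd_model (k := k) M χ o ε j, ← kd_iso h]
    rfl
  have h5 := sym_count K mult lam hs
  have h6 := ms_count (JJ M o) hs
  rw [← e, ← e, ← e] at h5
  have h7 : (JJ M o).count s = ∑ i ∈ Finset.range K, (if lam i = s then mult i else 0) := by omega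
  rw [← List.count_pos_iff, h7]
  constructor
  · intro hp
    by_contra hc
    push Not at hc
    rw [Finset.sum_eq_zero] at hp
    · omega
    · intro i hi
      rw [if_neg (hc i (Finset.mem_range.1 hi))]
  · rintro ⟨i, hi, rfl⟩
    have := Finset.single_le_sum (f := fun i' => if lam i' = lam i then mult i' else 0)
      (fun _ _ => Nat.zero_le _) (Finset.mem_range.2 hi)
    simp only [if_true] at this
    have := h3 i hi
    omega

theorem lam_anti {K : ℕ} {lam : ℕ → ℕ} (h : ∀ i : ℕ, i + 1 < K → lam (i + 1) < lam i) {i j : ℕ}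
    (hij : i < j) (hj : j < K) : lam j < lam i := by
  induction j, hij using Nat.le_induction with
  | base => exact h i hj
  | succ n hn ih => exact (h n hj).trans (ih (by omega))

open Classical in
theorem brk_count {X : FM.{u, v} k} {M : List ℕ} {χ : ℕ → ℕ} {o : Option (ℕ × List ℕ)}
    {ε : ℕ → k} (hv : Valid M χ o) (h : Iso X (NF (Tl k o) (nf χ ε M))) {K : ℕ}
    {lam mult chi : ℕ → ℕ} (hsy : X.Q.IsSymbolOf X.T K lam mult chi) :
    (o = none → symbolN2 K lam chi = (M.toFinset.filter (IsBrk M χ o)).card) ∧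
    (o ≠ none → symbolN1 K lam chi = (M.toFinset.filter (IsBrk M χ o)).card) := by
  have hmem : ∀ s, 1 ≤ s → (s ∈ JJ M o ↔ ∃ i < K, lam i = s) := fun s hs => sym_mem h hsy hs
  obtain ⟨h1, h2, _, _, h5⟩ := hsy
  have hchi : ∀ i < K, chi i = ic X (lam i) := h5
  have hanti : ∀ i j, i < j → j < K → lam j < lam i := fun i j => lam_anti h1
  have hinj : ∀ i j, i < K → j < K → lam i = lam j → i = j := by
    intro i j hi hj e
    rcases lt_trichotomy i j with hh | hh | hh
    · have := hanti i j hh hj; omega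
    · exact hh
    · have := hanti j i hh hi; omega
  have hχ : ∀ μ ∈ M, ic X μ = χ μ := fun μ hμ => by rw [ic_iso h, ic_model hv ε hμ]
  have hMJ : ∀ μ ∈ M, μ ∈ JJ M o := fun μ hμ => by unfold JJ; simp [hμ]
  -- if lam j < lam i then lam j <= lam (i+1)
  have hnext : ∀ i j, i < K → j < K → lam j < lam i → i + 1 < K ∧ lam j ≤ lam (i + 1) := by
    intro i j hi hj hlt
    have hij : i < j := by
      by_contra hc
      rcases Nat.lt_or_ge j i with hh | hh
      · have := hanti j i hh hi
        omega
      · have : i = j := by omega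
        subst this; omega
    refine ⟨by omega, ?_⟩
    rcases Nat.eq_or_lt_of_le (show i + 1 ≤ j from hij) with hh | hh
    · rw [hh]
    · exact (hanti _ _ hh hj).le
  constructor
  · rintro rfl
    have hJ : ∀ s, s ∈ JJ M none ↔ s ∈ M := fun s => by unfold JJ tlJ; simp
    unfold symbolN2
    refine Finset.card_nbij lam ?_ ?_ ?_
    · intro i hi
      rw [Finset.mem_coe, Finset.mem_filter, Finset.mem_range] at hi
      obtain ⟨hi, c1, c2⟩ := hi
      have hiM : lam i ∈ M := (hJ _).1 ((hmem _ (h2 i hi)).2 ⟨i, hi, rfl⟩)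
      have hb := hv.blk _ hiM
      rw [Finset.mem_coe, Finset.mem_filter, List.mem_toFinset]
      rw [hchi i hi, hχ _ hiM] at c1 c2
      refine ⟨hiM, hiM, by omega, ?_, by simp⟩
      intro ν hν hlt
      obtain ⟨j, hj, rfl⟩ := (hmem ν (hv.blk ν hν).1).1 ((hJ _).2 hν)
      obtain ⟨a1, a2⟩ := hnext i j hi hj hlt
      rw [if_pos a1, hchi _ a1] at c1
      have := ic_mono X a2
      rw [hχ _ hν] at this
      omega
    · intro i hi j hj e
      rw [Finset.mem_coe, Finset.mem_filter, Finset.mem_range] at hi hj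
      exact hinj i j hi.1 hj.1 e
    · intro μ hμ
      rw [Finset.mem_coe, Finset.mem_filter, List.mem_toFinset] at hμ
      obtain ⟨hμ, hB⟩ := hμ
      have hb := hv.blk _ hμ
      obtain ⟨i, hi, rfl⟩ := (hmem μ hb.1).1 ((hJ _).2 hμ)
      refine ⟨i, ?_, rfl⟩
      rw [Finset.mem_coe, Finset.mem_filter, Finset.mem_range, hchi i hi, hχ _ hμ]
      have hlt := hB.lt
      refine ⟨hi, ?_, by omega⟩
      split_ifs with hc
      · have hM' : lam (i + 1) ∈ M := (hJ _).1 ((hmem _ (h2 _ hc)).2 ⟨_, hc, rfl⟩)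
        rw [hchi _ hc, hχ _ hM']
        exact hB.sm _ hM' (h1 i hc)
      · omega
  · intro ho
    obtain ⟨⟨m, νs⟩, rfl⟩ := Option.ne_none_iff_exists'.1 ho
    have hJ : ∀ s ∈ JJ M (some (m, νs)), s ∈ M ∨ s ≤ m + 1 := by
      intro s hs
      unfold JJ tlJ at hs
      simp only [List.mem_append, List.mem_cons, or_self] at hs
      rcases hs with hs | hs | hs | hs
      · exact Or.inl hs
      · exact Or.inr (by omega)
      · exact Or.inr (by omega)
      · exact Or.inr (hv.nu _ rfl s hs).2
    have hlow : ∀ ν, 1 ≤ ν → ν ≤ m + 1 → ic X ν = ν := fun ν a b => by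
      rw [ic_iso h, ic_model_low χ M νs m ε a b]
    obtain ⟨i0, hi0, e0⟩ := (hmem (m + 1) (by omega)).1 (by unfold JJ tlJ; simp)
    unfold symbolN1
    refine Finset.card_nbij lam ?_ ?_ ?_
    · intro i hi
      rw [Finset.mem_coe, Finset.mem_filter, Finset.mem_range] at hi
      obtain ⟨hi, c0, c1, c2⟩ := hi
      rw [hchi i hi, hchi _ c0] at c1
      rw [hchi i hi] at c2
      have hiM : lam i ∈ M := by
        rcases hJ _ ((hmem _ (h2 i hi)).2 ⟨i, hi, rfl⟩) with hh | hh
        · exact hh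
        · exfalso
          have a1 := h2 _ c0
          have a2 := h1 i c0
          rw [hlow _ (h2 i hi) hh, hlow _ a1 (by omega)] at c1
          omega
      have hb := hv.blk _ hiM
      rw [Finset.mem_coe, Finset.mem_filter, List.mem_toFinset]
      rw [hχ _ hiM] at c1 c2
      refine ⟨hiM, hiM, by omega, ?_, ?_⟩
      · intro ν hν hlt
        obtain ⟨j, hj, rfl⟩ := (hmem ν (hv.blk ν hν).1).1 (hMJ _ hν)
        obtain ⟨a1, a2⟩ := hnext i j hi hj hlt
        have := ic_mono X a2
        rw [hχ _ hν] at this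
        omega
      · intro p hp
        have hp' : (m, νs) = p := Option.some.inj hp
        subst hp'
        have hlt := (hv.tl _ rfl _ hiM).1
        simp only at hlt ⊢
        obtain ⟨a1, a2⟩ := hnext i i0 hi hi0 (by omega)
        have := ic_mono X a2
        rw [e0, hlow (m + 1) (by omega) le_rfl] at this
        omega
    · intro i hi j hj e
      rw [Finset.mem_coe, Finset.mem_filter, Finset.mem_range] at hi hj
      exact hinj i j hi.1 hj.1 e
    · intro μ hμ
      rw [Finset.mem_coe, Finset.mem_filter, List.mem_toFinset] at hμ
      obtain ⟨hμ, hB⟩ := hμ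
      have hb := hv.blk _ hμ
      obtain ⟨i, hi, rfl⟩ := (hmem μ hb.1).1 (hMJ _ hμ)
      refine ⟨i, ?_, rfl⟩
      have hlt0 := (hv.tl _ rfl _ hμ).1
      simp only at hlt0
      obtain ⟨a1, a2⟩ := hnext i i0 hi hi0 (by omega)
      rw [Finset.mem_coe, Finset.mem_filter, Finset.mem_range, hchi i hi, hχ _ hμ, hchi _ a1]
      have hlt := hB.lt
      refine ⟨hi, a1, ?_, by omega⟩
      rcases hJ _ ((hmem _ (h2 _ a1)).2 ⟨_, a1, rfl⟩) with hh | hh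
      · rw [hχ _ hh]
        exact hB.sm _ hh (h1 i a1)
      · rw [hlow _ (h2 _ a1) hh]
        have := hB.tl _ rfl
        simp only at this
        omega

end counting

end FormMod

namespace FormMod

universe u v w z t

section ext
variable {F : Type u} [Field F] {K : Type u} [Field K] [Algebra F K]

/-- scalar extension relation -/
def SE (X : FM.{u, v} F) (Y : FM.{u, w} K) : Prop :=
  ∃ σ : X.V →ₛₗ[algebraMap F K] Y.V,
    (∀ a, Y.Q (σ a) = algebraMap F K (X.Q a)) ∧ (∀ a, σ (X.T a) = Y.T (σ a)) ∧
    Submodule.span K (Set.range σ) = ⊤ ∧ finrank K Y.V = finrank F X.V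

theorem semi_sum {V : Type v} {W : Type w} [AddCommGroup V] [Module F V] [AddCommGroup W]
    [Module K W] (σ : V →ₛₗ[algebraMap F K] W) {n : ℕ} (b : Basis (Fin n) F V) (a : V) :
    σ a = ∑ i, algebraMap F K (b.repr a i) • σ (b i) := by
  conv_lhs => rw [← b.sum_repr a]
  rw [map_sum]
  exact Finset.sum_congr rfl fun i _ => map_smulₛₗ σ _ _

theorem semi_span {V : Type v} {W : Type w} [AddCommGroup V] [Module F V] [AddCommGroup W]
    [Module K W] (σ : V →ₛₗ[algebraMap F K] W) {n : ℕ} (b : Basis (Fin n) F V) :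
    Submodule.span K (Set.range σ) = Submodule.span K (Set.range fun i => σ (b i)) := by
  apply le_antisymm
  · rw [Submodule.span_le]
    rintro _ ⟨a, rfl⟩
    rw [semi_sum σ b a]
    exact Submodule.sum_mem _ fun i _ => Submodule.smul_mem _ _ (Submodule.subset_span ⟨i, rfl⟩)
  · apply Submodule.span_mono
    rintro _ ⟨i, rfl⟩
    exact ⟨_, rfl⟩

theorem SE_iff (X : FM.{u, v} F) (Y : FM.{u, w} K) :
    SE X Y ↔ QuadraticForm.IsScalarExtension X.Q X.T Y.Q Y.T := by
  constructor
  · rintro ⟨σ, h1, h2, h3, h4⟩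
    refine ⟨σ, h1, h2, _, finBasis F X.V, ?_, ?_⟩
    · apply linearIndependent_of_top_le_span_of_card_eq_finrank
      · rw [← semi_span σ (finBasis F X.V), h3]
      · rw [h4]; simp
    · rw [← semi_span σ (finBasis F X.V), h3]
  · rintro ⟨σ, h1, h2, n, b, h3, h4⟩
    refine ⟨σ, h1, h2, ?_, ?_⟩
    · rw [semi_span σ b, h4]
    · rw [finrank_eq_card_basis b, finrank_eq_card_basis (Basis.mk h3 h4.ge)]

theorem SE.iso_left {X : FM.{u, v} F} {X' : FM.{u, w} F} {Y : FM.{u, z} K} (h : SE X Y)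
    (hi : Iso X X') : SE X' Y := by
  obtain ⟨σ, h1, h2, h3, h4⟩ := h
  obtain ⟨g, g1, g2⟩ := hi.symm
  refine ⟨σ.comp g.toLinearMap, fun a => ?_, fun a => ?_, ?_, ?_⟩
  · change Y.Q (σ (g a)) = _
    rw [h1, g1]
  · change σ (g _) = Y.T (σ (g a))
    rw [g2, h2]
  · rw [← h3]
    congr 1
    ext y
    constructor
    · rintro ⟨a, rfl⟩
      exact ⟨g a, rfl⟩
    · rintro ⟨a, rfl⟩
      refine ⟨g.symm a, ?_⟩
      change σ (g (g.symm a)) = _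
      rw [g.apply_symm_apply]
  · rw [h4, hi.finrank]

theorem SE.iso_right {X : FM.{u, v} F} {Y : FM.{u, w} K} {Y' : FM.{u, z} K} (h : SE X Y)
    (hi : Iso Y Y') : SE X Y' := by
  obtain ⟨σ, h1, h2, h3, h4⟩ := h
  have hf := hi.finrank
  obtain ⟨g, g1, g2⟩ := hi
  refine ⟨g.toLinearMap.comp σ, fun a => ?_, fun a => ?_, ?_, ?_⟩
  · change Y'.Q (g (σ a)) = _
    rw [g1, h1]
  · change g (σ _) = Y'.T (g (σ a))
    rw [h2, g2]
  · have : Set.range (g.toLinearMap.comp σ) = g.toLinearMap '' Set.range σ := by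
      ext y; simp
    rw [this, ← Submodule.map_span, h3, Submodule.map_top, LinearMap.range_eq_top]
    exact g.surjective
  · rw [← hf, h4]

theorem SE.prod {X : FM.{u, v} F} {X' : FM.{u, w} F} {Y : FM.{u, z} K} {Y' : FM.{u, t} K}
    (h : SE X Y) (h' : SE X' Y') : SE (X.prod X') (Y.prod Y') := by
  obtain ⟨σ, h1, h2, h3, h4⟩ := h
  obtain ⟨σ', h1', h2', h3', h4'⟩ := h'
  let τ : (X.V × X'.V) →ₛₗ[algebraMap F K] (Y.V × Y'.V) :=
    { toFun := fun p => (σ p.1, σ' p.2)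
      map_add' := fun p q => by simp
      map_smul' := fun c p => by simp [map_smulₛₗ] }
  refine ⟨τ, ?_, ?_, ?_, ?_⟩
  · rintro ⟨a, b⟩
    change (Y.prod Y').Q (σ a, σ' b) = _
    rw [FM.prod_Q, FM.prod_Q, h1, h1', map_add]
  · rintro ⟨a, b⟩
    change (σ (X.T a), σ' (X'.T b)) = (Y.T (σ a), Y'.T (σ' b))
    rw [h2, h2']
  · rw [eq_top_iff]
    rintro ⟨a, b⟩ -
    have e : ((a, b) : Y.V × Y'.V) = LinearMap.inl K Y.V Y'.V a + LinearMap.inr K Y.V Y'.V b := by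
      simp
    rw [e]
    apply Submodule.add_mem
    · have : a ∈ Submodule.span K (Set.range σ) := by rw [h3]; trivial
      have h5 := Submodule.mem_map_of_mem (f := LinearMap.inl K Y.V Y'.V) this
      rw [Submodule.map_span] at h5
      refine Submodule.span_mono ?_ h5
      rintro _ ⟨_, ⟨c, rfl⟩, rfl⟩
      refine ⟨(c, 0), ?_⟩
      change (σ c, σ' 0) = (σ c, 0)
      rw [map_zero]
    · have : b ∈ Submodule.span K (Set.range σ') := by rw [h3']; trivial
      have h5 := Submodule.mem_map_of_mem (f := LinearMap.inr K Y.V Y'.V) this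
      rw [Submodule.map_span] at h5
      refine Submodule.span_mono ?_ h5
      rintro _ ⟨_, ⟨c, rfl⟩, rfl⟩
      refine ⟨(0, c), ?_⟩
      change (σ 0, σ' c) = (0, σ' c)
      rw [map_zero]
  · rw [FM.prod_finrank, FM.prod_finrank, h4, h4']

theorem SE_Blk (a b : ℕ) (x y : ℕ → F) (x' y' : ℕ → K) (hx : ∀ n, x' n = algebraMap F K (x n))
    (hy : ∀ n, y' n = algebraMap F K (y n)) : SE (Blk a b x y) (Blk a b x' y') := by
  let τ : ((Fin a → F) × (Fin b → F)) →ₛₗ[algebraMap F K] ((Fin a → K) × (Fin b → K)) :=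
    { toFun := fun p => (fun i => algebraMap F K (p.1 i), fun i => algebraMap F K (p.2 i))
      map_add' := fun p q => by
        refine Prod.ext ?_ ?_ <;> funext i <;> simp
      map_smul' := fun c p => by
        refine Prod.ext ?_ ?_ <;> funext i <;> simp [Algebra.smul_def] }
  have hsh : ∀ (n : ℕ) (f : Fin n → F), (fun i => algebraMap F K (shiftL F n f i)) =
      shiftL K n (fun i => algebraMap F K (f i)) := by
    intro n f
    funext i
    simp only [shiftL, LinearMap.coe_mk, AddHom.coe_mk]
    split_ifs <;> simp
  refine ⟨τ, ?_, ?_, ?_, ?_⟩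
  · rintro ⟨f, g⟩
    change (Blk a b x' y').Q (fun i => algebraMap F K (f i), fun i => algebraMap F K (g i)) = _
    rw [Blk_Q, Blk_Q, map_add, map_add, map_sum, map_sum]
    unfold pairing
    rw [map_sum]
    congr 1
    · congr 1
      · exact Finset.sum_congr rfl fun i _ => by rw [hx, map_mul, map_mul]
      · exact Finset.sum_congr rfl fun i _ => by rw [hy, map_mul, map_mul]
    · refine Finset.sum_congr rfl fun i _ => ?_
      rw [map_sum]
      refine Finset.sum_congr rfl fun j _ => ?_
      split_ifs
      · rw [map_mul]
      · rw [map_zero]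
  · rintro ⟨f, g⟩
    exact Prod.ext (hsh a f) (hsh b g)
  · rw [eq_top_iff]
    rintro ⟨f, g⟩ -
    have e : ((f, g) : (Fin a → K) × (Fin b → K)) =
        (∑ i, f i • τ (Pi.single i 1, 0)) + ∑ j, g j • τ (0, Pi.single j 1) := by
      refine Prod.ext ?_ ?_
      · funext i
        simp [τ, Prod.fst_sum, Finset.sum_apply, Pi.single_apply, apply_ite]
      · funext i
        simp [τ, Prod.snd_sum, Finset.sum_apply, Pi.single_apply, apply_ite]
    rw [e]
    refine Submodule.add_mem _ (Submodule.sum_mem _ fun i _ => ?_) (Submodule.sum_mem _ fun i _ => ?_)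
    · exact Submodule.smul_mem _ _ (Submodule.subset_span ⟨_, rfl⟩)
    · exact Submodule.smul_mem _ _ (Submodule.subset_span ⟨_, rfl⟩)
  · rw [Blk_finrank, Blk_finrank]

theorem SE_W (μ l : ℕ) (δ : F) : SE (W μ l δ) (W μ l (algebraMap F K δ)) := by
  refine SE_Blk _ _ _ _ _ _ (fun n => ?_) (fun n => ?_)
  · unfold wx; split_ifs <;> simp
  · unfold wy; split_ifs <;> simp

theorem SE_Tl (o : Option (ℕ × List ℕ)) : SE (Tl F o) (Tl K o) := by
  cases o with
  | none => exact SE_Blk _ _ _ _ _ _ (fun n => by simp) (fun n => by simp)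
  | some p =>
    change SE (hs F (D F p.1) p.2) (hs K (D K p.1) p.2)
    generalize p.2 = L
    induction L with
    | nil =>
      refine SE_Blk _ _ _ _ _ _ (fun n => ?_) (fun n => by simp)
      unfold dx; split_ifs <;> simp
    | cons a L ih =>
      exact SE.prod (SE_Blk _ _ _ _ _ _ (fun n => by simp) (fun n => by simp)) ih

theorem SE_model (M : List ℕ) (χ : ℕ → ℕ) (o : Option (ℕ × List ℕ)) (ε : ℕ → F) :
    SE (NF (Tl F o) (nf χ ε M)) (NF (Tl K o) (nf χ (fun n => algebraMap F K (ε n)) M)) := by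
  induction M with
  | nil => exact SE_Tl o
  | cons a L ih =>
    unfold nf NF
    refine SE.prod ?_ ih
    dsimp only
    split_ifs
    · have := SE_W (F := F) (K := K) a (χ a) 0
      rwa [map_zero] at this
    · exact SE_W _ _ _

theorem SE.unique {X : FM.{u, v} F} {Y : FM.{u, w} K} {Y' : FM.{u, z} K} (h : SE X Y)
    (h' : SE X Y') : Iso Y Y' := by
  rw [SE_iff] at h h'
  obtain ⟨σ, h1, h2, n, b, h3, h4⟩ := h
  obtain ⟨σ', h1', h2', n', b', h3', h4'⟩ := h'
  rw [← semi_span σ' b'] at h4'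
  let bY := Basis.mk h3 h4.ge
  have hn : finrank K Y.V = finrank K Y'.V := by
    rw [finrank_eq_card_basis bY, ← finrank_eq_card_basis b, finrank_eq_card_basis b',
      ← finrank_eq_card_basis (Basis.mk h3' (by rw [← semi_span σ' b', h4']))]
  let e : Y.V →ₗ[K] Y'.V := bY.constr K fun i => σ' (b i)
  have heb : ∀ i, e (σ (b i)) = σ' (b i) := by
    intro i
    have : σ (b i) = bY i := by simp [bY]
    rw [this]
    exact bY.constr_basis K _ i
  have he : ∀ a, e (σ a) = σ' a := by
    intro a
    rw [semi_sum σ b a, semi_sum σ' b a, map_sum]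
    exact Finset.sum_congr rfl fun i _ => by rw [map_smul, heb]
  rw [← semi_span σ b] at h4
  have hsurj : Function.Surjective e := by
    rw [← LinearMap.range_eq_top, eq_top_iff, ← h4', Submodule.span_le]
    rintro _ ⟨a, rfl⟩
    exact ⟨σ a, he a⟩
  have hinj : Function.Injective e := (LinearMap.injective_iff_surjective_of_finrank_eq_finrank hn).2 hsurj
  have hB : ∀ a c, Y.B (σ a) (σ c) = Y'.B (σ' a) (σ' c) := by
    intro a c
    rw [Y.B_def, Y'.B_def, QuadraticMap.polar, QuadraticMap.polar, ← map_add, ← map_add, h1, h1,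
      h1, h1', h1', h1']
  have hB1 : ∀ y c, Y.B y (σ c) = Y'.B (e y) (σ' c) := by
    intro y c
    have hy : y ∈ Submodule.span K (Set.range σ) := by rw [h4]; trivial
    induction hy using Submodule.span_induction with
    | mem x hx => obtain ⟨a, rfl⟩ := hx; rw [he, hB]
    | zero => simp
    | add x y _ _ hx hy => rw [map_add, map_add, map_add, LinearMap.add_apply, LinearMap.add_apply, hx, hy]
    | smul r x _ hx => rw [map_smul, map_smul, map_smul, LinearMap.smul_apply, LinearMap.smul_apply, hx]
  have hB2 : ∀ y y', Y.B y y' = Y'.B (e y) (e y') := by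
    intro y y'
    have hy : y' ∈ Submodule.span K (Set.range σ) := by rw [h4]; trivial
    induction hy using Submodule.span_induction with
    | mem x hx => obtain ⟨a, rfl⟩ := hx; rw [he, hB1]
    | zero => simp
    | add x y _ _ hx hy => rw [map_add, map_add, map_add, hx, hy]
    | smul r x _ hx => rw [map_smul, map_smul, map_smul, hx]
  refine ⟨LinearEquiv.ofBijective e ⟨hinj, hsurj⟩, fun y => ?_, fun y => ?_⟩
  · change Y'.Q (e y) = Y.Q y
    have hy : y ∈ Submodule.span K (Set.range σ) := by rw [h4]; trivial
    induction hy using Submodule.span_induction with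
    | mem x hx => obtain ⟨a, rfl⟩ := hx; rw [he, h1, h1']
    | zero => simp
    | add x y _ _ hx hy => rw [map_add, FM.Q_add, FM.Q_add, hx, hy, hB2]
    | smul r x _ hx => rw [map_smul, FM.Q_smul, FM.Q_smul, hx]
  · change e (Y.T y) = Y'.T (e y)
    have hy : y ∈ Submodule.span K (Set.range σ) := by rw [h4]; trivial
    induction hy using Submodule.span_induction with
    | mem x hx => obtain ⟨a, rfl⟩ := hx; rw [he, ← h2, he, h2']
    | zero => simp
    | add x y _ _ hx hy => simp only [map_add, hx, hy]
    | smul r x _ hx => simp only [map_smul, hx]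

end ext

end FormMod

namespace FormMod

universe u v w z t

section sums
variable {F : Type u} [Field F] [Finite F] [CharP F 2]

open Classical in
/-- the additive character -/
noncomputable def psi (x : F) : ℤ := if ∃ c : F, c * c + c = x then 1 else -1

theorem psi_ne (x : F) : psi x ≠ 0 := by unfold psi; split_ifs <;> decide

theorem psi_sq (x : F) : psi x = 1 ∨ psi x = -1 := by unfold psi; split_ifs <;> simp

/-- the Artin-Schreier map -/
def asm (F : Type u) [Field F] [CharP F 2] : F →+ F where
  toFun x := x * x + x
  map_zero' := by simp
  map_add' x y := by
    have := CharTwo.two_eq_zero (R := F)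
    linear_combination (x * y) * this

theorem asm_index : (asm F).range.index = 2 := by
  have h1 := AddSubgroup.index_mul_card (asm F).range
  have h2 := AddSubgroup.index_mul_card (asm F).ker
  rw [AddSubgroup.index_ker] at h2
  have hk : Nat.card (asm F).ker = 2 := by
    have : ((asm F).ker : Set F) = {0, 1} := by
      ext x
      simp only [SetLike.mem_coe, AddMonoidHom.mem_ker, Set.mem_insert_iff, Set.mem_singleton_iff]
      change x * x + x = 0 ↔ _
      constructor
      · intro h
        have h' : x * (x + 1) = 0 := by linear_combination h
        rcases mul_eq_zero.1 h' with h | h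
        · exact Or.inl h
        · exact Or.inr (CharTwo.add_eq_zero.1 h)
      · rintro (rfl | rfl)
        · simp
        · rw [mul_one, CharTwo.add_self_eq_zero]
    change Nat.card ((asm F).ker : Set F) = 2
    rw [this, Nat.card_coe_set_eq, Set.ncard_pair zero_ne_one]
  rw [hk, ← h1] at h2
  have : 0 < Nat.card (asm F).range := Nat.card_pos
  nlinarith

theorem psi_eq (x : F) [Decidable (x ∈ (asm F).range)] :
    psi x = if x ∈ (asm F).range then 1 else -1 := by
  unfold psi
  by_cases h : x ∈ (asm F).range
  · rw [if_pos h, if_pos]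
    exact h
  · rw [if_neg h, if_neg]
    exact h

theorem psi_add (x y : F) : psi (x + y) = psi x * psi y := by
  classical
  rw [psi_eq, psi_eq, psi_eq]
  have := AddSubgroup.add_mem_iff_of_index_two (asm_index (F := F)) (a := x) (b := y)
  by_cases hx : x ∈ (asm F).range <;> by_cases hy : y ∈ (asm F).range <;> simp [hx, hy, this]

theorem psi_as (c : F) : psi (c * c + c) = 1 := if_pos ⟨c, rfl⟩

theorem psi_zero : psi (0 : F) = 1 := by
  have := psi_as (0 : F)
  simpa using this

theorem psi_mul_self (c : F) : psi (c * c) = psi c := by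
  have h := psi_add (c * c + c) c
  rw [psi_as, one_mul] at h
  rw [← h, add_assoc, CharTwo.add_self_eq_zero, add_zero]

theorem exists_neg : ∃ d : F, psi d = -1 := by
  by_contra hc
  push Not at hc
  have h1 : ∀ d : F, d ∈ (asm F).range := by
    classical
    intro d
    by_contra hd
    exact hc d (by rw [psi_eq, if_neg hd])
  have : (asm F).range = ⊤ := by
    rw [eq_top_iff]
    exact fun d _ => h1 d
  have h2 := asm_index (F := F)
  rw [this, AddSubgroup.index_top] at h2
  omega

theorem psi_triv {c : F} (h : ∀ x, psi (x * c) = 1) : c = 0 := by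
  by_contra hc
  obtain ⟨d, hd⟩ := exists_neg (F := F)
  have := h (d / c)
  rw [div_mul_cancel₀ _ hc, hd] at this
  omega

theorem char_sum {A : Type v} [AddCommGroup A] [Fintype A] (h : A → ℤ)
    (hm : ∀ a b, h (a + b) = h a * h b) :
    ∑ a, h a = if ∀ a, h a = 1 then (Fintype.card A : ℤ) else 0 := by
  split_ifs with hc
  · simp [hc]
  · push Not at hc
    obtain ⟨a, ha⟩ := hc
    have e : ∑ x, h x = h a * ∑ x, h x := by
      rw [Finset.mul_sum, ← Equiv.sum_comp (Equiv.addLeft a)]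
      exact Finset.sum_congr rfl fun x _ => hm a x
    have : (h a - 1) * ∑ x, h x = 0 := by linarith
    rcases mul_eq_zero.1 this with h1 | h1
    · exact absurd (by linarith) ha
    · exact h1

/-- exponential sums -/
noncomputable def SS (X : FM.{u, v} F) (a : ℕ) : ℤ := ∑ᶠ v : X.V, psi (X.Q ((X.T ^ a) v))

theorem SS_iso {X : FM.{u, v} F} {Y : FM.{u, w} F} (h : Iso X Y) (a : ℕ) : SS X a = SS Y a := by
  obtain ⟨g, hg⟩ := h.hom
  unfold SS
  rw [← finsum_comp_equiv g.toEquiv]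
  refine finsum_congr fun v => ?_
  rw [← hg.1, hg.tp]
  rfl

theorem SS_prod (X : FM.{u, v} F) (Y : FM.{u, w} F) (a : ℕ) :
    SS (X.prod Y) a = SS X a * SS Y a := by
  haveI : Finite X.V := Module.finite_of_finite F
  haveI : Finite Y.V := Module.finite_of_finite F
  letI := Fintype.ofFinite X.V
  letI := Fintype.ofFinite Y.V
  unfold SS
  rw [finsum_eq_sum_of_fintype, finsum_eq_sum_of_fintype, finsum_eq_sum_of_fintype,
    Fintype.sum_prod_type, Finset.sum_mul_sum]
  refine Finset.sum_congr rfl fun x _ => Finset.sum_congr rfl fun y _ => ?_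
  rw [FM.prod_tp, FM.prod_Q, psi_add]

theorem SS_pos {X : FM.{u, v} F} {a : ℕ} (h : ∀ v, X.Q ((X.T ^ a) v) = 0) : 0 < SS X a := by
  haveI : Finite X.V := Module.finite_of_finite F
  letI := Fintype.ofFinite X.V
  unfold SS
  rw [finsum_eq_sum_of_fintype, Finset.sum_congr rfl fun v _ => by rw [h v, psi_zero]]
  simp only [Finset.sum_const, Finset.card_univ, smul_eq_mul, mul_one, nsmul_eq_mul]
  have : 0 < Fintype.card X.V := Fintype.card_pos
  exact_mod_cast this

theorem SS_core {μ a : ℕ} (x y : ℕ → F) (δ : F)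
    (h1 : ∀ g : Fin μ → F, (∀ f : Fin μ → F,
      psi ((∑ i : Fin μ, f i * f i * (if i.1 + a < μ then x (i.1 + a) else 0)) +
        ∑ i : Fin μ, ∑ j : Fin μ, if i.1 + j.1 + 2 * a + 1 = μ then f i * g j else 0) = 1) →
      (∑ j : Fin μ, g j * g j * (if j.1 + a < μ then y (j.1 + a) else 0)) = δ)
    (h2 : ∃ g : Fin μ → F, (∀ f : Fin μ → F,
      psi ((∑ i : Fin μ, f i * f i * (if i.1 + a < μ then x (i.1 + a) else 0)) +
        ∑ i : Fin μ, ∑ j : Fin μ, if i.1 + j.1 + 2 * a + 1 = μ then f i * g j else 0) = 1)) :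
    ∃ N : ℤ, 0 < N ∧ SS (Blk μ μ x y) a = psi δ * N := by
  classical
  letI := Fintype.ofFinite F
  set A : (Fin μ → F) → F :=
    fun g => ∑ j : Fin μ, g j * g j * (if j.1 + a < μ then y (j.1 + a) else 0) with hA
  set P : (Fin μ → F) → (Fin μ → F) → F := fun f g =>
    (∑ i : Fin μ, f i * f i * (if i.1 + a < μ then x (i.1 + a) else 0)) +
        ∑ i : Fin μ, ∑ j : Fin μ, if i.1 + j.1 + 2 * a + 1 = μ then f i * g j else 0 with hP
  have hPadd : ∀ f f' g, P (f + f') g = P f g + P f' g := by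
    intro f f' g
    have e1 : ∀ i : Fin μ, (f + f') i * (f + f') i * (if i.1 + a < μ then x (i.1 + a) else 0) =
        f i * f i * (if i.1 + a < μ then x (i.1 + a) else 0) +
        f' i * f' i * (if i.1 + a < μ then x (i.1 + a) else 0) := by
      intro i
      rw [Pi.add_apply]
      have := CharTwo.two_eq_zero (R := F)
      linear_combination (f i * f' i * (if i.1 + a < μ then x (i.1 + a) else 0)) * this
    have e2 : ∀ i j : Fin μ, (if i.1 + j.1 + 2 * a + 1 = μ then (f + f') i * g j else 0) =
        (if i.1 + j.1 + 2 * a + 1 = μ then f i * g j else 0) +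
        (if i.1 + j.1 + 2 * a + 1 = μ then f' i * g j else 0) := by
      intro i j
      split_ifs
      · rw [Pi.add_apply, add_mul]
      · rw [add_zero]
    rw [hP]
    simp only [e1, e2, Finset.sum_add_distrib]
    ring
  have hS : SS (Blk μ μ x y) a = ∑ g : Fin μ → F, psi (A g) *
      (if ∀ f, psi (P f g) = 1 then (Fintype.card (Fin μ → F) : ℤ) else 0) := by
    unfold SS
    rw [finsum_eq_sum_of_fintype (α := (Fin μ → F) × (Fin μ → F)), Fintype.sum_prod_type, Finset.sum_comm]
    refine Finset.sum_congr rfl fun g _ => ?_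
    rw [← char_sum (fun f => psi (P f g)) (fun f f' => by rw [hPadd, psi_add]), Finset.mul_sum]
    refine Finset.sum_congr rfl fun f _ => ?_
    rw [Blk_Q_tp le_rfl, ← psi_add]
    congr 1
    rw [hP, hA]
    ring
  refine ⟨∑ g : Fin μ → F,
      (if ∀ f, psi (P f g) = 1 then (Fintype.card (Fin μ → F) : ℤ) else 0), ?_, ?_⟩
  · obtain ⟨g, hg⟩ := h2
    have hc : (0 : ℤ) < (Fintype.card (Fin μ → F) : ℤ) := by
      exact_mod_cast Fintype.card_pos
    refine Finset.sum_pos' (fun g _ => ?_) ⟨g, Finset.mem_univ _, ?_⟩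
    · split_ifs
      · exact hc.le
      · exact le_rfl
    · rw [if_pos hg]
      exact hc
  · rw [hS, Finset.mul_sum]
    refine Finset.sum_congr rfl fun g _ => ?_
    split_ifs with hg
    · have hAg : A g = δ := h1 g hg
      rw [hAg]
    · simp

theorem SS_W {μ l a : ℕ} (δ : F) (h0 : 1 ≤ μ) (h1 : μ ≤ 2 * l) (h2 : l ≤ μ) (ha : a ≤ μ - l)
    (hδ : μ < 2 * l ∨ δ = 0) : ∃ N : ℤ, 0 < N ∧ SS (W μ l δ) a = psi δ * N := by
  classical
  by_cases h3 : μ < 2 * l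
  · let i0 : Fin μ := ⟨l - 1 - a, by omega⟩
    let j0 : Fin μ := ⟨μ - l - a, by omega⟩
    have hx : ∀ f : Fin μ → F,
        (∑ i : Fin μ, f i * f i * (if i.1 + a < μ then wx F μ l (i.1 + a) else 0)) =
          f i0 * f i0 := by
      intro f
      rw [Finset.sum_eq_single i0]
      · rw [if_pos (by simp only [i0]; omega), wx, if_pos (by simp only [i0]; omega), mul_one]
      · intro i _ hi
        have : i.1 ≠ l - 1 - a := fun h => hi (Fin.ext h)
        unfold wx
        rw [if_neg (fun h => by omega : ¬ (i.1 + a + 1 = l ∧ μ < 2 * l))]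
        simp
      · simp
    have hy : ∀ g : Fin μ → F,
        (∑ j : Fin μ, g j * g j * (if j.1 + a < μ then wy μ l δ (j.1 + a) else 0)) =
          g j0 * g j0 * δ := by
      intro g
      rw [Finset.sum_eq_single j0]
      · rw [if_pos (by simp only [j0]; omega), wy, if_pos (by simp only [j0]; omega)]
      · intro i _ hi
        have : i.1 ≠ μ - l - a := fun h => hi (Fin.ext h)
        unfold wy
        rw [if_neg (fun h => by omega : ¬ (i.1 + a + l = μ ∧ μ < 2 * l))]
        simp
      · simp
    apply SS_core
    · intro g hg
      rw [hy]
      have : 1 + g j0 = 0 := by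
        apply psi_triv
        intro c
        have := hg (fun i => if i = i0 then c else 0)
        rw [hx, Finset.sum_eq_single i0, Finset.sum_eq_single j0] at this
        · rw [if_pos rfl, if_pos (by simp only [i0, j0]; omega), psi_add, psi_mul_self, ← psi_add]
            at this
          rw [← this]
          congr 1
          ring
        · intro j _ hj
          have : j.1 ≠ μ - l - a := fun h => hj (Fin.ext h)
          rw [if_neg (by simp only [i0]; omega)]
        · simp
        · intro i _ hi
          refine Finset.sum_eq_zero fun j _ => ?_
          rw [if_neg hi]; simp
        · simp
      have h5 : g j0 = 1 := (CharTwo.add_eq_zero.1 this).symm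
      rw [h5]; ring
    · refine ⟨fun j => if j = j0 then 1 else 0, fun f => ?_⟩
      rw [hx, Finset.sum_eq_single i0, Finset.sum_eq_single j0]
      · rw [if_pos (by simp only [i0, j0]; omega)]
        beta_reduce
        rw [if_pos rfl, mul_one, psi_as]
      · intro j _ hj
        beta_reduce
        rw [if_neg hj]; simp
      · simp
      · intro i _ hi
        have : i.1 ≠ l - 1 - a := fun h => hi (Fin.ext h)
        refine Finset.sum_eq_zero fun j _ => ?_
        by_cases hj : j = j0
        · subst hj
          rw [if_neg (by simp only [j0]; omega)]
        · beta_reduce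
          rw [if_neg hj]; simp
      · simp
  · have hδ0 : δ = 0 := hδ.resolve_left h3
    subst hδ0
    apply SS_core
    · intro g _
      refine Finset.sum_eq_zero fun j _ => ?_
      unfold wy; simp
    · refine ⟨fun _ => 0, fun f => ?_⟩
      rw [Finset.sum_eq_zero, Finset.sum_eq_zero, add_zero, psi_zero]
      · intro i _
        exact Finset.sum_eq_zero fun j _ => by simp
      · intro i _
        unfold wx
        rw [if_neg (fun h => h3 h.2 : ¬ (i.1 + a + 1 = l ∧ μ < 2 * l))]
        simp

/-- expected sign -/
noncomputable def sg (μ0 : ℕ) (L : List (ℕ × ℕ × F)) : ℤ :=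
  (L.map fun t => if μ0 ≤ t.1 then psi t.2.2 else 1).prod

theorem sg_ne (μ0 : ℕ) (L : List (ℕ × ℕ × F)) : sg μ0 L = 1 ∨ sg μ0 L = -1 := by
  induction L with
  | nil => left; rfl
  | cons t L ih =>
    have : sg μ0 (t :: L) = (if μ0 ≤ t.1 then psi t.2.2 else 1) * sg μ0 L := by
      unfold sg; simp
    rw [this]
    have h2 : (if μ0 ≤ t.1 then psi t.2.2 else 1) = 1 ∨ (if μ0 ≤ t.1 then psi t.2.2 else 1) = -1 := by
      split_ifs
      · exact psi_sq _
      · exact Or.inl rfl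
    rcases h2 with h | h <;> rcases ih with h' | h' <;> rw [h, h'] <;> simp

theorem SS_NF {R : FM.{u, u} F} {a μ0 : ℕ} (hR : 0 < SS R a) (χ : ℕ → ℕ) (ε : ℕ → F) (L : List ℕ)
    (hb : ∀ μ ∈ L, 1 ≤ μ ∧ μ ≤ 2 * χ μ ∧ χ μ ≤ μ) (hε : ∀ μ ∈ L, μ < 2 * χ μ ∨ ε μ = 0)
    (h1 : ∀ μ ∈ L, μ0 ≤ μ → a ≤ μ - χ μ) (h2 : ∀ μ ∈ L, μ < μ0 → χ μ ≤ a) :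
    ∃ N : ℤ, 0 < N ∧ SS (NF R (nf χ ε L)) a = sg μ0 (nf χ ε L) * N := by
  induction L with
  | nil => exact ⟨SS R a, hR, by simp [nf, NF, sg]⟩
  | cons μ L ih =>
    obtain ⟨N, hN, e⟩ := ih (fun ν hν => hb ν (List.mem_cons_of_mem _ hν))
      (fun ν hν => hε ν (List.mem_cons_of_mem _ hν))
      (fun ν hν => h1 ν (List.mem_cons_of_mem _ hν)) (fun ν hν => h2 ν (List.mem_cons_of_mem _ hν))
    obtain ⟨b1, b2, b3⟩ := hb μ List.mem_cons_self
    have hW : ∃ N' : ℤ, 0 < N' ∧ SS (W μ (χ μ) (if μ ∈ L then 0 else ε μ)) a =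
        (if μ0 ≤ μ then psi (if μ ∈ L then 0 else ε μ) else 1) * N' := by
      by_cases hc : μ0 ≤ μ
      · rw [if_pos hc]
        refine SS_W _ b1 b2 b3 (h1 μ List.mem_cons_self hc) ?_
        split_ifs
        · exact Or.inr rfl
        · exact hε μ List.mem_cons_self
      · rw [if_neg hc]
        refine ⟨_, SS_pos (X := W μ (χ μ) (if μ ∈ L then 0 else ε μ)) (a := a) fun v => ?_,
          (one_mul _).symm⟩
        have h5 := h2 μ List.mem_cons_self (by omega)
        refine AA_W (p := μ) (j := a) _ b2 (by omega) v ?_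
        rw [show (W μ (χ μ) (if μ ∈ L then 0 else ε μ)).T ^ μ = 0 from by
          have := Blk_nil μ μ (wx F μ (χ μ)) (wy μ (χ μ) (if μ ∈ L then 0 else ε μ))
          rwa [max_self] at this]
        rfl
    obtain ⟨N', hN', e'⟩ := hW
    refine ⟨N' * N, mul_pos hN' hN, ?_⟩
    unfold nf NF
    rw [SS_prod, e]
    have : ∀ t : ℕ × ℕ × F, sg μ0 (t :: nf χ ε L) =
        (if μ0 ≤ t.1 then psi t.2.2 else 1) * sg μ0 (nf χ ε L) := fun t => by
      unfold sg; simp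
    rw [this]
    dsimp only
    rw [e']
    ring

theorem sg_compare (μ0 : ℕ) (χ : ℕ → ℕ) (ε ε' : ℕ → F) (h : ∀ μ, μ0 < μ → psi (ε μ) = psi (ε' μ))
    (L : List ℕ) :
    (μ0 ∉ L → sg μ0 (nf χ ε L) = sg μ0 (nf χ ε' L)) ∧
    (μ0 ∈ L → sg μ0 (nf χ ε L) * psi (ε' μ0) = sg μ0 (nf χ ε' L) * psi (ε μ0)) := by
  have hc : ∀ (t : ℕ × ℕ × F) L, sg μ0 (t :: L) =
        (if μ0 ≤ t.1 then psi t.2.2 else 1) * sg μ0 L := fun t L => by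
      unfold sg; simp
  induction L with
  | nil => exact ⟨fun _ => rfl, fun h => by simp at h⟩
  | cons μ L ih =>
    have key : μ ≠ μ0 ∨ μ0 ∈ L → (if μ0 ≤ μ then psi (if μ ∈ L then 0 else ε μ) else 1) =
        (if μ0 ≤ μ then psi (if μ ∈ L then 0 else ε' μ) else 1) := by
      intro hh
      by_cases h1 : μ0 ≤ μ
      · rw [if_pos h1, if_pos h1]
        by_cases h2 : μ ∈ L
        · rw [if_pos h2, if_pos h2]
        · rw [if_neg h2, if_neg h2]
          apply h
          rcases hh with hh | hh
          · omega
          · rcases Nat.eq_or_lt_of_le h1 with h3 | h3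
            · subst h3; exact absurd hh h2
            · exact h3
      · rw [if_neg h1, if_neg h1]
    unfold nf
    rw [hc, hc]
    dsimp only
    constructor
    · intro hn
      rw [List.mem_cons, not_or] at hn
      rw [key (Or.inl fun h => hn.1 h.symm), ih.1 hn.2]
    · intro hm
      by_cases h0 : μ0 ∈ L
      · have := ih.2 h0
        rw [key (Or.inr h0), mul_assoc, this, mul_assoc]
      · have h1 : μ0 = μ := (List.mem_cons.1 hm).resolve_right h0
        subst h1
        rw [if_pos le_rfl, if_pos le_rfl, if_neg h0, if_neg h0, ih.1 h0]
        ring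

theorem model_inj {M : List ℕ} {χ : ℕ → ℕ} {o : Option (ℕ × List ℕ)} (hv : Valid M χ o)
    {ε ε' : ℕ → F} (h1 : ∀ μ, ε μ ≠ 0 → IsBrk M χ o μ) (h2 : ∀ μ, ε' μ ≠ 0 → IsBrk M χ o μ)
    (hi : Iso (NF (Tl F o) (nf χ ε M)) (NF (Tl F o) (nf χ ε' M))) :
    ∀ μ, psi (ε μ) = psi (ε' μ) := by
  classical
  by_contra hc
  push Not at hc
  obtain ⟨μ1, hμ1⟩ := hc
  have hbrk : ∀ μ, psi (ε μ) ≠ psi (ε' μ) → IsBrk M χ o μ := by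
    intro μ hμ
    by_cases h : ε μ = 0
    · apply h2
      intro h'
      apply hμ
      rw [h, h']
    · exact h1 _ h
  let Sf := M.toFinset.filter fun μ => psi (ε μ) ≠ psi (ε' μ)
  have hne : Sf.Nonempty := ⟨μ1, by
    rw [Finset.mem_filter, List.mem_toFinset]
    exact ⟨(hbrk _ hμ1).mem, hμ1⟩⟩
  obtain ⟨μ0, hμ0, hmax⟩ := Finset.exists_max_image Sf id hne
  rw [Finset.mem_filter] at hμ0
  have hB := hbrk _ hμ0.2
  have hmax' : ∀ μ, μ0 < μ → psi (ε μ) = psi (ε' μ) := by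
    intro μ hlt
    by_contra hh
    have := hmax μ (by
      rw [Finset.mem_filter, List.mem_toFinset]
      exact ⟨(hbrk _ hh).mem, hh⟩)
    simp only [id] at this
    omega
  have hR : 0 < SS (Tl F o) (μ0 - χ μ0) := by
    apply SS_pos
    intro v
    rw [Tl_tpow o]
    · simp
    · intro p hp
      have := hB.tl p hp
      omega
    · intro p hp ν hν
      have := hB.tl p hp
      have := (hv.nu p hp ν hν).2
      omega
  have c1 : ∀ μ ∈ M, μ0 ≤ μ → μ0 - χ μ0 ≤ μ - χ μ := by
    intro μ hμ hle
    have a1 := hv.cl μ hμ μ0 hB.mem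
    have a2 := hv.blk μ hμ
    have a3 := hv.blk μ0 hB.mem
    omega
  have c2 : ∀ μ ∈ M, μ < μ0 → χ μ ≤ μ0 - χ μ0 := by
    intro μ hμ hlt
    have := hB.sm μ hμ hlt
    omega
  have c3 : ∀ (η : ℕ → F), (∀ μ, η μ ≠ 0 → IsBrk M χ o μ) → ∀ μ ∈ M, μ < 2 * χ μ ∨ η μ = 0 := by
    intro η hη μ _
    by_cases h : η μ = 0
    · exact Or.inr h
    · exact Or.inl (hη μ h).lt
  obtain ⟨N, hN, e⟩ := SS_NF (μ0 := μ0) hR χ ε M hv.blk (c3 ε h1) c1 c2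
  obtain ⟨N', hN', e'⟩ := SS_NF (μ0 := μ0) hR χ ε' M hv.blk (c3 ε' h2) c1 c2
  rw [SS_iso hi, e'] at e
  have hcmp := (sg_compare μ0 χ ε ε' hmax' M).2 hB.mem
  have hs : sg μ0 (nf χ ε M) = sg μ0 (nf χ ε' M) := by
    rcases sg_ne μ0 (nf χ ε M) with h | h <;> rcases sg_ne μ0 (nf χ ε' M) with h' | h' <;>
      rw [h, h'] at e ⊢ <;> exfalso <;> linarith
  apply hμ0.2
  rw [hs] at hcmp
  have hs0 : sg μ0 (nf χ ε' M) ≠ 0 := by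
    rcases sg_ne μ0 (nf χ ε' M) with h | h <;> rw [h] <;> decide
  exact (mul_left_cancel₀ hs0 hcmp).symm

end sums

end FormMod

namespace FormMod

universe u v w z t

section conv
variable {k : Type u} [Field k]

theorem mem_rad (X : FM.{u, v} k) (a : X.V) : a ∈ X.Q.polarRadical ↔ ∀ b, X.B a b = 0 := by
  unfold QuadraticForm.polarRadical
  rw [LinearMap.mem_ker]
  constructor
  · intro h b
    exact congrArg (fun f => f b) h
  · intro h
    ext b
    exact h b

theorem adm_of (X : FM.{u, v} k) (h1 : X.Q.IsNondegenerateFormSpace) (h2 : X.Q.mem_oLie X.T)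
    (h3 : IsNilpotent X.T) : X.Adm := by
  refine ⟨fun a => h2.1 a, h3, fun a ha hq => ?_⟩
  by_contra h0
  exact h1.2.2 a ((mem_rad X a).2 ha) h0 hq

theorem rad_bot (X : FM.{u, v} k) : X.Q.polarRadical = ⊥ ↔ X.Nondef := by
  rw [Submodule.eq_bot_iff]
  constructor
  · intro h a ha
    exact h a ((mem_rad X a).2 ha)
  · intro h a ha
    exact h a ((mem_rad X a).1 ha)

variable [CharP k 2]

theorem adm_conv (hsq : ∀ x : k, ∃ y, y * y = x) (X : FM.{u, v} k) (hX : X.Adm)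
    (hn : Nontrivial X.V) :
    X.Q.IsNondegenerateFormSpace ∧ X.Q.mem_oLie X.T ∧ IsNilpotent X.T := by
  refine ⟨⟨hn, ?_, fun a ha h0 hq => h0 (hX.rad a ((mem_rad X a).1 ha) hq)⟩, ⟨fun a => hX.alt a, ?_⟩,
    hX.nil⟩
  · by_cases h : X.Q.polarRadical = ⊥
    · rw [h, finrank_bot]; omega
    · obtain ⟨b, hb, hb0⟩ := (Submodule.ne_bot_iff _).1 h
      refine finrank_le_one (⟨b, hb⟩ : X.Q.polarRadical) fun a => ?_
      obtain ⟨s, hs⟩ := rad_unique hsq hX ((mem_rad X a.1).1 a.2) ((mem_rad X b).1 hb) hb0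
      exact ⟨s, Subtype.ext hs.symm⟩
  · exact (LinearMap.isNilpotent_trace_of_isNilpotent hX.nil).eq_zero

end conv

section fin
variable {F : Type u} [Field F]

/-- coordinates -/
@[reducible] noncomputable def mk {n : ℕ} (p : QuadraticForm F (Fin n → F) × Module.End F (Fin n → F)) :
    FM.{u, u} F := { V := Fin n → F, Q := p.1, T := p.2 }

theorem exists_mk (X : FM.{u, v} F) {n : ℕ} (h : finrank F X.V = n) :
    ∃ p : QuadraticForm F (Fin n → F) × Module.End F (Fin n → F), Iso (mk p) X := by
  have e : (Fin n → F) ≃ₗ[F] X.V := LinearEquiv.ofFinrankEq _ _ (by rw [h]; simp)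
  refine ⟨(X.Q.comp e.toLinearMap, e.symm.toLinearMap ∘ₗ X.T ∘ₗ e.toLinearMap), e, fun a => rfl,
    fun a => ?_⟩
  change e (e.symm (X.T (e a))) = X.T (e a)
  simp

theorem nf_congr2 {χ χ' : ℕ → ℕ} (ε : ℕ → F) (M : List ℕ) (h : ∀ μ ∈ M, χ μ = χ' μ) :
    nf χ ε M = nf χ' ε M := by
  induction M with
  | nil => rfl
  | cons μ M ih =>
    unfold nf
    rw [ih (fun ν hν => h ν (List.mem_cons_of_mem _ hν)), h μ List.mem_cons_self]

theorem IsBrk.congr {M : List ℕ} {χ χ' : ℕ → ℕ} {o o' : Option (ℕ × List ℕ)} {μ : ℕ}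
    (h : IsBrk M χ' o' μ) (hχ : ∀ ν ∈ M, χ ν = χ' ν)
    (ho : (o = none ∧ o' = none) ∨
      ∃ m νs νs', o = some (m, νs) ∧ o' = some (m, νs') ∧ νs.Perm νs') : IsBrk M χ o μ := by
  refine ⟨h.mem, ?_, fun ν h1 h2 => ?_, fun p hp => ?_⟩
  · rw [hχ μ h.mem]; exact h.lt
  · rw [hχ μ h.mem, hχ ν h1]; exact h.sm ν h1 h2
  · rw [hχ μ h.mem]
    rcases ho with ⟨rfl, _⟩ | ⟨m, νs, νs', rfl, rfl, _⟩
    · simp at hp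
    · obtain rfl : (m, νs) = p := by simpa using hp
      exact h.tl (m, νs') rfl

variable [Finite F] [CharP F 2] {K : Type u} [Field K] [Algebra F K] [CharP K 2] [IsAlgClosed K]

theorem as_closed (x : K) : ∃ c : K, x = c * c + c := by
  obtain ⟨c, hc⟩ := IsAlgClosed.exists_root
    (Polynomial.X ^ 2 + Polynomial.X + Polynomial.C x : Polynomial K) (by
      have : (Polynomial.X ^ 2 + Polynomial.X + Polynomial.C x : Polynomial K).degree = 2 := by
        compute_degree!
      rw [this]; decide)
  refine ⟨c, ?_⟩
  simp only [Polynomial.IsRoot, Polynomial.eval_add, Polynomial.eval_pow, Polynomial.eval_X,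
    Polynomial.eval_C] at hc
  rw [← pow_two]
  exact (CharTwo.add_eq_zero.1 hc).symm

theorem sq_fin (x : F) : ∃ y, y * y = x := by
  obtain ⟨y, hy⟩ := FiniteField.isSquare_of_char_two (CharP.ringChar_of_prime_eq_zero Nat.prime_two
    (by exact_mod_cast CharTwo.two_eq_zero (R := F))) x
  exact ⟨y, hy.symm⟩

theorem sq_closed (x : K) : ∃ y, y * y = x := by
  obtain ⟨y, hy⟩ := IsAlgClosed.exists_eq_mul_self x
  exact ⟨y, hy.symm⟩

theorem model_zero {M : List ℕ} {χ : ℕ → ℕ} {o : Option (ℕ × List ℕ)} (hv : Valid M χ o)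
    {ε : ℕ → K} (h : ∀ μ, ε μ ≠ 0 → IsBrk M χ o μ) :
    Iso (NF (Tl K o) (nf χ ε M)) (NF (Tl K o) (nf χ (fun _ => 0) M)) := by
  refine nf_change _ χ ε (fun _ => 0) M hv.blk fun μ _ => ?_
  by_cases h0 : ε μ = 0
  · exact Or.inl h0.symm
  · right
    refine ⟨(h μ h0).lt, ?_⟩
    obtain ⟨c, hc⟩ := as_closed (ε μ)
    exact ⟨c, by rw [← hc, CharTwo.add_self_eq_zero]⟩

theorem model_change {M : List ℕ} {χ : ℕ → ℕ} {o : Option (ℕ × List ℕ)} (hv : Valid M χ o)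
    {ε ε' : ℕ → F} (h : ∀ μ, ε μ ≠ 0 → IsBrk M χ o μ) (h' : ∀ μ, ε' μ ≠ 0 → IsBrk M χ o μ)
    (hp : ∀ μ, psi (ε μ) = psi (ε' μ)) :
    Iso (NF (Tl F o) (nf χ ε M)) (NF (Tl F o) (nf χ ε' M)) := by
  refine nf_change _ χ ε ε' M hv.blk fun μ _ => ?_
  by_cases h0 : ε μ = 0 ∧ ε' μ = 0
  · exact Or.inl (by rw [h0.1, h0.2])
  · right
    have hb : IsBrk M χ o μ := by
      by_cases h1 : ε μ = 0
      · exact h' μ fun h2 => h0 ⟨h1, h2⟩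
      · exact h μ h1
    refine ⟨hb.lt, ?_⟩
    have h1 : psi (ε μ + ε' μ) = 1 := by
      rw [psi_add, hp μ]
      rcases psi_sq (ε' μ) with e | e <;> rw [e] <;> rfl
    unfold psi at h1
    split_ifs at h1 with h2
    obtain ⟨c, hc⟩ := h2
    refine ⟨c, ?_⟩
    rw [hc, ← add_assoc, CharTwo.add_self_eq_zero, zero_add]

theorem Tl_congr {o o' : Option (ℕ × List ℕ)} (ho : (o = none ∧ o' = none) ∨
      ∃ m νs νs', o = some (m, νs) ∧ o' = some (m, νs') ∧ νs.Perm νs') :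
    Iso (Tl F o') (Tl F o) := by
  rcases ho with ⟨rfl, rfl⟩ | ⟨m, νs, νs', rfl, rfl, h⟩
  · exact Iso.refl _
  · exact hs_perm (D F m) h.symm

open Classical in
theorem count {X : FM.{u, v} K} {M : List ℕ} {χ : ℕ → ℕ} {o : Option (ℕ × List ℕ)}
    (hn : Nontrivial X.V) (hv : Valid M χ o) (h : Iso X (NF (Tl K o) (nf χ (fun _ => 0) M))) {n : ℕ}
    (hd : finrank K X.V = n)
    (P : QuadraticForm F (Fin n → F) × Module.End F (Fin n → F) → Prop)
    (hP : ∀ p, P p ↔ (p.1.IsNondegenerateFormSpace ∧ p.1.mem_oLie p.2 ∧ IsNilpotent p.2 ∧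
      SE (mk p) X)) :
    Nat.card (Quot fun p q : {p // P p} => Iso (mk p.1) (mk q.1)) =
      2 ^ (M.toFinset.filter (IsBrk M χ o)).card := by
  obtain ⟨d, hdn⟩ := exists_neg (F := F)
  have hd0 : d ≠ 0 := by
    rintro rfl
    rw [psi_zero] at hdn
    omega
  set S := M.toFinset.filter (IsBrk M χ o) with hS
  have hSm : ∀ μ, μ ∈ S ↔ IsBrk M χ o μ := fun μ => by
    rw [hS, Finset.mem_filter, List.mem_toFinset]
    exact ⟨fun h => h.2, fun h => ⟨h.mem, h⟩⟩
  let E : (S → Bool) → ℕ → F := fun s μ =>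
    if h : μ ∈ S then (if s ⟨μ, h⟩ = true then d else 0) else 0
  have hE : ∀ s μ, E s μ ≠ 0 → IsBrk M χ o μ := by
    intro s μ h
    by_contra hc
    apply h
    simp only [E]
    rw [dif_neg (fun h => hc ((hSm μ).1 h))]
  have hex : ∀ s, ∃ p : {p // P p}, Iso (mk p.1) (NF (Tl F o) (nf χ (E s) M)) := by
    intro s
    have a1 : SE (NF (Tl F o) (nf χ (E s) M))
      (NF (Tl K o) (nf χ (fun n => algebraMap F K (E s n)) M)) := SE_model M χ o (E s)
    have a2 : Iso (NF (Tl K o) (nf χ (fun n => algebraMap F K (E s n)) M))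
        (NF (Tl K o) (nf χ (fun _ => 0) M)) :=
      model_zero hv fun μ h => hE s μ fun h0 => h (by rw [h0, map_zero])
    have a3 : SE (NF (Tl F o) (nf χ (E s) M)) X := a1.iso_right (a2.trans h.symm)
    obtain ⟨p, hp⟩ := exists_mk (NF (Tl F o) (nf χ (E s) M)) (n := n) (by
      obtain ⟨_, _, _, _, h4⟩ := a3
      rw [← h4, hd])
    have a4 : (mk p).Adm := hp.symm.adm (NF_adm (Tl_adm o) _)
    have hn' : Nontrivial (mk p).V := by
      have : 0 < finrank K X.V := finrank_pos
      haveI : Nonempty (Fin n) := ⟨⟨0, by omega⟩⟩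
      exact (inferInstance : Nontrivial (Fin n → F))
    obtain ⟨b1, b2, b3⟩ := adm_conv sq_fin (mk p) a4 hn'
    exact ⟨⟨p, (hP p).2 ⟨b1, b2, b3, a3.iso_left hp.symm⟩⟩, hp⟩
  choose f hf using hex
  have hb : Function.Bijective fun s : S → Bool =>
      (Quot.mk _ (f s) : Quot fun p q : {p // P p} => Iso (mk p.1) (mk q.1)) := by
    constructor
    · intro s s' hss
      have heq : Equivalence fun p q : {p // P p} => Iso (mk p.1) (mk q.1) :=
        ⟨fun p => Iso.refl _, fun h => h.symm, fun h h' => h.trans h'⟩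
      have h1 : Iso (mk (f s).1) (mk (f s').1) := heq.eqvGen_iff.1 (Quot.eqvGen_exact hss)
      have h2 := model_inj hv (hE s) (hE s') ((hf s).symm.trans (h1.trans (hf s')))
      funext ⟨μ, hμ⟩
      have h3 := h2 μ
      simp only [E] at h3
      rw [dif_pos hμ, dif_pos hμ] at h3
      cases e1 : s ⟨μ, hμ⟩ <;> cases e2 : s' ⟨μ, hμ⟩ <;> simp [e1, e2, hdn, psi_zero] at h3 ⊢
    · intro x
      induction x using Quot.ind with
      | mk p =>
        obtain ⟨b1, b2, b3, b4⟩ := (hP p.1).1 p.2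
        have hA : (mk p.1).Adm := adm_of _ b1 b2 b3
        obtain ⟨M0, χ0, o0, ε0, hv0, hε0, hi0⟩ := normal_form sq_fin _ hA
        have c1 : SE (NF (Tl F o0) (nf χ0 ε0 M0))
          (NF (Tl K o0) (nf χ0 (fun n => algebraMap F K (ε0 n)) M0)) := SE_model M0 χ0 o0 ε0
        have c2 : Iso X (NF (Tl K o0) (nf χ0 (fun n => algebraMap F K (ε0 n)) M0)) :=
          b4.unique (c1.iso_left hi0.symm)
        obtain ⟨e, hχ, ho⟩ := iso_skel hv hv0 h c2
        subst e
        have c3 : Iso (mk p.1) (NF (Tl F o) (nf χ ε0 M)) := by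
          rw [nf_congr2 ε0 M hχ]
          exact hi0.trans (NF_congr (Tl_congr ho) _)
        have c4 : ∀ μ, ε0 μ ≠ 0 → IsBrk M χ o μ := fun μ hμ => (hε0 μ hμ).congr hχ ho
        let s : S → Bool := fun μ => decide (psi (ε0 μ.1) = -1)
        refine ⟨s, Quot.sound ?_⟩
        refine (hf s).trans (Iso.trans ?_ c3.symm)
        refine model_change hv (hE s) c4 fun μ => ?_
        simp only [E, s]
        by_cases hμ : μ ∈ S
        · rw [dif_pos hμ]
          rcases psi_sq (ε0 μ) with e | e <;> simp [e, hdn, psi_zero]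
        · rw [dif_neg hμ]
          have : ε0 μ = 0 := by
            by_contra h0
            exact hμ ((hSm μ).2 (c4 μ h0))
          rw [this]
  rw [← Nat.card_eq_of_bijective _ hb]
  simp

end fin

end FormMod

/-- Let `(V̄, Q̄, T̄)` be a form module over the algebraic closure `K` of a finite field `F` of
characteristic 2, with symbol `(λ_i, χ_i, m_i)_{1 ≤ i ≤ k}`.  The number of isomorphism
classes of form modules over `F` whose scalar extension to `K` is isomorphic to
`(V̄, T̄)` equals `2^{n₁}` if `V̄` is defective, and `2^{n₂}` if `V̄` is non-defective. -/
theorem card_rational_classes_of_form_module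
    (F : Type*) [Field F] [Fintype F] [CharP F 2]
    (V' : Type*) [AddCommGroup V'] [Module (AlgebraicClosure F) V']
    [FiniteDimensional (AlgebraicClosure F) V']
    (Q' : QuadraticForm (AlgebraicClosure F) V') (T' : Module.End (AlgebraicClosure F) V')
    (hQ' : Q'.IsNondegenerateFormSpace) (hT' : Q'.mem_oLie T') (hT'nil : IsNilpotent T')
    (k : ℕ) (lam mult chi : ℕ → ℕ) (hsymb : Q'.IsSymbolOf T' k lam mult chi) :
    (Q'.polarRadical ≠ ⊥ →
      Nat.card (Quot fun p q :
          {p : QuadraticForm F (Fin (Module.finrank (AlgebraicClosure F) V') → F) ×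
              Module.End F (Fin (Module.finrank (AlgebraicClosure F) V') → F) //
            p.1.IsNondegenerateFormSpace ∧ p.1.mem_oLie p.2 ∧ IsNilpotent p.2 ∧
            QuadraticForm.IsScalarExtension p.1 p.2 Q' T'} =>
        ∃ g : (Fin (Module.finrank (AlgebraicClosure F) V') → F) ≃ₗ[F]
            (Fin (Module.finrank (AlgebraicClosure F) V') → F),
          (∀ v, (q.1).1 (g v) = (p.1).1 v) ∧ ∀ v, g ((p.1).2 v) = (q.1).2 (g v)) =
        2 ^ symbolN1 k lam chi) ∧
    (Q'.polarRadical = ⊥ →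
      Nat.card (Quot fun p q :
          {p : QuadraticForm F (Fin (Module.finrank (AlgebraicClosure F) V') → F) ×
              Module.End F (Fin (Module.finrank (AlgebraicClosure F) V') → F) //
            p.1.IsNondegenerateFormSpace ∧ p.1.mem_oLie p.2 ∧ IsNilpotent p.2 ∧
            QuadraticForm.IsScalarExtension p.1 p.2 Q' T'} =>
        ∃ g : (Fin (Module.finrank (AlgebraicClosure F) V') → F) ≃ₗ[F]
            (Fin (Module.finrank (AlgebraicClosure F) V') → F),
          (∀ v, (q.1).1 (g v) = (p.1).1 v) ∧ ∀ v, g ((p.1).2 v) = (q.1).2 (g v)) =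
        2 ^ symbolN2 k lam chi) := by
  classical
  haveI : CharP (AlgebraicClosure F) 2 :=
    charP_of_injective_algebraMap (algebraMap F (AlgebraicClosure F)).injective 2
  let X : FormMod.FM (AlgebraicClosure F) := { V := V', Q := Q', T := T' }
  have hX : X.Adm := FormMod.adm_of X hQ' hT' hT'nil
  obtain ⟨M, χ, o, ε, hv, hε, hi⟩ := FormMod.normal_form FormMod.sq_closed X hX
  have hi0 : FormMod.Iso X (FormMod.NF (FormMod.Tl (AlgebraicClosure F) o)
    (FormMod.nf χ (fun _ => 0) M)) := hi.trans (FormMod.model_zero hv hε)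
  have hc := FormMod.count (F := F) (X := X) hQ'.1 hv hi0 rfl
    (fun p => p.1.IsNondegenerateFormSpace ∧ p.1.mem_oLie p.2 ∧ IsNilpotent p.2 ∧
            QuadraticForm.IsScalarExtension p.1 p.2 Q' T')
    (fun p => by
      have := FormMod.SE_iff (FormMod.mk p) X
      exact ⟨fun ⟨a, b, c, d⟩ => ⟨a, b, c, this.2 d⟩, fun ⟨a, b, c, d⟩ => ⟨a, b, c, this.1 d⟩⟩)
  have hb := FormMod.brk_count hv hi0 hsymb
  have hr : Q'.polarRadical = ⊥ ↔ X.Nondef := FormMod.rad_bot X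
  constructor
  · intro hne
    have ho : o ≠ none := by
      rintro rfl
      exact hne (hr.2 (hi0.symm.nondef (FormMod.NF_none_nondef _)))
    rw [hb.2 ho]
    exact hc
  · intro heq
    have ho : o = none := by
      rcases o with _ | ⟨m, νs⟩
      · rfl
      · exfalso
        have h1 : FormMod.RadAt (FormMod.Tl (AlgebraicClosure F) (some (m, νs))) m :=
          FormMod.hs_radAt (FormMod.D_radAt m) νs
        exact ((FormMod.NF_radAt h1 _).iso hi0.symm).not_nondef (hr.1 heq)
    rw [hb.1 ho]
    exact hc
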